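/- Suppose that (a₁,a₂,a₃,a₄) is NOT equal, up to cyclic rotation and/or reversal, to any vector of the following forms (p, q, r ranging over positive integers): (p,p,p,p); (p,q,p+q,p+q) with p ≠ q; (p,q,r,p+q) with r ∉ {p, p+q}; (p,p,q,q+r) (here q = p is allowed). Then there exists a continuous Q₄ₙ-equivariant map F : S³ → M_D(α). -/

import Mathlib

noncomputable section

open scoped BigOperators

/-- The cyclic shift `σ(x₁,…,xₙ) = (x₂,…,xₙ,x₁)`, i.e. `(σ x) i = x (i+1)`. -/
def cyclicShift (n : ℕ) (x : Fin n → ℝ) : Fin n → ℝ := fun i => x (finRotate n i)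

/-- The reversal `τ(x₁,…,xₙ) = (xₙ,…,x₂,x₁)`. -/
def revShift (n : ℕ) (x : Fin n → ℝ) : Fin n → ℝ := fun i => x i.rev

/-- The hyperplane `Wₙ = {x ∈ ℝⁿ : x₁ + ⋯ + xₙ = 0}`. -/
def Wset (n : ℕ) : Set (Fin n → ℝ) := {x | ∑ i, x i = 0}

/-- The linear subspace `L(α) ⊆ Wₙ` cut out by the vanishing of the four consecutive
block sums of lengths `a₁, a₂, a₃, a₄`. -/
def Lset (n a₁ a₂ a₃ a₄ : ℕ) : Set (Fin n → ℝ) :=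
  {x | x ∈ Wset n ∧
    ∑ i ∈ Finset.univ.filter (fun i : Fin n => (i : ℕ) < a₁), x i = 0 ∧
    ∑ i ∈ Finset.univ.filter (fun i : Fin n => a₁ ≤ (i : ℕ) ∧ (i : ℕ) < a₁ + a₂), x i = 0 ∧
    ∑ i ∈ Finset.univ.filter
      (fun i : Fin n => a₁ + a₂ ≤ (i : ℕ) ∧ (i : ℕ) < a₁ + a₂ + a₃), x i = 0 ∧
    ∑ i ∈ Finset.univ.filter (fun i : Fin n => a₁ + a₂ + a₃ ≤ (i : ℕ)), x i = 0}

/-- The union `⋃ A_D(α)` of the smallest family of linear subspaces containing `L(α)`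
that is invariant under the cyclic shift `σ` and the reversal `τ`; it consists of the
subspaces `σᵏ·L(α)` and `σᵏ·(τ·L(α))`, `0 ≤ k < n`. -/
def dihArrangementUnion (n a₁ a₂ a₃ a₄ : ℕ) : Set (Fin n → ℝ) :=
  (⋃ k ∈ Finset.range n, (cyclicShift n)^[k] '' Lset n a₁ a₂ a₃ a₄) ∪
  (⋃ k ∈ Finset.range n, (cyclicShift n)^[k] '' (revShift n '' Lset n a₁ a₂ a₃ a₄))

/-- The complement `M_D(α) = Wₙ \ ⋃ A_D(α)`. -/
def Mdih (n a₁ a₂ a₃ a₄ : ℕ) : Set (Fin n → ℝ) :=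
  Wset n \ dihArrangementUnion n a₁ a₂ a₃ a₄

/-- The quaternion `ε = cos(π/n) + i·sin(π/n)`. -/
def epsQ (n : ℕ) : Quaternion ℝ :=
  ⟨Real.cos (Real.pi / n), Real.sin (Real.pi / n), 0, 0⟩

/-- The quaternion `j`. -/
def jQ : Quaternion ℝ := ⟨0, 0, 1, 0⟩

lemma norm_epsQ (n : ℕ) : ‖epsQ n‖ = 1 := by
  have h : Quaternion.normSq (epsQ n) = 1 := by
    rw [Quaternion.normSq_def']
    show Real.cos (Real.pi / n) ^ 2 + Real.sin (Real.pi / n) ^ 2 + 0 ^ 2 + 0 ^ 2 = 1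
    have := Real.cos_sq_add_sin_sq (Real.pi / n)
    nlinarith
  have h2 := Quaternion.normSq_eq_norm_mul_self (epsQ n)
  rw [h] at h2
  nlinarith [norm_nonneg (epsQ n)]

lemma norm_jQ : ‖jQ‖ = 1 := by
  have h : Quaternion.normSq jQ = 1 := by
    rw [Quaternion.normSq_def']
    show (0:ℝ) ^ 2 + 0 ^ 2 + 1 ^ 2 + 0 ^ 2 = 1
    norm_num
  have h2 := Quaternion.normSq_eq_norm_mul_self jQ
  rw [h] at h2
  nlinarith [norm_nonneg jQ]

/-- The sphere `S³` of unit quaternions. -/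
abbrev UnitQuat : Type := {q : Quaternion ℝ // ‖q‖ = 1}

/-- Existence of a continuous `Q₄ₙ`-equivariant map `S³ → M_D(α)`: equivariance with respect
to the generators `ε` (acting on `Wₙ` as `σ`) and `j` (acting as `τ`). -/
def ExistsQuatEquivariantMap (n a₁ a₂ a₃ a₄ : ℕ) : Prop :=
  ∃ F : UnitQuat → {x : Fin n → ℝ // x ∈ Mdih n a₁ a₂ a₃ a₄},
    Continuous F ∧
    (∀ q : UnitQuat,
      (F ⟨epsQ n * q.1, by rw [norm_mul, norm_epsQ, q.2, one_mul]⟩).1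
        = cyclicShift n (F q).1) ∧
    (∀ q : UnitQuat,
      (F ⟨jQ * q.1, by rw [norm_mul, norm_jQ, q.2, one_mul]⟩).1
        = revShift n (F q).1)

/-- The eight rearrangements of a quadruple under cyclic rotation and/or reversal. -/
def dihedralVersions (a₁ a₂ a₃ a₄ : ℕ) : List (ℕ × ℕ × ℕ × ℕ) :=
  [(a₁, a₂, a₃, a₄), (a₂, a₃, a₄, a₁), (a₃, a₄, a₁, a₂), (a₄, a₁, a₂, a₃),
   (a₄, a₃, a₂, a₁), (a₃, a₂, a₁, a₄), (a₂, a₁, a₄, a₃), (a₁, a₄, a₃, a₂)]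

/-- The excluded shapes of quadruples: `(p,p,p,p)`; `(p,q,p+q,p+q)` with `p ≠ q`;
`(p,q,r,p+q)` with `r ∉ {p, p+q}`; `(p,p,q,q+r)`; here `p, q, r` range over positive
integers (and `q = p` is allowed in the last form). -/
def ExcludedShape (b : ℕ × ℕ × ℕ × ℕ) : Prop :=
  (∃ p : ℕ, 0 < p ∧ b = (p, p, p, p)) ∨
  (∃ p q : ℕ, 0 < p ∧ 0 < q ∧ p ≠ q ∧ b = (p, q, p + q, p + q)) ∨
  (∃ p q r : ℕ, 0 < p ∧ 0 < q ∧ 0 < r ∧ r ≠ p ∧ r ≠ p + q ∧ b = (p, q, r, p + q)) ∨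
  (∃ p q r : ℕ, 0 < p ∧ 0 < q ∧ 0 < r ∧ b = (p, p, q, q + r))

/-- The unit complex number `exp (π i t / n)`. -/
def rot (n : ℕ) (t : ℝ) : ℂ := Complex.exp ((t * Real.pi / n : ℝ) * Complex.I)

/-- Left multiplication by `j` on `S³ ⊆ ℂ²`, where `(z, w)` stands for `z + w j`. -/
def jmap (q : ℂ × ℂ) : ℂ × ℂ := (-(starRingEnd ℂ) q.2, (starRingEnd ℂ) q.1)

lemma rot_zero (n : ℕ) : rot n 0 = 1 := by simp [rot]

lemma rot_add (n : ℕ) (s t : ℝ) : rot n (s + t) = rot n s * rot n t := by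
  rw [rot, rot, rot, ← Complex.exp_add]
  congr 1
  push_cast
  ring

lemma rot_self {n : ℕ} (hn : 0 < n) : rot n n = -1 := by
  have : (n : ℝ) ≠ 0 := by positivity
  rw [rot, mul_div_assoc, mul_div_cancel₀ _ this, Complex.exp_pi_mul_I]

lemma norm_rot (n : ℕ) (t : ℝ) : ‖rot n t‖ = 1 := Complex.norm_exp_ofReal_mul_I _

lemma rot_ne_zero (n : ℕ) (t : ℝ) : rot n t ≠ 0 := Complex.exp_ne_zero _

lemma conj_rot (n : ℕ) (t : ℝ) : (starRingEnd ℂ) (rot n t) = rot n (-t) := by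
  rw [rot, rot, ← Complex.exp_conj]
  congr 1
  simp
  ring

lemma rot_neg_mul (n : ℕ) (t : ℝ) : rot n (-t) * rot n t = 1 := by
  rw [← rot_add, neg_add_cancel, rot_zero]

lemma continuous_jmap : Continuous jmap := by unfold jmap; fun_prop

lemma jmap_smul (c : ℂ) (q : ℂ × ℂ) : jmap (c • q) = (starRingEnd ℂ) c • jmap q := by
  simp [jmap]

lemma jmap_jmap (q : ℂ × ℂ) : jmap (jmap q) = -q := by
  simp [jmap, Prod.ext_iff]

lemma jmap_eq_zero {q : ℂ × ℂ} : jmap q = 0 ↔ q = 0 := by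
  simp [jmap, Prod.ext_iff, and_comm]

/-- `S` admits a continuous function `H` on `ℂ²`, antisymmetric under `j`, which is nowhere
constant on the points `εˢ q`, `s ∈ S`. -/
def Separable4 (n : ℕ) (S : Set ℤ) : Prop :=
  ∃ H : ℂ × ℂ → ℝ, Continuous H ∧ (∀ q, H (jmap q) = -H q) ∧
    ∀ q ≠ 0, ¬ ∀ s ∈ S, ∀ t ∈ S, H (rot n s • q) = H (rot n t • q)

lemma apply_neg_of_jmap {H : ℂ × ℂ → ℝ} (hj : ∀ q, H (jmap q) = -H q) (q : ℂ × ℂ) :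
    H (-q) = H q := by
  rw [← jmap_jmap, hj, hj, neg_neg]

lemma apply_rot_add_mul {n : ℕ} (hn : 0 < n) {H : ℂ × ℂ → ℝ} (hj : ∀ q, H (-q) = H q)
    (t : ℝ) (k : ℤ) (q : ℂ × ℂ) : H (rot n (t + n * k) • q) = H (rot n t • q) := by
  have step : ∀ t : ℝ, ∀ q, H (rot n (t + n) • q) = H (rot n t • q) := by
    intro t q
    rw [rot_add, rot_self hn, mul_neg_one, neg_smul, hj]
  induction k with
  | zero => simp
  | succ k ih =>
    rw [← ih, ← step (t + n * (k : ℤ))]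
    congr 3
    push_cast
    ring
  | pred k ih =>
    rw [← ih, ← step (t + n * (-(k : ℤ) - 1 : ℤ))]
    congr 3
    push_cast
    ring

/-- Separability only depends on the set modulo `n`, up to translation and negation. -/
lemma Separable4.congr {n : ℕ} (hn : 0 < n) {S S' : Set ℤ} (h : Separable4 n S) (k e : ℤ)
    (he : e = 1 ∨ e = -1) (hS : ∀ t ∈ S, ∃ s ∈ S', (n : ℤ) ∣ (e * t + k) - s) :
    Separable4 n S' := by
  obtain ⟨H, hc, hj, hH⟩ := h
  refine ⟨H, hc, hj, fun q hq hall => ?_⟩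
  have hneg := apply_neg_of_jmap hj
  have key : ∀ s ∈ S, ∀ t ∈ S,
      H (rot n (e * s + k : ℤ) • q) = H (rot n (e * t + k : ℤ) • q) := by
    have aux : ∀ t ∈ S, ∃ s ∈ S', H (rot n (e * t + k : ℤ) • q) = H (rot n s • q) := by
      intro t ht
      obtain ⟨s, hs, m, hm⟩ := hS t ht
      refine ⟨s, hs, ?_⟩
      rw [← apply_rot_add_mul hn hneg s m]
      congr 3
      have : e * t + k = s + n * m := by linarith
      rw [this]; push_cast; ring
    intro s hs t ht
    obtain ⟨s', hs', h1⟩ := aux s hs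
    obtain ⟨t', ht', h2⟩ := aux t ht
    rw [h1, h2, hall s' hs' t' ht']
  rcases he with rfl | rfl
  · refine hH (rot n k • q) (smul_ne_zero (rot_ne_zero _ _) hq) fun s hs t ht => ?_
    have := key s hs t ht
    push_cast at this
    simpa [smul_smul, ← rot_add] using this
  · refine hH (jmap (rot n k • q))
      (mt jmap_eq_zero.1 (smul_ne_zero (rot_ne_zero _ _) hq)) fun s hs t ht => ?_
    have aux : ∀ s : ℤ, H (rot n s • jmap (rot n k • q)) = -H (rot n (-1 * s + k : ℤ) • q) := by
      intro s
      rw [← hj]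
      congr 1
      have : rot n (s : ℝ) = (starRingEnd ℂ) (rot n (-s)) := by rw [conj_rot, neg_neg]
      rw [this, ← jmap_smul, smul_smul, ← rot_add]
      push_cast
      ring_nf
    rw [aux, aux, key s hs t ht]

/-- The pair of complex numbers `(z, w)` with `q = z + w j`. -/
def toPair (q : Quaternion ℝ) : ℂ × ℂ := (⟨q.re, q.imI⟩, ⟨q.imJ, q.imK⟩)

lemma toPair_eps_mul (n : ℕ) (q : Quaternion ℝ) :
    toPair (epsQ n * q) = rot n 1 • toPair q := by
  have : rot n 1 = ⟨Real.cos (Real.pi / n), Real.sin (Real.pi / n)⟩ := by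
    rw [rot, one_mul, Complex.exp_mul_I, ← Complex.ofReal_cos, ← Complex.ofReal_sin]
    apply Complex.ext <;> simp [-Complex.ofReal_cos, -Complex.ofReal_sin]
  rw [this]
  refine Prod.ext (Complex.ext ?_ ?_) (Complex.ext ?_ ?_) <;>
    simp only [toPair, Quaternion.re_mul, Quaternion.imI_mul, Quaternion.imJ_mul,
      Quaternion.imK_mul, Prod.smul_fst, Prod.smul_snd, smul_eq_mul, Complex.mul_re,
      Complex.mul_im] <;>
    simp only [epsQ] <;> ring

lemma toPair_j_mul (q : Quaternion ℝ) : toPair (jQ * q) = jmap (toPair q) := by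
  refine Prod.ext (Complex.ext ?_ ?_) (Complex.ext ?_ ?_) <;>
    simp [toPair, Quaternion.re_mul, Quaternion.imI_mul, Quaternion.imJ_mul,
      Quaternion.imK_mul, jmap] <;> simp [jQ]

lemma toPair_ne_zero {q : Quaternion ℝ} (hq : ‖q‖ = 1) : toPair q ≠ 0 := by
  intro h
  have : q = 0 := by
    simp only [toPair, Prod.ext_iff, Complex.ext_iff, Prod.fst_zero, Prod.snd_zero,
      Complex.zero_re, Complex.zero_im] at h
    ext <;> simp only [h] <;> rfl
  simp [this] at hq

lemma continuous_toPair : Continuous toPair := by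
  have h : ∀ f g : Quaternion ℝ → ℝ, Continuous f → Continuous g →
      Continuous fun q => (⟨f q, g q⟩ : ℂ) := by
    intro f g hf hg
    have : (fun q => (⟨f q, g q⟩ : ℂ)) = fun q => (f q : ℂ) + g q * Complex.I := by
      funext q; apply Complex.ext <;> simp
    rw [this]
    fun_prop
  exact (h _ _ Quaternion.continuous_re Quaternion.continuous_imI).prodMk
    (h _ _ Quaternion.continuous_imJ Quaternion.continuous_imK)

lemma cyclicShift_injective (n : ℕ) : Function.Injective (cyclicShift n) := by
  intro x y h
  funext i
  have := congrFun h ((finRotate n).symm i)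
  simpa only [cyclicShift, Equiv.apply_symm_apply] using this

lemma revShift_revShift (n : ℕ) (x : Fin n → ℝ) : revShift n (revShift n x) = x := by
  funext i; simp [revShift]

lemma finRotate_val {n : ℕ} (i : Fin n) :
    (i.1 + 1 < n ∧ (finRotate n i).1 = i.1 + 1) ∨ (i.1 + 1 = n ∧ (finRotate n i).1 = 0) := by
  rcases n with _ | m
  · exact i.elim0
  · rcases Nat.lt_or_ge i.1 m with h | h
    · left
      exact ⟨by omega, by rw [finRotate_of_lt h]⟩
    · right
      have : i = Fin.last m := Fin.ext (by simp; omega)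
      subst this
      simp

/-- Summing consecutive differences over an interval of indices telescopes. -/
lemma sum_filter_sub {n : ℕ} (f : ℕ → ℝ) {a b : ℕ} (hab : a ≤ b) (hb : b ≤ n) :
    ∑ i ∈ Finset.univ.filter (fun i : Fin n => a ≤ (i : ℕ) ∧ (i : ℕ) < b),
      (f (i + 1) - f i) = f b - f a := by
  rw [← Finset.sum_Ico_sub f hab]
  refine Finset.sum_bij (fun i _ => (i : ℕ)) ?_ ?_ ?_ ?_
  · intro i hi; simpa using hi
  · intro i _ j _ h; exact Fin.ext h
  · intro j hj
    have hj' := Finset.mem_Ico.1 hj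
    exact ⟨⟨j, by omega⟩, by simpa using hj', rfl⟩
  · intro i _; rfl

lemma exists_map_of_separable {n a₁ a₂ a₃ a₄ : ℕ} (hn : 1 ≤ n) (hsum : a₁ + a₂ + a₃ + a₄ = n)
    (h : Separable4 n {0, (a₁ : ℤ), (a₁ + a₂ : ℤ), (a₁ + a₂ + a₃ : ℤ)}) :
    ExistsQuatEquivariantMap n a₁ a₂ a₃ a₄ := by
  obtain ⟨H, hc, hj, hH⟩ := h
  have hneg := apply_neg_of_jmap hj
  set f : ℂ × ℂ → ℕ → ℝ := fun q k => H (rot n k • q) with hf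
  have fn : ∀ q, f q n = f q 0 := by
    intro q
    simp only [hf]
    rw [rot_self hn, neg_one_smul, hneg, Nat.cast_zero, rot_zero, one_smul]
  set G : ℂ × ℂ → Fin n → ℝ := fun q i => f q (i + 1) - f q i with hG
  have Gc : Continuous G := by
    refine continuous_pi fun i => ?_
    simp only [hG, hf]
    fun_prop
  have feps : ∀ q k, f (rot n 1 • q) k = f q (k + 1) := by
    intro q k
    simp only [hf, smul_smul, ← rot_add]
    push_cast
    rfl
  have Geps : ∀ q, G (rot n 1 • q) = cyclicShift n (G q) := by
    intro q
    funext i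
    simp only [hG, cyclicShift, feps]
    rcases finRotate_val i with ⟨_, h2⟩ | ⟨h1, h2⟩
    · rw [h2]
    · rw [h2, h1, fn]
      have : f q (n + 1) = f q 1 := by
        rw [← feps, fn, feps]
      rw [this]
  have Gj : ∀ q, G (jmap q) = revShift n (G q) := by
    have fj : ∀ q (k : ℕ), k ≤ n → f (jmap q) k = -f q (n - k) := by
      intro q k hk
      simp only [hf]
      have : rot n (k : ℝ) = (starRingEnd ℂ) (rot n (-k)) := by rw [conj_rot, neg_neg]
      rw [this, ← jmap_smul, hj]
      have h1 := apply_rot_add_mul hn hneg (-k) 1 q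
      rw [← h1, Nat.cast_sub hk]
      congr 4
      push_cast
      ring
    intro q
    funext i
    have hi := i.2
    simp only [hG, revShift, Fin.val_rev]
    rw [fj q _ (by omega), fj q _ (by omega)]
    have e1 : n - (i.1 + 1) + 1 = n - i.1 := by omega
    rw [e1]
    ring
  have GW : ∀ q, G q ∈ Wset n := by
    intro q
    have := sum_filter_sub (n := n) (f q) (Nat.zero_le n) le_rfl
    simp only [Nat.zero_le, Fin.is_lt, and_self, Finset.filter_true] at this
    simp only [Wset, Set.mem_ofPred_eq, hG]
    rw [this, fn, sub_self]
  have G_notMem : ∀ q ≠ 0, G q ∉ Lset n a₁ a₂ a₃ a₄ := by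
    rintro q hq ⟨-, h1, h2, h3, -⟩
    refine hH q hq ?_
    have e1 := sum_filter_sub (n := n) (f q) (Nat.zero_le a₁) (by omega)
    simp only [Nat.zero_le, true_and] at e1
    have e2 := sum_filter_sub (n := n) (f q) (Nat.le_add_right a₁ a₂) (by omega)
    have e3 := sum_filter_sub (n := n) (f q) (Nat.le_add_right (a₁ + a₂) a₃) (by omega)
    simp only [hG] at h1 h2 h3
    rw [h1] at e1
    rw [h2] at e2
    rw [h3] at e3
    have hall : ∀ s ∈ ({0, (a₁ : ℤ), (a₁ + a₂ : ℤ), (a₁ + a₂ + a₃ : ℤ)} : Set ℤ),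
        H (rot n s • q) = f q 0 := by
      intro s hs
      simp only [hf] at e1 e2 e3 ⊢
      push_cast at e1 e2 e3 ⊢
      rcases hs with rfl | rfl | rfl | rfl <;> push_cast <;> linarith
    intro s hs t ht
    rw [hall s hs, hall t ht]
  have Giter : ∀ k q x, (cyclicShift n)^[k] x = G q → ∃ q', (q ≠ 0 → q' ≠ 0) ∧ x = G q' := by
    intro k
    induction k with
    | zero => intro q x h; exact ⟨q, id, h⟩
    | succ k ih =>
      intro q x h
      rw [Function.iterate_succ_apply'] at h
      have h2 : (cyclicShift n)^[k] x = G (rot n (-1) • q) := by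
        apply cyclicShift_injective n
        rw [h, ← Geps, smul_smul, mul_comm, rot_neg_mul, one_smul]
      obtain ⟨q', h3, h4⟩ := ih _ _ h2
      exact ⟨q', fun hq => h3 (smul_ne_zero (rot_ne_zero _ _) hq), h4⟩
  have GM : ∀ q ≠ 0, G q ∈ Mdih n a₁ a₂ a₃ a₄ := by
    intro q hq
    refine ⟨GW q, ?_⟩
    rintro (h | h)
    · simp only [Set.mem_iUnion] at h
      obtain ⟨k, _, x, hx, hxq⟩ := h
      obtain ⟨q', h3, rfl⟩ := Giter k q x hxq
      exact G_notMem q' (h3 hq) hx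
    · simp only [Set.mem_iUnion] at h
      obtain ⟨k, _, y, ⟨x, hx, rfl⟩, hxq⟩ := h
      obtain ⟨q', h3, h4⟩ := Giter k q _ hxq
      have : x = G (jmap q') := by
        rw [Gj, ← h4, revShift_revShift]
      rw [this] at hx
      exact G_notMem _ (mt jmap_eq_zero.1 (h3 hq)) hx
  refine ⟨fun q => ⟨G (toPair q.1), GM _ (toPair_ne_zero q.2)⟩, ?_, ?_, ?_⟩
  · exact (Gc.comp (continuous_toPair.comp continuous_subtype_val)).subtype_mk _
  · intro q
    change G (toPair (epsQ n * q.1)) = _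
    rw [toPair_eps_mul, Geps]
  · intro q
    change G (toPair (jQ * q.1)) = _
    rw [toPair_j_mul, Gj]

/-- If `Ψ` is nowhere constant along `S` and along `-S`, then gluing two copies of it over the
two solid tori `|z| ≥ |w|` and `|z| ≤ |w|` separates `S`. -/
lemma separable_of_half {n : ℕ} {S : Set ℤ} (Ψ : ℂ → ℂ → ℝ)
    (hc : Continuous fun x : ℂ × ℂ => Ψ x.1 x.2)
    (h0 : ∀ p, Ψ (-(starRingEnd ℂ) p) 0 = -Ψ p 0)
    (hS : ∀ e : ℤ, e = 1 ∨ e = -1 → ∀ p y, (p, y) ≠ (0 : ℂ × ℂ) →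
      ¬ ∀ s ∈ S, ∀ t ∈ S,
        Ψ (rot n (2 * (e * s : ℤ)) * p) (rot n (2 * (e * s : ℤ)) * y) =
        Ψ (rot n (2 * (e * t : ℤ)) * p) (rot n (2 * (e * t : ℤ)) * y)) :
    Separable4 n S := by
  set P : ℂ × ℂ → ℂ := fun q => q.1 * q.2 with hP
  set Y : ℂ × ℂ → ℂ := fun q => (max 0 (‖q.1‖ ^ 2 - ‖q.2‖ ^ 2) : ℝ) * q.1 ^ 2 with hY
  have Pc : Continuous P := by fun_prop
  have Yc : Continuous Y := by fun_prop
  have Pj : ∀ q, P (jmap q) = -(starRingEnd ℂ) (P q) := by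
    intro q; simp only [hP, jmap, map_mul]; ring
  have Y0 : ∀ q : ℂ × ℂ, ‖q.1‖ ≤ ‖q.2‖ → Y q = 0 := by
    intro q h
    have : ‖q.1‖ ^ 2 ≤ ‖q.2‖ ^ 2 := by gcongr
    simp only [hY]
    rw [max_eq_left (by linarith)]
    simp
  have Yj0 : ∀ q : ℂ × ℂ, ‖q.2‖ ≤ ‖q.1‖ → Y (jmap q) = 0 := by
    intro q h
    exact Y0 _ (by simpa [jmap] using h)
  have Yneg : ∀ q, Y (-q) = Y q := by intro q; simp [hY]
  have Pneg : ∀ q, P (-q) = P q := by intro q; simp [hP]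
  have hne : ∀ q : ℂ × ℂ, q ≠ 0 → ‖q.2‖ ≤ ‖q.1‖ → (P q, Y q) ≠ (0 : ℂ × ℂ) := by
    rintro ⟨z, w⟩ hq hle h
    simp only [hP, hY, Prod.mk_eq_zero] at h hle
    obtain ⟨h1, h2⟩ := h
    have hz : z ≠ 0 := by
      rintro rfl
      simp only [norm_zero, norm_le_zero_iff] at hle
      exact hq (by simp [hle])
    have hw : w = 0 := by simpa [hz] using h1
    subst hw
    have : (0 : ℝ) < ‖z‖ ^ 2 := by positivity
    simp [hz] at h2
  have Prot : ∀ (s : ℤ) q, P (rot n s • q) = rot n (2 * (1 * s : ℤ)) * P q := by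
    intro s q
    have : rot n (2 * (1 * s : ℤ)) = rot n s * rot n s := by
      rw [← rot_add]; push_cast; ring_nf
    rw [this]; simp only [hP, Prod.smul_fst, Prod.smul_snd, smul_eq_mul]; ring
  have Yrot : ∀ (s : ℤ) q, Y (rot n s • q) = rot n (2 * (1 * s : ℤ)) * Y q := by
    intro s q
    have : rot n (2 * (1 * s : ℤ)) = rot n s * rot n s := by
      rw [← rot_add]; push_cast; ring_nf
    rw [this]
    simp only [hY, Prod.smul_fst, Prod.smul_snd, smul_eq_mul, norm_mul, norm_rot, one_mul]
    ring
  have jrot : ∀ (s : ℤ) q, jmap (rot n s • q) = rot n (-s : ℤ) • jmap q := by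
    intro s q
    rw [jmap_smul, conj_rot]; push_cast; rfl
  set H : ℂ × ℂ → ℝ := fun q =>
    Ψ (P q) (Y q) - Ψ (P (jmap q)) (Y (jmap q)) - Ψ (P q) 0 with hH
  have H1 : ∀ q : ℂ × ℂ, ‖q.2‖ ≤ ‖q.1‖ → H q = Ψ (P q) (Y q) := by
    intro q h
    simp only [hH]
    rw [Yj0 q h, Pj, h0]; ring
  have Hj : ∀ q, H (jmap q) = -H q := by
    intro q
    simp only [hH, jmap_jmap, Yneg, Pneg]
    rw [Pj, h0]; ring
  refine ⟨H, ?_, Hj, ?_⟩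
  · have h1 : Continuous fun q => Ψ (P q) (Y q) := hc.comp (Pc.prodMk Yc)
    have h2 : Continuous fun q => Ψ (P q) 0 := hc.comp (Pc.prodMk continuous_const)
    exact (h1.sub (h1.comp continuous_jmap)).sub h2
  · intro q hq hall
    rcases le_total ‖q.2‖ ‖q.1‖ with h | h
    · refine hS 1 (Or.inl rfl) (P q) (Y q) (hne q hq h) fun s hs t ht => ?_
      have := hall s hs t ht
      rw [H1 _ (by simpa [norm_rot] using h), H1 _ (by simpa [norm_rot] using h),
        Prot, Prot, Yrot, Yrot] at this
      exact this
    · have h' : ‖(jmap q).2‖ ≤ ‖(jmap q).1‖ := by simpa [jmap] using h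
      refine hS (-1) (Or.inr rfl) (P (jmap q)) (Y (jmap q))
        (hne _ (mt jmap_eq_zero.1 hq) h') fun s hs t ht => ?_
      have := hall s hs t ht
      rw [← neg_inj, ← Hj, ← Hj, jrot, jrot, H1 _ (by simpa [norm_rot] using h'),
        H1 _ (by simpa [norm_rot] using h'), Prot, Prot, Yrot, Yrot] at this
      simpa using this

lemma rot_int_mul (n : ℕ) (k : ℤ) (t : ℝ) : rot n (k * t) = rot n t ^ k := by
  rw [rot, rot, ← Complex.exp_int_mul]
  congr 1
  push_cast
  ring

lemma rot_third {p : ℕ} (hp : 0 < p) (e : ℤ) (he : e = 1 ∨ e = -1) :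
    ∃ s : ℝ, s ^ 2 = 3 ∧ (s = √3 ∨ s = -√3) ∧ rot (6 * p) (2 * (e * p)) = ⟨1 / 2, s / 2⟩ := by
  have hp' : (p : ℝ) ≠ 0 := by positivity
  have h1 : rot (6 * p) (2 * p) = ⟨1 / 2, √3 / 2⟩ := by
    have : (2 * (p : ℝ) * Real.pi / (6 * p : ℕ) : ℝ) = Real.pi / 3 := by
      push_cast; field_simp; ring
    rw [rot, this, Complex.exp_mul_I, ← Complex.ofReal_cos, ← Complex.ofReal_sin,
      Real.cos_pi_div_three, Real.sin_pi_div_three]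
    apply Complex.ext <;> simp
  rcases he with rfl | rfl
  · exact ⟨√3, by norm_num, Or.inl rfl, by simpa using h1⟩
  · refine ⟨-√3, by norm_num, Or.inr rfl, ?_⟩
    have : (2 * ((-1 : ℤ) * p : ℝ)) = -(2 * p) := by push_cast; ring
    rw [this, ← conj_rot, h1]
    apply Complex.ext <;> simp
    ring

/-- The set `{0, p, 3 p, 4 p}` modulo `6 p`. -/
lemma separable_rectangle_one_two {p : ℕ} (hp : 0 < p) :
    Separable4 (6 * p) {0, (p : ℤ), 3 * (p : ℤ), 4 * (p : ℤ)} := by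
  set a : ℂ → ℂ → ℝ := fun x y =>
    x.re * (‖x‖ ^ 2 + ‖y‖ ^ 2) + (y ^ 3 + 3 * y ^ 2 * x).re with ha
  set b : ℂ → ℂ → ℝ := fun x y => (y ^ 2 + y * x).im with hb
  obtain ⟨s, hs2, -, hs⟩ := rot_third hp 1 (Or.inl rfl)
  set c : ℂ := rot (6 * p) (2 * ((1 : ℤ) * p)) with hc
  have hcn : ‖c‖ = 1 := norm_rot _ _
  have c2 : c ^ 2 = c - 1 := by
    rw [hs]
    apply Complex.ext
    · simp [pow_two]; linear_combination (-1 / 4) * hs2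
    · simp [pow_two]; ring
  have c3 : c ^ 3 = -1 := by linear_combination (c + 1) * c2
  have aneg : ∀ x y, a (-x) (-y) = -a x y := by
    intro x y
    simp only [ha, norm_neg]
    rw [show (-y) ^ 3 + 3 * (-y) ^ 2 * (-x) = -(y ^ 3 + 3 * y ^ 2 * x) by ring,
      Complex.neg_re, Complex.neg_re]
    ring
  have bneg : ∀ x y, b (-x) (-y) = b x y := by
    intro x y
    simp only [hb]
    congr 1
    ring
  have main : ∀ x y : ℂ, (x, y) ≠ (0 : ℂ × ℂ) →
      a x y = 0 → a (c * x) (c * y) = 0 → b x y ≠ b (c * x) (c * y) := by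
    intro x y hne h1 h2 h3
    simp only [ha, hb, norm_mul, hcn, one_mul] at h1 h2 h3
    have hN : 0 < ‖x‖ ^ 2 + ‖y‖ ^ 2 := by
      rcases eq_or_ne x 0 with rfl | hx
      · rcases eq_or_ne y 0 with rfl | hy
        · exact absurd rfl hne
        · positivity
      · positivity
    rw [show (c * y) ^ 3 + 3 * (c * y) ^ 2 * (c * x) = -(y ^ 3 + 3 * y ^ 2 * x) by
      linear_combination (y ^ 3 + 3 * y ^ 2 * x) * c3, Complex.neg_re] at h2
    have h4 : x.re + (c * x).re = 0 := by
      have : (x.re + (c * x).re) * (‖x‖ ^ 2 + ‖y‖ ^ 2) = 0 := by linear_combination h1 + h2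
      exact (mul_eq_zero.1 this).resolve_right hN.ne'
    obtain ⟨t, rfl⟩ : ∃ t : ℝ, x = t * c := by
      refine ⟨2 * x.re, ?_⟩
      rw [hs] at h4 ⊢
      simp at h4
      apply Complex.ext
      · simp; ring
      · simp
        have : s * (s * x.re - x.im) = 0 := by linear_combination x.re * hs2 + 2 * h4
        rcases mul_eq_zero.1 this with h | h
        · rw [h] at hs2; norm_num at hs2
        · linarith
    obtain ⟨Y, rfl⟩ : ∃ Y : ℂ, y = c * Y :=
      ⟨c⁻¹ * y, by rw [mul_inv_cancel_left₀ (by rw [← norm_ne_zero_iff, hcn]; norm_num)]⟩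
    have e1 : (c * Y) ^ 3 + 3 * (c * Y) ^ 2 * (t * c) = -(Y ^ 3 + 3 * t * Y ^ 2) := by
      linear_combination (Y ^ 3 + 3 * t * Y ^ 2) * c3
    have e2 : (c * Y) ^ 2 + c * Y * (t * c) = (c - 1) * (Y ^ 2 + t * Y) := by
      linear_combination (Y ^ 2 + t * Y) * c2
    have e3 : (c * (c * Y)) ^ 2 + c * (c * Y) * (c * (t * c)) = -c * (Y ^ 2 + t * Y) := by
      linear_combination (Y ^ 2 + t * Y) * c * c3
    rw [e2, e3] at h3
    rw [e1] at h1
    simp only [norm_mul, hcn, one_mul, mul_one, Complex.norm_real, Real.norm_eq_abs, sq_abs,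
      Complex.sq_norm, Complex.normSq_apply] at h1
    obtain ⟨X, V⟩ := Y
    rw [hs] at h1 h3
    simp [pow_succ] at h1 h3
    have hV : V ^ 2 = X ^ 2 + t * X := by
      have : s * (X ^ 2 + t * X - V ^ 2) = 0 := by linear_combination h3
      rcases mul_eq_zero.1 this with h | h
      · rw [h] at hs2; norm_num at hs2
      · linarith
    have h5 : 2 * X * (X + t) ^ 2 + 3 / 2 * t ^ 2 * X + t ^ 3 / 2 = 0 := by
      linear_combination h1 - (3 * X + 3 * t + t / 2) * hV
    have h6 : 2 * V ^ 2 * (V ^ 2 + (X + t) ^ 2) +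
        t ^ 2 * (V ^ 2 + (2 * X ^ 2 + 3 / 2 * t * X + t ^ 2 / 2)) = 0 := by
      linear_combination (2 * X + t) * h5 +
        (2 * (V ^ 2 + X ^ 2 + t * X) + 2 * (X + t) ^ 2 + t ^ 2) * hV
    have ht : t = 0 := by
      by_contra ht
      have : 0 < t ^ 2 := by positivity
      have h7 : 0 < 2 * X ^ 2 + 3 / 2 * t * X + t ^ 2 / 2 := by
        nlinarith [sq_nonneg (2 * X + 3 / 4 * t)]
      have h8 : 0 < t ^ 2 * (V ^ 2 + (2 * X ^ 2 + 3 / 2 * t * X + t ^ 2 / 2)) := by positivity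
      have h9 : 0 ≤ 2 * V ^ 2 * (V ^ 2 + (X + t) ^ 2) := by positivity
      linarith
    subst ht
    have hX : X = 0 := by
      have : X ^ 3 = 0 := by linear_combination h5 / 2
      exact pow_eq_zero_iff (by norm_num) |>.1 this
    subst hX
    have hV0 : V = 0 := by
      have : V ^ 2 = 0 := by linear_combination hV
      exact pow_eq_zero_iff (by norm_num) |>.1 this
    subst hV0
    apply hne
    simp [Complex.ext_iff]
  have key : ∀ x y : ℂ, (x, y) ≠ (0 : ℂ × ℂ) →
      a x y - b x y = a (-x) (-y) - b (-x) (-y) →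
      a (c * x) (c * y) - b (c * x) (c * y) = a (-(c * x)) (-(c * y)) - b (-(c * x)) (-(c * y)) →
      a x y - b x y = a (c * x) (c * y) - b (c * x) (c * y) → False := by
    intro x y hne h1 h2 h3
    rw [aneg, bneg] at h1 h2
    refine main x y hne (by linarith) (by linarith) (by linarith)
  have hr : ∀ k : ℤ, rot (6 * p) (2 * (k * p : ℤ)) = c ^ k := by
    intro k
    rw [hc, ← rot_int_mul]
    push_cast
    ring_nf
  refine separable_of_half (fun x y => a x y - b x y) (by fun_prop) ?_ ?_
  · intro x
    simp [ha, hb]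
  · intro e he x y hne hall
    have c4 : c ^ 4 = -c := by linear_combination c * c3
    have m0 : (0 : ℤ) ∈ ({0, (p : ℤ), 3 * (p : ℤ), 4 * (p : ℤ)} : Set ℤ) := by simp
    have m1 : (p : ℤ) ∈ ({0, (p : ℤ), 3 * (p : ℤ), 4 * (p : ℤ)} : Set ℤ) := by simp
    have m3 : 3 * (p : ℤ) ∈ ({0, (p : ℤ), 3 * (p : ℤ), 4 * (p : ℤ)} : Set ℤ) := by simp
    have m4 : 4 * (p : ℤ) ∈ ({0, (p : ℤ), 3 * (p : ℤ), 4 * (p : ℤ)} : Set ℤ) := by simp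
    rcases he with rfl | rfl
    · have r0 : rot (6 * p) (2 * ((1 * 0 : ℤ) : ℝ)) = 1 := by
        have := hr 0; simpa using this
      have r1 : rot (6 * p) (2 * ((1 * p : ℤ) : ℝ)) = c := by
        have := hr 1; simpa using this
      have r3 : rot (6 * p) (2 * ((1 * (3 * p) : ℤ) : ℝ)) = -1 := by
        rw [one_mul, hr 3, ← c3]; rfl
      have r4 : rot (6 * p) (2 * ((1 * (4 * p) : ℤ) : ℝ)) = -c := by
        rw [one_mul, hr 4, ← c4]; rfl
      have h1 := hall _ m0 _ m3
      have h2 := hall _ m1 _ m4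
      have h3 := hall _ m0 _ m1
      rw [r0, r3] at h1
      rw [r1, r4] at h2
      rw [r0, r1] at h3
      exact key x y hne (by simpa using h1) (by simpa using h2) (by simpa using h3)
    · have hc0 : c ≠ 0 := by rw [← norm_ne_zero_iff, hcn]; norm_num
      have r0 : rot (6 * p) (2 * ((-1 * 0 : ℤ) : ℝ)) = -(c * c ^ 2) := by
        have := hr 0; rw [show c * c ^ 2 = -1 by rw [← c3]; ring]; simpa using this
      have r1 : rot (6 * p) (2 * ((-1 * p : ℤ) : ℝ)) = -c ^ 2 := by
        rw [hr (-1), zpow_neg_one]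
        field_simp
        linear_combination c3
      have r3 : rot (6 * p) (2 * ((-1 * (3 * p) : ℤ) : ℝ)) = c * c ^ 2 := by
        rw [← mul_assoc, hr (-1 * 3)]
        rw [show (-1 * 3 : ℤ) = -((3 : ℕ) : ℤ) by norm_num, zpow_neg, zpow_natCast, c3,
          show c * c ^ 2 = -1 by rw [← c3]; ring]
        norm_num
      have r4 : rot (6 * p) (2 * ((-1 * (4 * p) : ℤ) : ℝ)) = c ^ 2 := by
        rw [← mul_assoc, hr (-1 * 4)]
        rw [show (-1 * 4 : ℤ) = -((4 : ℕ) : ℤ) by norm_num, zpow_neg, zpow_natCast]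
        field_simp
        linear_combination -(c ^ 3 - 1) * c3
      have h1 := hall _ m4 _ m1
      have h2 := hall _ m3 _ m0
      have h3 := hall _ m4 _ m3
      rw [r4, r1] at h1
      rw [r3, r0] at h2
      rw [r4, r3] at h3
      refine key (c ^ 2 * x) (c ^ 2 * y) ?_ (by simpa using h1) ?_ ?_
      · simpa [Prod.ext_iff, hc0] using hne
      · rw [← mul_assoc, ← mul_assoc]; simpa using h2
      · rw [← mul_assoc, ← mul_assoc]; simpa using h3

/-- The set `{0, p, 2 p, 4 p}` modulo `6 p`. -/
lemma separable_kite_one_two {p : ℕ} (hp : 0 < p) :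
    Separable4 (6 * p) {0, (p : ℤ), 2 * (p : ℤ), 4 * (p : ℤ)} := by
  set h : ℂ → ℂ → ℂ → ℝ := fun x C u => (u * x).re + (u ^ 2 * C).re with hh
  set o : ℂ := ⟨1 / 2, √3 / 2⟩ with ho
  set o' : ℂ := ⟨1 / 2, -√3 / 2⟩ with ho'
  set D : ℂ → ℂ → ℝ := fun x C =>
    |h x C o - h x C (-1)| + |h x C (-1) - h x C o'| + |h x C o - h x C o'| with hD
  set F : ℂ → ℂ → ℝ := fun x C => (‖x‖ + ‖C‖) * h x C 1 - 3 * ‖C‖ * D x C with hF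
  have h_mul : ∀ x C u v, h (u * x) (u ^ 2 * C) v = h x C (u * v) := by
    intro x C u v
    simp only [hh]
    congr 2 <;> ring
  have main : ∀ x C : ℂ, (x, C) ≠ (0 : ℂ × ℂ) → ∀ s : ℝ, s ^ 2 = 3 → (s = √3 ∨ s = -√3) →
      ∀ c : ℂ, c = ⟨1 / 2, s / 2⟩ → c ^ 2 = c - 1 → ‖c‖ = 1 →
      F x C = F (c ^ 2 * x) ((c ^ 2) ^ 2 * C) → F x C = F (-c * x) ((-c) ^ 2 * C) →
      F x C = F (c * x) (c ^ 2 * C) → False := by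
    intro x C hne s hs2 hs c hc c2 hcn h1 h2 h3
    have D_eq : ∀ x C, D x C = |h x C c - h x C (-1)| +
        |h x C (-1) - h x C (1 - c)| + |h x C c - h x C (1 - c)| := by
      intro x C
      have hoo : 1 - o = o' := by
        apply Complex.ext
        · simp [ho, ho']; norm_num
        · simp [ho, ho']; ring
      rcases hs with rfl | rfl
      · rw [show c = o from hc, hoo]
      · have : c = o' := by rw [hc]
        rw [this, ← hoo, sub_sub_cancel]
        simp only [hD, hoo]
        rw [abs_sub_comm (h x C o) (h x C (-1)), abs_sub_comm (h x C (-1)) (h x C o'),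
          abs_sub_comm (h x C o) (h x C o')]
        ring
    have F_mul : ∀ u, ‖u‖ = 1 → F (u * x) (u ^ 2 * C) = (‖x‖ + ‖C‖) * h x C u -
        3 * ‖C‖ * (|h x C (u * c) - h x C (u * -1)| + |h x C (u * -1) - h x C (u * (1 - c))| +
          |h x C (u * c) - h x C (u * (1 - c))|) := by
      intro u hu
      simp only [hF, D_eq, h_mul, norm_mul, norm_pow, hu, mul_one, one_mul, one_pow]
    have hN : 0 < ‖x‖ + ‖C‖ := by
      rcases eq_or_ne x 0 with rfl | hx
      · rcases eq_or_ne C 0 with rfl | hy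
        · exact absurd rfl hne
        · positivity
      · positivity
    have F1 := F_mul 1 (by simp)
    simp only [one_mul, one_pow] at F1
    rw [F_mul (c ^ 2) (by simp [hcn]), F1,
      show c ^ 2 * c = -1 by linear_combination (c + 1) * c2,
      show c ^ 2 * -1 = 1 - c by linear_combination -c2,
      show c ^ 2 * (1 - c) = c by linear_combination -c * c2, c2] at h1
    rw [F_mul (-c) (by simp [hcn]), F1,
      show -c * c = 1 - c by linear_combination -c2,
      show -c * -1 = c by ring,
      show -c * (1 - c) = -1 by linear_combination c2] at h2
    rw [F_mul c hcn, F1,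
      show c * c = c - 1 by linear_combination c2,
      show c * -1 = -c by ring,
      show c * (1 - c) = 1 by linear_combination -c2] at h3
    have e1 : h x C 1 = h x C (c - 1) := by
      have : (‖x‖ + ‖C‖) * (h x C 1 - h x C (c - 1)) = 0 := by
        rw [abs_sub_comm (h x C (-1)) (h x C c), abs_sub_comm (h x C (1 - c)) (h x C c)] at h1
        linear_combination h1
      linarith [(mul_eq_zero.1 this).resolve_left hN.ne']
    have e2 : h x C 1 = h x C (-c) := by
      have : (‖x‖ + ‖C‖) * (h x C 1 - h x C (-c)) = 0 := by
        rw [abs_sub_comm (h x C (1 - c)) (h x C c), abs_sub_comm (h x C (1 - c)) (h x C (-1))] at h2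
        linear_combination h2
      linarith [(mul_eq_zero.1 this).resolve_left hN.ne']
    rw [← e1, ← e2] at h3
    simp only [sub_self, abs_zero, add_zero, mul_zero, sub_zero] at h3
    clear h1 h2 F1 F_mul D_eq
    obtain ⟨x1, x2⟩ := x
    obtain ⟨C1, C2⟩ := C
    simp only [hh, hc] at e1 e2 h3
    simp [pow_two] at e1 e2 h3
    have hC1 : C1 = -x1 := by
      linear_combination (1 / 3) * (e1 + e2) - (C1 / 6) * hs2
    have hC2 : C2 = x2 := by
      have : s * (C2 - x2) = 0 := by
        linear_combination e2 - e1
      rcases mul_eq_zero.1 this with h | h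
      · rw [h] at hs2; norm_num at hs2
      · linarith
    subst hC1 hC2
    have hnorm : ‖(⟨-x1, C2⟩ : ℂ)‖ = ‖(⟨x1, C2⟩ : ℂ)‖ := by
      rw [Complex.norm_def, Complex.norm_def]
      congr 1
      simp [Complex.normSq_apply]
    have hK : 0 < ‖(⟨x1, C2⟩ : ℂ)‖ := by linarith
    rw [hnorm] at h3
    set K := ‖(⟨x1, C2⟩ : ℂ)‖
    have hss : s / 2 * (s / 2) = 3 / 4 := by linear_combination hs2 / 4
    rw [hss] at h3
    set m := s * C2 with hm
    have h4 : K * (2 * (x1 - m) + 3 * (|3 * x1 - m| + |-3 * x1 - m| + |-2 * m|)) = 0 := by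
      rw [show 3 * x1 - m = 2⁻¹ * x1 - s / 2 * C2 + ((2⁻¹ * 2⁻¹ - 3 / 4) * -x1 -
          (2⁻¹ * (s / 2) + s / 2 * 2⁻¹) * C2) - (-x1 + -x1) by rw [hm]; ring,
        show -3 * x1 - m = -x1 + -x1 - ((1 - 2⁻¹) * x1 + s / 2 * C2 + (((1 - 2⁻¹) * (1 - 2⁻¹) -
          3 / 4) * -x1 - (-((1 - 2⁻¹) * (s / 2)) + -(s / 2 * (1 - 2⁻¹))) * C2)) by rw [hm]; ring,
        show -2 * m = 2⁻¹ * x1 - s / 2 * C2 + ((2⁻¹ * 2⁻¹ - 3 / 4) * -x1 -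
          (2⁻¹ * (s / 2) + s / 2 * 2⁻¹) * C2) - ((1 - 2⁻¹) * x1 + s / 2 * C2 +
          (((1 - 2⁻¹) * (1 - 2⁻¹) - 3 / 4) * -x1 -
          (-((1 - 2⁻¹) * (s / 2)) + -(s / 2 * (1 - 2⁻¹))) * C2)) by rw [hm]; ring]
      linear_combination -h3
    have h5 := (mul_eq_zero.1 h4).resolve_left hK.ne'
    have a1 := neg_abs_le (3 * x1 - m)
    have a2 := le_abs_self (3 * x1 - m)
    have a3 := neg_abs_le (-3 * x1 - m)
    have a4 := le_abs_self (-3 * x1 - m)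
    have a5 := neg_abs_le (-2 * m)
    have a6 := le_abs_self (-2 * m)
    have hx1 : x1 = 0 := by linarith
    have hm0 : m = 0 := by linarith
    have hC2 : C2 = 0 := by
      rcases mul_eq_zero.1 hm0 with h | h
      · rw [h] at hs2; norm_num at hs2
      · exact h
    subst hx1 hC2
    apply hne
    simp [Complex.ext_iff]
  have hcont : Continuous fun q : ℂ × ℂ => F q.1 q.2 := by
    simp only [hF, hD, hh]
    fun_prop
  have hinv : ∀ u x y : ℂ, ‖u‖ = 1 → F (u * x * (‖u * x‖ + ‖u * y‖ : ℝ)) ((u * y) ^ 2) =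
      F (u * (x * (‖x‖ + ‖y‖ : ℝ))) (u ^ 2 * y ^ 2) := by
    intro u x y hu
    rw [norm_mul, norm_mul, hu, one_mul, one_mul, mul_pow, mul_assoc]
  refine separable_of_half (fun x y => F (x * (‖x‖ + ‖y‖ : ℝ)) (y ^ 2)) ?_ ?_ ?_
  · exact hcont.comp (by fun_prop : Continuous fun q : ℂ × ℂ =>
      (q.1 * ((‖q.1‖ + ‖q.2‖ : ℝ) : ℂ), q.2 ^ 2))
  · intro x
    simp [hF, hh]
  · intro e he x y hne hall
    obtain ⟨s, hs2, hs, hc⟩ := rot_third hp e he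
    set c : ℂ := rot (6 * p) (2 * ((e : ℝ) * p)) with hcdef
    have hcn : ‖c‖ = 1 := norm_rot _ _
    have c2 : c ^ 2 = c - 1 := by
      rw [hc]
      apply Complex.ext
      · simp [pow_two]; linear_combination (-1 / 4) * hs2
      · simp [pow_two]; ring
    have hr : ∀ k : ℕ, rot (6 * p) (2 * ((e * (k * p) : ℤ) : ℝ)) = c ^ k := by
      intro k
      rw [hcdef, ← zpow_natCast, ← rot_int_mul]
      push_cast
      ring_nf
    have m0 : (0 : ℤ) ∈ ({0, (p : ℤ), 2 * (p : ℤ), 4 * (p : ℤ)} : Set ℤ) := by simp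
    have m1 : (p : ℤ) ∈ ({0, (p : ℤ), 2 * (p : ℤ), 4 * (p : ℤ)} : Set ℤ) := by simp
    have m2 : 2 * (p : ℤ) ∈ ({0, (p : ℤ), 2 * (p : ℤ), 4 * (p : ℤ)} : Set ℤ) := by simp
    have m4 : 4 * (p : ℤ) ∈ ({0, (p : ℤ), 2 * (p : ℤ), 4 * (p : ℤ)} : Set ℤ) := by simp
    have r0 : rot (6 * p) (2 * ((e * 0 : ℤ) : ℝ)) = 1 := by simpa using hr 0
    have r1 : rot (6 * p) (2 * ((e * p : ℤ) : ℝ)) = c := by simpa using hr 1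
    have r2 : rot (6 * p) (2 * ((e * (2 * p) : ℤ) : ℝ)) = c ^ 2 := hr 2
    have r4 : rot (6 * p) (2 * ((e * (4 * p) : ℤ) : ℝ)) = -c := by
      rw [show -c = c ^ 4 by linear_combination (-(c ^ 2) - c) * c2]
      exact hr 4
    have h1 := hall _ m0 _ m2
    have h2 := hall _ m0 _ m4
    have h3 := hall _ m0 _ m1
    rw [r0, r2, one_mul, one_mul, hinv _ _ _ (by simp [hcn])] at h1
    rw [r0, r4, one_mul, one_mul, hinv _ _ _ (by simp [hcn])] at h2
    rw [r0, r1, one_mul, one_mul, hinv _ _ _ hcn] at h3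
    refine main _ _ ?_ s hs2 hs c hc c2 hcn h1 h2 h3
    intro h
    rw [Prod.mk_eq_zero] at h
    obtain ⟨h1, h2⟩ := h
    have hy : y = 0 := by simpa using h2
    subst hy
    simp at h1
    exact hne (by rw [h1]; rfl)

/-- The sum of `G` over the cyclic orbit of `q` generated by `ε^g`. -/
def orbitSum (n : ℕ) (g : ℤ) (G : ℂ × ℂ → ℝ) (q : ℂ × ℂ) : ℝ :=
  ∑ k ∈ Finset.range n, G (rot n (g * k) • q)

lemma continuous_orbitSum (n : ℕ) (g : ℤ) {G : ℂ × ℂ → ℝ} (hc : Continuous G) :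
    Continuous (orbitSum n g G) := by
  unfold orbitSum
  fun_prop

lemma orbitSum_neg (n : ℕ) (g : ℤ) {G : ℂ × ℂ → ℝ} (hG : ∀ q, G (-q) = G q) (q : ℂ × ℂ) :
    orbitSum n g G (-q) = orbitSum n g G q := by
  simp only [orbitSum, smul_neg, hG]

lemma orbitSum_rot {n : ℕ} (hn : 0 < n) (g : ℤ) {G : ℂ × ℂ → ℝ} (hG : ∀ q, G (-q) = G q)
    (q : ℂ × ℂ) : orbitSum n g G (rot n g • q) = orbitSum n g G q := by
  have h : ∀ k : ℕ, G (rot n (g * k) • rot n g • q) = G (rot n (g * (k + 1 : ℕ)) • q) := by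
    intro k
    rw [smul_smul, ← rot_add]
    push_cast
    ring_nf
  simp only [orbitSum, h]
  have h1 := Finset.sum_range_succ (fun k : ℕ => G (rot n (g * k) • q)) n
  rw [Finset.sum_range_succ'] at h1
  have h2 : G (rot n (g * n) • q) = G (rot n (g * (0 : ℕ)) • q) := by
    rw [← apply_rot_add_mul hn hG (g * (0 : ℕ)) g]
    push_cast
    ring_nf
  linarith

lemma orbitSum_rot_neg {n : ℕ} (hn : 0 < n) (g : ℤ) {G : ℂ × ℂ → ℝ}
    (hG : ∀ q, G (-q) = G q) (q : ℂ × ℂ) :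
    orbitSum n g G (rot n (-g) • q) = orbitSum n g G q := by
  rw [← orbitSum_rot hn g hG, smul_smul, mul_comm, rot_neg_mul, one_smul]

lemma orbitSum_rot_mul {n : ℕ} (hn : 0 < n) (g : ℤ) {G : ℂ × ℂ → ℝ}
    (hG : ∀ q, G (-q) = G q) (k : ℕ) (q : ℂ × ℂ) :
    orbitSum n g G (rot n (g * k) • q) = orbitSum n g G q := by
  induction k with
  | zero => simp [rot_zero]
  | succ k ih =>
    rw [← ih, ← orbitSum_rot hn g hG (rot n (g * k) • q), smul_smul, ← rot_add]
    push_cast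
    ring_nf

lemma orbitSum_jmap {n : ℕ} (hn : 0 < n) (g : ℤ) {G : ℂ × ℂ → ℝ} (hG : ∀ q, G (-q) = G q)
    (hj : ∀ q, G (jmap q) = G (rot n (-g) • q)) (q : ℂ × ℂ) :
    orbitSum n g G (jmap q) = orbitSum n g G q := by
  simp only [orbitSum]
  rw [← Finset.sum_range_reflect (fun k : ℕ => G (rot n (g * k) • q))]
  refine Finset.sum_congr rfl fun k hk => ?_
  have hk := Finset.mem_range.1 hk
  have : rot n ((g : ℝ) * k) = (starRingEnd ℂ) (rot n (-(g * k))) := by rw [conj_rot, neg_neg]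
  rw [this, ← jmap_smul, hj, smul_smul, ← rot_add, ← apply_rot_add_mul hn hG _ g]
  congr 3
  rw [show n - 1 - k = n - (k + 1) by omega, Nat.cast_sub (by omega)]
  push_cast
  ring

/-- A function `d` with vanishing orbit sums and the right behaviour under `j` is the
difference `H(ε^g q) - H(q)` of a function `H` that is antisymmetric under `j`. -/
lemma exists_difference {n : ℕ} (hn : 0 < n) (g : ℤ) {d : ℂ × ℂ → ℝ} (hc : Continuous d)
    (hd : ∀ q, d (-q) = d q) (hsum : ∀ q, orbitSum n g d q = 0)
    (hj : ∀ q, d (jmap q) = d (rot n (-g) • q)) :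
    ∃ H : ℂ × ℂ → ℝ, Continuous H ∧ (∀ q, H (jmap q) = -H q) ∧
      (∀ q, H (rot n g • q) - H q = d q) ∧
      ∀ u : ℝ, (∀ q, d (rot n u • q) = d q) → ∀ q, H (rot n u • q) = H q := by
  have hn' : (n : ℝ) ≠ 0 := by positivity
  set H₀ : ℂ × ℂ → ℝ := fun q =>
    (∑ k ∈ Finset.range n, (k : ℝ) * d (rot n (g * k) • q)) / n with hH
  have H₀c : Continuous H₀ := by
    simp only [hH]; fun_prop
  have H₀neg : ∀ q, H₀ (-q) = H₀ q := by
    intro q; simp only [hH, smul_neg, hd]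
  have H₀g : ∀ q, H₀ (rot n g • q) - H₀ q = d q := by
    intro q
    have h : ∀ k : ℕ, d (rot n (g * k) • rot n g • q) = d (rot n (g * (k + 1 : ℕ)) • q) := by
      intro k
      rw [smul_smul, ← rot_add]
      push_cast
      ring_nf
    have h1 := Finset.sum_range_succ (fun k : ℕ => ((k : ℝ) - 1) * d (rot n (g * k) • q)) n
    rw [Finset.sum_range_succ'] at h1
    have h2 : d (rot n (g * n) • q) = d q := by
      have := apply_rot_add_mul hn hd 0 g q
      rw [rot_zero, one_smul, zero_add, mul_comm] at this
      exact this
    have h3 := hsum q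
    simp only [orbitSum] at h3
    simp only [sub_mul, one_mul, Finset.sum_sub_distrib, h3, h2, Nat.cast_zero, mul_zero,
      rot_zero, one_smul] at h1
    have h4 : ∑ k ∈ Finset.range n, (k : ℝ) * d (rot n (g * k) • rot n g • q) =
        ∑ k ∈ Finset.range n, (k : ℝ) * d (rot n (g * k) • q) + n * d q := by
      simp only [h]
      rw [← Finset.sum_sub_distrib] at h1
      have : ∀ k : ℕ, ((k + 1 : ℕ) : ℝ) * d (rot n (g * (k + 1 : ℕ)) • q) -
          d (rot n (g * (k + 1 : ℕ)) • q) = k * d (rot n (g * (k + 1 : ℕ)) • q) := by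
        intro k; push_cast; ring
      simp only [this] at h1
      linarith
    simp only [hH]
    rw [h4, div_sub_div_same, add_sub_cancel_left, mul_div_cancel_left₀ _ hn']
  have jrot : ∀ (u : ℝ) q, jmap (rot n u • q) = rot n (-u) • jmap q := by
    intro u q
    rw [jmap_smul, conj_rot]
  refine ⟨fun q => (H₀ q - H₀ (jmap q)) / 2, ?_, ?_, ?_, ?_⟩
  · have := continuous_jmap
    fun_prop
  · intro q
    simp only [jmap_jmap, H₀neg]
    ring
  · intro q
    have h1 := H₀g q
    have h2 := H₀g (jmap (rot n g • q))
    rw [hj, smul_smul, rot_neg_mul, one_smul] at h2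
    rw [show rot n g • jmap (rot n g • q) = jmap q by
      rw [jrot, smul_smul, mul_comm, rot_neg_mul, one_smul]] at h2
    linarith
  · intro u hu q
    have inv : ∀ v : ℝ, (∀ q, d (rot n v • q) = d q) → ∀ q, H₀ (rot n v • q) = H₀ q := by
      intro v hv q
      simp only [hH]
      congr 1
      refine Finset.sum_congr rfl fun k _ => ?_
      rw [smul_comm, hv]
    have hu' : ∀ q, d (rot n (-u) • q) = d q := by
      intro q
      rw [← hu, smul_smul, mul_comm, rot_neg_mul, one_smul]
    beta_reduce
    rw [inv u hu, jrot, inv (-u) hu']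

lemma sum_pow_eq_zero {z : ℂ} {n : ℕ} (h1 : z ≠ 1) (hz : z ^ n = 1) :
    ∑ k ∈ Finset.range n, z ^ k = 0 := by
  rw [geom_sum_eq h1, hz, sub_self, zero_div]

lemma rot_two_mul_eq_one {n : ℕ} (hn : 0 < n) (t : ℤ) : rot n (2 * t) = 1 ↔ (n : ℤ) ∣ t := by
  have hn' : (n : ℝ) ≠ 0 := by positivity
  rw [rot, Complex.exp_eq_one_iff]
  constructor
  · rintro ⟨m, hm⟩
    refine ⟨m, ?_⟩
    have h1 : ((2 * t * Real.pi / n : ℝ) : ℂ) = ((m * (2 * Real.pi) : ℝ) : ℂ) := by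
      have : ((2 * t * Real.pi / n : ℝ) : ℂ) * Complex.I =
          ((m * (2 * Real.pi) : ℝ) : ℂ) * Complex.I := by
        rw [hm]; push_cast; ring
      exact mul_right_cancel₀ Complex.I_ne_zero this
    have h2 := Complex.ofReal_injective h1
    field_simp at h2
    have : (t : ℝ) = n * m := by linarith
    exact_mod_cast this
  · rintro ⟨m, rfl⟩
    refine ⟨m, ?_⟩
    push_cast
    have : (n : ℂ) ≠ 0 := by exact_mod_cast hn'
    field_simp

/-- The set `{0, p, h, h + p}` modulo `2 h`. -/
lemma separable_rectangle {h : ℕ} (hh : 0 < h) (p : ℤ) (h2 : ¬ (2 * h : ℤ) ∣ 2 * p)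
    (h4 : ¬ (2 * h : ℤ) ∣ 4 * p) (h6 : ¬ (2 * h : ℤ) ∣ 6 * p) :
    Separable4 (2 * h) {0, p, (h : ℤ), h + p} := by
  set n := 2 * h with hn
  have hn0 : 0 < n := by omega
  have hncast : (n : ℤ) = 2 * h := by rw [hn]; push_cast; rfl
  set Y : ℂ × ℂ → ℂ := fun q => (max 0 (‖q.1‖ ^ 2 - ‖q.2‖ ^ 2) : ℝ) * q.1 ^ 2 with hY
  set a : ℂ × ℂ → ℝ := fun q => (q.1 * q.2).re + (Y q ^ 3).re - (Y (jmap q) ^ 3).re with ha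
  have Yc : Continuous Y := by fun_prop
  have ac : Continuous a := by
    have := continuous_jmap
    fun_prop
  have Yneg : ∀ q, Y (-q) = Y q := by intro q; simp [hY]
  have jrot : ∀ (u : ℝ) q, jmap (rot n u • q) = rot n (-u) • jmap q := by
    intro u q
    rw [jmap_smul, conj_rot]
  have aj : ∀ q, a (jmap q) = -a q := by
    intro q
    simp only [ha, jmap_jmap, Yneg]
    simp [jmap]
    ring
  have aneg := apply_neg_of_jmap aj
  have Yrot : ∀ (u : ℝ) q, Y (rot n u • q) = rot n u ^ 2 * Y q := by
    intro u q
    simp only [hY, Prod.smul_fst, Prod.smul_snd, smul_eq_mul, norm_mul, norm_rot, one_mul]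
    ring
  have rsq : ∀ u : ℝ, rot n u ^ 2 = rot n (2 * u) := by
    intro u; rw [pow_two, ← rot_add]; ring_nf
  have rh : rot n (2 * (h : ℝ)) = -1 := by
    rw [← rot_self hn0, hn]; push_cast; rfl
  have rh' : rot n (2 * (-(h : ℝ))) = -1 := by
    rw [mul_neg, ← conj_rot, rh]; simp
  have ah : ∀ q, a (rot n h • q) = -a q := by
    intro q
    simp only [ha, jrot, Yrot, rsq, rh, rh', Prod.smul_fst, Prod.smul_snd, smul_eq_mul]
    rw [show rot n h * q.1 * (rot n h * q.2) = rot n (2 * h) * (q.1 * q.2) by rw [← rsq]; ring, rh]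
    rw [show (-1 * Y q) ^ 3 = -(Y q ^ 3) by ring,
      show (-1 * Y (jmap q)) ^ 3 = -(Y (jmap q) ^ 3) by ring]
    simp
    ring
  set τ : ℂ := rot n (2 * p) with hτ
  have τpow : ∀ m : ℕ, τ ^ m = rot n (2 * (m * p : ℤ)) := by
    intro m
    have := rot_int_mul n m (2 * p)
    rw [zpow_natCast] at this
    rw [hτ, ← this]
    push_cast
    ring_nf
  have τn : τ ^ n = 1 := by
    rw [τpow, rot_two_mul_eq_one hn0]
    exact dvd_mul_right _ _
  have τne : ∀ m : ℕ, ¬ (2 * h : ℤ) ∣ m * p → τ ^ m ≠ 1 := by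
    intro m hm h1
    rw [τpow, rot_two_mul_eq_one hn0, hncast] at h1
    exact hm h1
  set τ' : ℂ := (starRingEnd ℂ) τ with hτ'
  have ττ : τ * τ' = 1 := by
    rw [hτ', Complex.mul_conj, Complex.normSq_eq_norm_sq, norm_rot]; norm_num
  have sum1 : ∀ m : ℕ, ¬ (2 * h : ℤ) ∣ m * p → ∑ k ∈ Finset.range n, (τ ^ m) ^ k = 0 := by
    intro m hm
    refine sum_pow_eq_zero (τne m hm) ?_
    rw [← pow_mul, mul_comm, pow_mul, τn, one_pow]
  have sum2 : ∀ m : ℕ, ¬ (2 * h : ℤ) ∣ m * p → ∑ k ∈ Finset.range n, (τ' ^ m) ^ k = 0 := by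
    intro m hm
    have := congrArg (starRingEnd ℂ) (sum1 m hm)
    simpa [map_sum] using this
  have anz_half : ∀ q : ℂ × ℂ, q ≠ 0 → ‖q.2‖ ≤ ‖q.1‖ → ∃ k : ℕ, a (rot n (p * k) • q) ≠ 0 := by
    intro q hq hle
    by_contra! hcon
    have Y0 : Y (jmap q) = 0 := by
      have : ‖q.2‖ ^ 2 ≤ ‖q.1‖ ^ 2 := by gcongr
      simp only [hY, jmap, norm_neg, RCLike.norm_conj]
      rw [max_eq_left (by linarith)]
      simp
    set P := q.1 * q.2 with hP
    set Q := Y q ^ 3 with hQ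
    have e : ∀ k : ℕ, τ ^ k * P + τ' ^ k * (starRingEnd ℂ) P + (τ ^ k) ^ 3 * Q +
        (τ' ^ k) ^ 3 * (starRingEnd ℂ) Q = 0 := by
      intro k
      have h1 := hcon k
      simp only [ha, jrot, Yrot, Y0] at h1
      have h2 : rot n (p * k) ^ 2 = τ ^ k := by
        rw [rsq, τpow]; push_cast; ring_nf
      simp only [h2, Prod.smul_fst, Prod.smul_snd, smul_eq_mul] at h1
      rw [show rot n (p * k) * q.1 * (rot n (p * k) * q.2) = τ ^ k * P by rw [← h2]; ring,
        mul_pow, ← hQ] at h1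
      simp only [mul_zero, ne_eq, OfNat.ofNat_ne_zero, not_false_eq_true, zero_pow,
        Complex.zero_re, sub_zero] at h1
      have h3 := Complex.add_conj (τ ^ k * P)
      have h4 := Complex.add_conj ((τ ^ k) ^ 3 * Q)
      have h5 : ((τ ^ k * P).re : ℂ) + (((τ ^ k) ^ 3 * Q).re : ℂ) = 0 := by exact_mod_cast h1
      rw [Complex.ofReal_mul, Complex.ofReal_ofNat] at h3 h4
      simp only [map_mul, map_pow, ← hτ'] at h3 h4
      linear_combination h3 + h4 + 2 * h5
    have ττk : ∀ k : ℕ, τ ^ k * τ' ^ k = 1 := by intro k; rw [← mul_pow, ττ, one_pow]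
    have hn0' : (n : ℂ) ≠ 0 := by exact_mod_cast hn0.ne'
    have hP0 : P = 0 := by
      have e1 : ∀ k : ℕ, P + (τ' ^ 2) ^ k * (starRingEnd ℂ) P + (τ ^ 2) ^ k * Q +
          (τ' ^ 4) ^ k * (starRingEnd ℂ) Q = 0 := by
        intro k
        rw [pow_right_comm τ' 2, pow_right_comm τ 2, pow_right_comm τ' 4]
        linear_combination τ' ^ k * e k - (P + (τ ^ k) ^ 2 * Q) * ττk k
      have := Finset.sum_congr rfl fun k (_ : k ∈ Finset.range n) => e1 k
      simp only [Finset.sum_add_distrib, ← Finset.sum_mul, sum1 2 h2, sum2 2 h2, sum2 4 h4] at this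
      simpa [hn0'] using this
    have hQ0 : Q = 0 := by
      have e1 : ∀ k : ℕ, (τ' ^ 2) ^ k * P + (τ' ^ 4) ^ k * (starRingEnd ℂ) P + Q +
          (τ' ^ 6) ^ k * (starRingEnd ℂ) Q = 0 := by
        intro k
        rw [pow_right_comm τ' 2, pow_right_comm τ' 4, pow_right_comm τ' 6]
        linear_combination (τ' ^ k) ^ 3 * e k - (P * (τ' ^ k) ^ 2 +
          Q * (1 + τ ^ k * τ' ^ k + (τ ^ k * τ' ^ k) ^ 2)) * ττk k
      have := Finset.sum_congr rfl fun k (_ : k ∈ Finset.range n) => e1 k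
      simp only [Finset.sum_add_distrib, ← Finset.sum_mul, sum2 2 h2, sum2 4 h4, sum2 6 h6] at this
      simpa [hn0'] using this
    obtain ⟨z, w⟩ := q
    simp only [hP, hQ, hY] at hP0 hQ0 hle
    have hz : z ≠ 0 := by
      rintro rfl
      simp only [norm_zero, norm_le_zero_iff] at hle
      exact hq (by simp [hle])
    have hw : w = 0 := by simpa [hz] using hP0
    subst hw
    have : (0 : ℝ) < ‖z‖ ^ 2 := by positivity
    simp [hz] at hQ0
  have habs : ∀ q, |a (-q)| = |a q| := by intro q; rw [aneg]
  have anz : ∀ q ≠ 0, 0 < orbitSum n p (fun q => |a q|) q := by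
    intro q hq
    have pos : ∀ q : ℂ × ℂ, a q ≠ 0 → 0 < orbitSum n p (fun q => |a q|) q := by
      intro q hk
      refine Finset.sum_pos' (fun _ _ => abs_nonneg _) ⟨0, Finset.mem_range.2 hn0, ?_⟩
      simpa [rot_zero] using hk
    rcases le_total ‖q.2‖ ‖q.1‖ with hle | hle
    · obtain ⟨k, hk⟩ := anz_half q hq hle
      rw [← orbitSum_rot_mul hn0 p (G := fun q => |a q|) habs k]
      exact pos _ hk
    · obtain ⟨k, hk⟩ := anz_half (jmap q) (mt jmap_eq_zero.1 hq) (by simpa [jmap] using hle)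
      rw [← neg_neg ((p : ℝ) * k), ← jrot, aj, neg_ne_zero] at hk
      have := orbitSum_rot_mul hn0 p (G := fun q => |a q|) habs k (rot n (-(p * k)) • q)
      rw [smul_smul, mul_comm, rot_neg_mul, one_smul] at this
      rw [this]
      exact pos _ hk
  set F : ℂ × ℂ → ℝ := fun q => |a q| + |a (rot n p • q)| with hF
  have Fc : Continuous F := by fun_prop
  have Fneg : ∀ q, F (-q) = F q := by
    intro q; simp only [hF, smul_neg, habs]
  have Fj : ∀ q, F (jmap q) = F (rot n (-p) • q) := by
    intro q
    simp only [hF]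
    rw [show rot n p • jmap q = jmap (rot n (-p) • q) by rw [jrot, neg_neg], aj, aj, abs_neg,
      abs_neg, smul_smul, mul_comm (rot n p), rot_neg_mul, one_smul, add_comm]
  have Fpos : ∀ q ≠ 0, 0 < orbitSum n p F q := by
    intro q hq
    refine (anz q hq).trans_le (Finset.sum_le_sum fun k _ => ?_)
    simp only [hF]
    linarith [abs_nonneg (a (rot n p • rot n (p * k) • q))]
  have nR : (n : ℝ) ≠ 0 := by positivity
  obtain ⟨e, ec, ej, ediff, einv⟩ := exists_difference hn0 p
    (d := fun q => orbitSum n p F q / n - F q)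
    (((continuous_orbitSum n p Fc).div_const _).sub Fc)
    (fun q => by rw [orbitSum_neg n p Fneg, Fneg])
    (fun q => by
      have h1 : ∀ k : ℕ, orbitSum n p F (rot n (p * k) • q) = orbitSum n p F q :=
        fun k => orbitSum_rot_mul hn0 p Fneg k q
      rw [orbitSum]
      simp only [h1, Finset.sum_sub_distrib, Finset.sum_const, Finset.card_range, nsmul_eq_mul]
      rw [mul_div_cancel₀ _ nR, orbitSum, sub_self])
    (fun q => by
      rw [orbitSum_jmap hn0 p Fneg Fj, orbitSum_rot_neg hn0 p Fneg, Fj])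
  have Fh : ∀ q, F (rot n h • q) = F q := by
    intro q
    simp only [hF]
    rw [smul_comm, ah, ah, abs_neg, abs_neg]
  have eh : ∀ q, e (rot n h • q) = e q := by
    refine einv h fun q => ?_
    rw [Fh]
    congr 2
    refine Finset.sum_congr rfl fun k _ => ?_
    rw [smul_comm, Fh]
  refine ⟨fun q => a q + e q, ac.add ec, fun q => by beta_reduce; rw [aj, ej]; ring,
    fun q hq hall => ?_⟩
  have m0 : (0 : ℤ) ∈ ({0, p, (h : ℤ), h + p} : Set ℤ) := by simp
  have mp : p ∈ ({0, p, (h : ℤ), h + p} : Set ℤ) := by simp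
  have mh : (h : ℤ) ∈ ({0, p, (h : ℤ), h + p} : Set ℤ) := by simp
  have mhp : (h : ℤ) + p ∈ ({0, p, (h : ℤ), h + p} : Set ℤ) := by simp
  have e1 := hall _ m0 _ mh
  have e2 := hall _ mp _ mhp
  have e3 := hall _ m0 _ mp
  have r : rot n ((h + p : ℤ) : ℝ) • q = rot n h • rot n p • q := by
    rw [smul_smul, ← rot_add]; push_cast; rfl
  simp only [Int.cast_zero, rot_zero, one_smul, Int.cast_natCast, r, ah, eh] at e1 e2 e3
  have a1 : a q = 0 := by linarith
  have a2 : a (rot n p • q) = 0 := by linarith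
  have h1 := ediff q
  have h3 : orbitSum n p F q / n = 0 := by
    have : F q = 0 := by simp [hF, a1, a2]
    linarith
  have := Fpos q hq
  exact (div_pos this (by positivity : (0 : ℝ) < n)).ne' h3

lemma orbitSum_rot_zmul {n : ℕ} (hn : 0 < n) (g : ℤ) {G : ℂ × ℂ → ℝ}
    (hG : ∀ q, G (-q) = G q) (m : ℤ) (q : ℂ × ℂ) :
    orbitSum n g G (rot n (g * m) • q) = orbitSum n g G q := by
  obtain ⟨k, rfl | rfl⟩ := m.eq_nat_or_neg
  · exact_mod_cast orbitSum_rot_mul hn g hG k q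
  · have := orbitSum_rot_mul hn g hG k (rot n (g * (-(k : ℤ) : ℤ)) • q)
    rw [← this, smul_smul, ← rot_add]
    push_cast
    rw [mul_neg, add_neg_cancel, rot_zero, one_smul]

/-- An arithmetic progression of length four is separated as soon as some function `e` changes
sign on every orbit of `ε^g` and does not vanish at three consecutive points of an orbit. -/
lemma separable_progression_of_sign_change {n : ℕ} (hn : 0 < n) (g : ℤ) {e : ℂ × ℂ → ℝ}
    (ec : Continuous e) (ej : ∀ q, e (jmap q) = e (rot n (-g) • q))
    (hpos : ∀ q ≠ 0, ∃ m : ℤ, 0 < e (rot n (g * m) • q))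
    (hneg : ∀ q ≠ 0, ∃ m : ℤ, e (rot n (g * m) • q) < 0)
    (hno : ∀ q ≠ 0, e (rot n (-g) • q) = 0 → e q = 0 → e (rot n g • q) = 0 → False) :
    Separable4 n {0, g, 2 * g, 3 * g} := by
  have eneg : ∀ q, e (-q) = e q := by
    intro q
    have : rot n (-g) • jmap q = jmap (rot n g • q) := by rw [jmap_smul, conj_rot]
    rw [← jmap_jmap, ej, this, ej, smul_smul, rot_neg_mul, one_smul]
  set ep : ℂ × ℂ → ℝ := fun q => max (e q) 0 with hep
  set em : ℂ × ℂ → ℝ := fun q => max (-e q) 0 with hem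
  have epc : Continuous ep := by fun_prop
  have emc : Continuous em := by fun_prop
  have epneg : ∀ q, ep (-q) = ep q := by intro q; simp only [hep, eneg]
  have emneg : ∀ q, em (-q) = em q := by intro q; simp only [hem, eneg]
  have epj : ∀ q, ep (jmap q) = ep (rot n (-g) • q) := by intro q; simp only [hep, ej]
  have emj : ∀ q, em (jmap q) = em (rot n (-g) • q) := by intro q; simp only [hem, ej]
  have pos : ∀ G : ℂ × ℂ → ℝ, (∀ q, G (-q) = G q) → (∀ q, 0 ≤ G q) →
      ∀ q, (∃ m : ℤ, 0 < G (rot n (g * m) • q)) → 0 < orbitSum n g G q := by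
    rintro G hG h0 q ⟨m, hm⟩
    rw [← orbitSum_rot_zmul hn g hG m]
    refine Finset.sum_pos' (fun _ _ => h0 _) ⟨0, Finset.mem_range.2 hn, ?_⟩
    simpa [rot_zero] using hm
  have Bpos : ∀ q ≠ 0, 0 < orbitSum n g ep q := fun q hq =>
    pos ep epneg (fun _ => le_max_right _ _) q
      ((hpos q hq).imp fun m hm => lt_max_of_lt_left hm)
  have Apos : ∀ q ≠ 0, 0 < orbitSum n g em q := fun q hq =>
    pos em emneg (fun _ => le_max_right _ _) q
      ((hneg q hq).imp fun m hm => lt_max_of_lt_left (by linarith))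
  obtain ⟨H, Hc, Hj, Hd, -⟩ := exists_difference hn g
    (d := fun q => ep q * orbitSum n g em q - em q * orbitSum n g ep q)
    ((epc.mul (continuous_orbitSum n g emc)).sub (emc.mul (continuous_orbitSum n g epc)))
    (fun q => by simp only [orbitSum_neg n g epneg, orbitSum_neg n g emneg, epneg, emneg])
    (fun q => by
      have h1 : ∀ k : ℕ, orbitSum n g ep (rot n (g * k) • q) = orbitSum n g ep q :=
        fun k => orbitSum_rot_mul hn g epneg k q
      have h2 : ∀ k : ℕ, orbitSum n g em (rot n (g * k) • q) = orbitSum n g em q :=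
        fun k => orbitSum_rot_mul hn g emneg k q
      rw [orbitSum]
      simp only [h1, h2, Finset.sum_sub_distrib, ← Finset.sum_mul]
      rw [← orbitSum, ← orbitSum]
      ring)
    (fun q => by
      simp only [orbitSum_jmap hn g epneg epj, orbitSum_jmap hn g emneg emj,
        orbitSum_rot_neg hn g epneg, orbitSum_rot_neg hn g emneg, epj, emj])
  refine ⟨H, Hc, Hj, fun q hq hall => ?_⟩
  have key : ∀ q ≠ 0, H (rot n g • q) = H q → e q = 0 := by
    intro q hq h
    have h1 := Hd q
    rw [h, sub_self] at h1
    have hA := Apos q hq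
    have hB := Bpos q hq
    simp only [hep, hem] at h1
    rcases lt_trichotomy (e q) 0 with hlt | h0 | hgt
    · rw [max_eq_right hlt.le, max_eq_left (by linarith)] at h1
      nlinarith
    · exact h0
    · rw [max_eq_left hgt.le, max_eq_right (by linarith)] at h1
      nlinarith
  have nz : ∀ t : ℝ, rot n t • q ≠ 0 := fun t => smul_ne_zero (rot_ne_zero n t) hq
  have m0 : (0 : ℤ) ∈ ({0, g, 2 * g, 3 * g} : Set ℤ) := by simp
  have m1 : g ∈ ({0, g, 2 * g, 3 * g} : Set ℤ) := by simp
  have m2 : 2 * g ∈ ({0, g, 2 * g, 3 * g} : Set ℤ) := by simp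
  have m3 : 3 * g ∈ ({0, g, 2 * g, 3 * g} : Set ℤ) := by simp
  have rr : ∀ a b c : ℝ, a + b = c → rot n a • rot n b • q = rot n c • q := by
    rintro a b c rfl
    rw [smul_smul, ← rot_add]
  have e0 : e q = 0 := key q hq (by simpa [rot_zero] using hall _ m1 _ m0)
  have e1 : e (rot n g • q) = 0 := key _ (nz _) (by
    rw [rr g g (2 * g : ℤ) (by push_cast; ring)]
    exact hall _ m2 _ m1)
  have e2 : e (rot n (2 * g : ℤ) • q) = 0 := key _ (nz _) (by
    rw [rr g (2 * g : ℤ) (3 * g : ℤ) (by push_cast; ring)]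
    exact hall _ m3 _ m2)
  refine hno (rot n g • q) (nz _) ?_ e1 ?_
  · rwa [smul_smul, rot_neg_mul, one_smul]
  · rwa [rr g g (2 * g : ℤ) (by push_cast; ring)]

/-- Orthogonality relations make the trigonometric polynomial
`Im (z^m P) + Re (z^(km) c) + C ‖c‖` change sign along the powers of a root of unity `z`. -/
lemma exists_sign_change {n : ℕ} (hn : 0 < n) {z : ℂ} (hz : z ^ n = 1) (hz1 : ‖z‖ = 1) {k : ℕ}
    (hk : 1 ≤ k) (h1 : z ≠ 1) (h2 : z ^ 2 ≠ 1) (hk0 : z ^ k ≠ 1) (hkm : z ^ (k - 1) ≠ 1)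
    (hkp : z ^ (k + 1) ≠ 1) (hkk : z ^ (2 * k) ≠ 1) {C : ℝ} (hC0 : 0 < C) (hC : C < 1 / 2)
    {P c : ℂ} (hPc : P ≠ 0 ∨ c ≠ 0) :
    (∃ m : ℕ, 0 < (z ^ m * P).im + ((z ^ m) ^ k * c).re + C * ‖c‖) ∧
    ∃ m : ℕ, (z ^ m * P).im + ((z ^ m) ^ k * c).re + C * ‖c‖ < 0 := by
  have hn' : (0 : ℝ) < n := by exact_mod_cast hn
  have sum0 : ∀ (j : ℕ) (x : ℂ), z ^ j ≠ 1 → ∑ m ∈ Finset.range n, (z ^ m) ^ j * x = 0 := by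
    intro j x hj
    rw [← Finset.sum_mul]
    simp_rw [pow_right_comm z _ j]
    rw [sum_pow_eq_zero hj (by rw [← pow_mul, mul_comm, pow_mul, hz, one_pow]), zero_mul]
  have sumRe : ∀ (j : ℕ) (x : ℂ), z ^ j ≠ 1 → ∑ m ∈ Finset.range n, ((z ^ m) ^ j * x).re = 0 := by
    intro j x hj
    rw [← Complex.re_sum, sum0 j x hj, Complex.zero_re]
  have sumIm : ∀ (j : ℕ) (x : ℂ), z ^ j ≠ 1 → ∑ m ∈ Finset.range n, ((z ^ m) ^ j * x).im = 0 := by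
    intro j x hj
    rw [← Complex.im_sum, sum0 j x hj, Complex.zero_im]
  have sP : ∑ m ∈ Finset.range n, (z ^ m * P).im = 0 := by
    simpa using sumIm 1 P (by simpa using h1)
  set f : ℕ → ℝ := fun m => (z ^ m * P).im + ((z ^ m) ^ k * c).re + C * ‖c‖ with hf
  have sf : ∑ m ∈ Finset.range n, f m = n * (C * ‖c‖) := by
    simp only [hf, Finset.sum_add_distrib, sP, sumRe k c hk0, Finset.sum_const, Finset.card_range,
      nsmul_eq_mul]
    ring
  by_cases hc : c = 0
  · subst hc
    have hP : P ≠ 0 := by simpa using hPc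
    simp only [mul_zero, Complex.zero_re, norm_zero, add_zero]
    have nz : ¬ ∀ m : ℕ, m ∈ Finset.range n → (z ^ m * P).im = 0 := by
      intro hall
      have hall' : ∀ m : ℕ, (z ^ m * P).im = 0 := by
        intro m
        have := hall (m % n) (Finset.mem_range.2 (Nat.mod_lt _ hn))
        rwa [← pow_eq_pow_mod m hz] at this
      have e0 := hall' 0
      have e1 := hall' 1
      simp only [pow_zero, one_mul, pow_one, Complex.mul_im] at e0 e1
      rw [e0, mul_zero, zero_add] at e1
      have hP' : P.re ≠ 0 := fun h => hP (Complex.ext h e0)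
      have him : z.im = 0 := (mul_eq_zero.1 e1).resolve_right hP'
      have := Complex.normSq_eq_norm_sq z
      rw [hz1, Complex.normSq_apply, him] at this
      apply h2
      apply Complex.ext <;> simp [pow_two, him]
      linarith
    constructor
    · by_contra! hcon
      apply nz
      exact (Finset.sum_eq_zero_iff_of_nonpos fun m _ => hcon m).1 sP
    · by_contra! hcon
      apply nz
      exact (Finset.sum_eq_zero_iff_of_nonneg fun m _ => hcon m).1 sP
  · have hc' : 0 < ‖c‖ := norm_pos_iff.2 hc
    constructor
    · by_contra! hcon
      have : ∑ m ∈ Finset.range n, f m ≤ 0 := Finset.sum_nonpos fun m _ => hcon m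
      rw [sf] at this
      have : 0 < n * (C * ‖c‖) := by positivity
      linarith
    · by_contra! hcon
      have w : ∀ m, 0 ≤ (‖c‖ - ((z ^ m) ^ k * c).re) * f m := by
        intro m
        refine mul_nonneg ?_ (hcon m)
        have := Complex.re_le_norm ((z ^ m) ^ k * c)
        rw [norm_mul, norm_pow, norm_pow, hz1, one_pow, one_pow, one_mul] at this
        linarith
      have expand : ∀ m, (‖c‖ - ((z ^ m) ^ k * c).re) * f m = ‖c‖ * f m -
          (((z ^ m) ^ (k + 1) * (c * P)).im / 2 -
            ((z ^ m) ^ (k - 1) * (c * (starRingEnd ℂ) P)).im / 2) -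
          (‖c‖ ^ 2 / 2 + ((z ^ m) ^ (2 * k) * c ^ 2).re / 2) - C * ‖c‖ * ((z ^ m) ^ k * c).re := by
        intro m
        have a1 : (z ^ m) ^ (k + 1) * (c * P) = ((z ^ m) ^ k * c) * (z ^ m * P) := by ring
        have a2 : (z ^ m) ^ (k - 1) * (c * (starRingEnd ℂ) P) =
            ((z ^ m) ^ k * c) * (starRingEnd ℂ) (z ^ m * P) := by
          have hu : (z ^ m) * (starRingEnd ℂ) (z ^ m) = 1 := by
            rw [Complex.mul_conj, Complex.normSq_eq_norm_sq, norm_pow, hz1]; simp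
          obtain ⟨j, rfl⟩ : ∃ j, k = j + 1 := ⟨k - 1, by omega⟩
          rw [map_mul, pow_succ, Nat.add_sub_cancel]
          linear_combination -(z ^ m) ^ j * (c * (starRingEnd ℂ) P) * hu
        have a3 : (z ^ m) ^ (2 * k) * c ^ 2 = ((z ^ m) ^ k * c) ^ 2 := by ring
        have a4 : ‖c‖ ^ 2 = ((z ^ m) ^ k * c).re ^ 2 + ((z ^ m) ^ k * c).im ^ 2 := by
          have : ‖c‖ = ‖(z ^ m) ^ k * c‖ := by
            rw [norm_mul, norm_pow, norm_pow, hz1, one_pow, one_pow, one_mul]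
          rw [this, ← Complex.normSq_eq_norm_sq, Complex.normSq_apply]
          ring
        rw [a1, a2, a3, a4]
        simp only [hf, Complex.mul_im, Complex.conj_re, Complex.conj_im, pow_two ((z ^ m) ^ k * c),
          Complex.mul_re ((z ^ m) ^ k * c)]
        set u := (z ^ m) ^ k * c
        rw [show (z ^ m).re * P.im + (z ^ m).im * P.re = (z ^ m * P).im from
          (Complex.mul_im _ _).symm]
        ring
      have total := Finset.sum_nonneg fun m (_ : m ∈ Finset.range n) => w m
      simp only [expand, Finset.sum_sub_distrib, Finset.sum_add_distrib, ← Finset.mul_sum,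
        ← Finset.sum_div, sumIm _ _ hkp, sumIm _ _ hkm, sumRe _ _ hkk, sumRe _ _ hk0, sf,
        Finset.sum_const, Finset.card_range, nsmul_eq_mul] at total
      have : 0 < n * ‖c‖ ^ 2 * (1 / 2 - C) := by
        have : 0 < 1 / 2 - C := by linarith
        positivity
      nlinarith

lemma separable_progression_of_power {n : ℕ} (hn : 0 < n) (g : ℤ) {k : ℕ} (hk : 1 ≤ k)
    (h1 : ¬ (n : ℤ) ∣ g) (h2 : ¬ (n : ℤ) ∣ 2 * g) (hk0 : ¬ (n : ℤ) ∣ k * g)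
    (hkm : ¬ (n : ℤ) ∣ (k - 1) * g) (hkp : ¬ (n : ℤ) ∣ (k + 1) * g)
    (hkk : ¬ (n : ℤ) ∣ 2 * k * g) {C : ℝ} (hC0 : 0 < C) (hC : C < 1 / 2)
    (hcos : |(rot n (2 * g)).re - (rot n (2 * g) ^ k).re| < C * (1 - (rot n (2 * g)).re)) :
    Separable4 n {0, g, 2 * g, 3 * g} := by
  set Y : ℂ × ℂ → ℂ := fun q => (max 0 (‖q.1‖ ^ 2 - ‖q.2‖ ^ 2) : ℝ) * q.1 ^ 2 with hY
  set E : ℂ → ℝ := fun y => (y ^ k).re + C * ‖y ^ k‖ with hE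
  set e : ℂ × ℂ → ℝ := fun q => (q.1 * q.2).im + E (Y q) + E (Y (jmap q)) with he
  have Yc : Continuous Y := by fun_prop
  have Ec : Continuous E := by fun_prop
  have ec : Continuous e := by
    have := continuous_jmap
    fun_prop
  have Yneg : ∀ q, Y (-q) = Y q := by intro q; simp [hY]
  have jrot : ∀ (u : ℝ) q, jmap (rot n u • q) = rot n (-u) • jmap q := by
    intro u q
    rw [jmap_smul, conj_rot]
  have ej : ∀ q, e (jmap q) = e q := by
    intro q
    simp only [he, jmap_jmap, Yneg]
    simp [jmap]
    ring
  have Yrot : ∀ (u : ℝ) q, Y (rot n u • q) = rot n (2 * u) * Y q := by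
    intro u q
    have rsq : rot n u ^ 2 = rot n (2 * u) := by rw [pow_two, ← rot_add]; ring_nf
    simp only [hY, Prod.smul_fst, Prod.smul_snd, smul_eq_mul, norm_mul, norm_rot, one_mul, ← rsq]
    ring
  have Y0 : ∀ q : ℂ × ℂ, ‖q.1‖ ≤ ‖q.2‖ → Y q = 0 := by
    intro q h
    have : ‖q.1‖ ^ 2 ≤ ‖q.2‖ ^ 2 := by gcongr
    simp only [hY]
    rw [max_eq_left (by linarith)]
    simp
  have hne : ∀ q : ℂ × ℂ, q ≠ 0 → ‖q.2‖ ≤ ‖q.1‖ → q.1 * q.2 ≠ 0 ∨ Y q ^ k ≠ 0 := by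
    rintro ⟨z, w⟩ hq hle
    by_contra! h
    simp only [hY] at h hle
    obtain ⟨h3, h4⟩ := h
    have hz : z ≠ 0 := by
      rintro rfl
      simp only [norm_zero, norm_le_zero_iff] at hle
      exact hq (by simp [hle])
    have hw : w = 0 := by simpa [hz] using h3
    subst hw
    have : (0 : ℝ) < ‖z‖ ^ 2 := by positivity
    have h5 := pow_eq_zero_iff (by omega) |>.1 h4
    simp [hz] at h5
  have formula : ∀ (u : ℝ) (q : ℂ × ℂ), ‖q.2‖ ≤ ‖q.1‖ → e (rot n u • q) =
      (rot n (2 * u) * (q.1 * q.2)).im + (rot n (2 * u) ^ k * Y q ^ k).re + C * ‖Y q ^ k‖ := by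
    intro u q hle
    have h3 : Y (jmap q) = 0 := Y0 _ (by simpa [jmap] using hle)
    have h4 : rot n u * q.1 * (rot n u * q.2) = rot n (2 * u) * (q.1 * q.2) := by
      rw [two_mul, rot_add]; ring
    have h5 : ‖rot n (2 * u)‖ = 1 := norm_rot _ _
    simp only [he, hE, jrot, Yrot, h3, mul_zero, Prod.smul_fst, Prod.smul_snd, smul_eq_mul, h4,
      mul_pow, zero_pow (show k ≠ 0 by omega), norm_mul, norm_pow, h5, one_mul]
    simp [show k ≠ 0 by omega]
    ring
  set τ : ℂ := rot n (2 * g) with hτ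
  have τpow : ∀ m : ℕ, τ ^ m = rot n (2 * (m * g : ℤ)) := by
    intro m
    have := rot_int_mul n m (2 * g)
    rw [zpow_natCast] at this
    rw [hτ, ← this]
    push_cast
    ring_nf
  have τne : ∀ m : ℕ, ¬ (n : ℤ) ∣ m * g → τ ^ m ≠ 1 := by
    intro m hm h
    rw [τpow, rot_two_mul_eq_one hn] at h
    exact hm h
  have τn : τ ^ n = 1 := by
    rw [τpow, rot_two_mul_eq_one hn]
    exact dvd_mul_right _ _
  have τ1 : ‖τ‖ = 1 := norm_rot _ _
  have τsq : τ ^ 2 ≠ 1 := τne 2 (by simpa using h2)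
  have sign : ∀ q : ℂ × ℂ, q ≠ 0 → ‖q.2‖ ≤ ‖q.1‖ →
      (∃ m : ℤ, 0 < e (rot n (g * m) • q)) ∧ ∃ m : ℤ, e (rot n (g * m) • q) < 0 := by
    intro q hq hle
    have := exists_sign_change hn τn τ1 hk (by simpa using τne 1 (by simpa using h1)) τsq
      (τne k hk0) (τne (k - 1) (by rwa [Nat.cast_sub hk, Nat.cast_one]))
      (τne (k + 1) (by push_cast; exact hkp)) (τne (2 * k) (by push_cast; exact hkk))
      hC0 hC (hne q hq hle)
    have conv : ∀ m : ℕ, e (rot n (g * (m : ℤ)) • q) =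
        (τ ^ m * (q.1 * q.2)).im + ((τ ^ m) ^ k * Y q ^ k).re + C * ‖Y q ^ k‖ := by
      intro m
      rw [formula _ q hle, τpow]
      push_cast
      rw [mul_comm (g : ℝ)]
    obtain ⟨⟨m, hm⟩, m', hm'⟩ := this
    exact ⟨⟨m, by rw [conv]; exact hm⟩, m', by rw [conv]; exact hm'⟩
  have sign' : ∀ q : ℂ × ℂ, q ≠ 0 →
      (∃ m : ℤ, 0 < e (rot n (g * m) • q)) ∧ ∃ m : ℤ, e (rot n (g * m) • q) < 0 := by
    intro q hq
    rcases le_total ‖q.2‖ ‖q.1‖ with hle | hle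
    · exact sign q hq hle
    · obtain ⟨⟨m, hm⟩, m', hm'⟩ :=
        sign (jmap q) (mt jmap_eq_zero.1 hq) (by simpa [jmap] using hle)
      have conv : ∀ m : ℤ, e (rot n (g * m) • jmap q) = e (rot n (g * (-m : ℤ)) • q) := by
        intro m
        rw [← ej (rot n (g * (-m : ℤ)) • q), jrot]
        push_cast
        rw [mul_neg, neg_neg]
      exact ⟨⟨-m, by rw [← conv]; exact hm⟩, -m', by rw [← conv]; exact hm'⟩
  have no_half : ∀ q : ℂ × ℂ, q ≠ 0 → ‖q.2‖ ≤ ‖q.1‖ → e (rot n (-g) • q) = 0 → e q = 0 →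
      e (rot n g • q) = 0 → False := by
    intro q hq hle em e0 ep
    have e0' : e (rot n 0 • q) = 0 := by rwa [rot_zero, one_smul]
    rw [formula _ q hle] at em e0' ep
    rw [mul_neg, ← conj_rot, ← hτ, ← map_pow] at em
    rw [← hτ] at ep
    rw [mul_zero, rot_zero, one_pow, one_mul, one_mul] at e0'
    set P := q.1 * q.2 with hP
    set c := Y q ^ k with hc
    simp only [Complex.mul_im, Complex.mul_re, Complex.conj_re, Complex.conj_im] at em ep
    have main : C * (1 - τ.re) * ‖c‖ = c.re * (τ.re - (τ ^ k).re) := by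
      linear_combination (em + ep) / 2 - τ.re * e0'
    have bound : c.re * (τ.re - (τ ^ k).re) ≤ ‖c‖ * |τ.re - (τ ^ k).re| :=
      (le_abs_self _).trans (by rw [abs_mul]; gcongr; exact Complex.abs_re_le_norm c)
    have hc0 : c = 0 := by
      by_contra hne0
      have : 0 < ‖c‖ := norm_pos_iff.2 hne0
      nlinarith
    rw [hc0] at e0' ep
    simp only [Complex.zero_re, Complex.zero_im, mul_zero, norm_zero, add_zero, sub_zero] at e0' ep
    have him : τ.im ≠ 0 := by
      intro h
      have := Complex.normSq_eq_norm_sq τ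
      rw [τ1, Complex.normSq_apply, h] at this
      apply τsq
      apply Complex.ext <;> simp [pow_two, h]
      linarith
    have hP0 : P = 0 := by
      rw [e0', mul_zero, zero_add] at ep
      exact Complex.ext ((mul_eq_zero.1 ep).resolve_left him) e0'
    rcases hne q hq hle with h | h
    · exact h hP0
    · exact h hc0
  have no : ∀ q : ℂ × ℂ, q ≠ 0 → e (rot n (-g) • q) = 0 → e q = 0 →
      e (rot n g • q) = 0 → False := by
    intro q hq em e0 ep
    rcases le_total ‖q.2‖ ‖q.1‖ with hle | hle
    · exact no_half q hq hle em e0 ep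
    · refine no_half (jmap q) (mt jmap_eq_zero.1 hq) (by simpa [jmap] using hle) ?_ ?_ ?_
      · rwa [← jrot, ej]
      · rwa [ej]
      · rwa [← neg_neg (g : ℝ), ← jrot, ej]
  have nz : ∀ (t : ℝ) (q : ℂ × ℂ), q ≠ 0 → rot n t • q ≠ 0 :=
    fun t q hq => smul_ne_zero (rot_ne_zero n t) hq
  refine separable_progression_of_sign_change hn g (e := fun q => e (rot n (g / 2) • q))
    (ec.comp (continuous_const_smul _)) (fun q => ?_) (fun q hq => ?_) (fun q hq => ?_)
    (fun q hq em e0 ep => ?_)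
  · rw [← neg_neg (g / 2 : ℝ), ← jrot, ej, neg_neg, smul_smul, ← rot_add]
    congr 3; ring
  · simp only [smul_comm (rot n (g / 2 : ℝ))]
    exact (sign' _ (nz _ q hq)).1
  · simp only [smul_comm (rot n (g / 2 : ℝ))]
    exact (sign' _ (nz _ q hq)).2
  · rw [smul_comm] at em ep
    exact no _ (nz _ q hq) em e0 ep

lemma abs_quartic_lt {x : ℝ} (h : 37 / 50 ≤ x) (h' : x ≤ 9 / 10) :
    |-x - (8 * x ^ 4 - 8 * x ^ 2 + 1)| < 49 / 100 * (1 - -x) := by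
  have f : x ^ 2 * (1 - x) < 18 / 100 := by nlinarith [sq_nonneg (x - 2 / 3)]
  have f' : 7 / 100 < x ^ 2 * (1 - x) := by
    have : 0 ≤ (9 / 10 - x) * (x ^ 2 - x / 10 - 9 / 100) :=
      mul_nonneg (by linarith) (by nlinarith)
    linarith
  rw [abs_lt, show -x - (8 * x ^ 4 - 8 * x ^ 2 + 1) = (1 + x) * (8 * (x ^ 2 * (1 - x)) - 1) by ring]
  have h1 : 0 < (1 + x) * (149 / 100 - 8 * (x ^ 2 * (1 - x))) :=
    mul_pos (by linarith) (by linarith)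
  have h2 : 0 < (1 + x) * (8 * (x ^ 2 * (1 - x)) - 51 / 100) :=
    mul_pos (by linarith) (by linarith)
  constructor <;> linarith

/-- The set `{0, g, 2 g, 3 g}` modulo `3 p + 2 q`, where `g = p + q`. -/
lemma separable_progression {p q : ℕ} (hp : 0 < p) (hq : 0 < q) (hpq : p ≠ q) :
    Separable4 (3 * p + 2 * q) {0, (p + q : ℤ), 2 * (p + q : ℤ), 3 * (p + q : ℤ)} := by
  set n := 3 * p + 2 * q with hn
  have hn0 : 0 < n := by omega
  have hncast : (n : ℤ) = 3 * p + 2 * q := by rw [hn]; push_cast; rfl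
  set g : ℤ := p + q with hg
  have nd : ∀ (t k : ℤ), n * k < t → t < n * (k + 1) → ¬ (n : ℤ) ∣ t := fun t k h1 h2 =>
    (Int.exists_lt_and_lt_iff_not_dvd t (by omega)).1 ⟨k, h1, h2⟩
  have d1 : ¬ (n : ℤ) ∣ g := nd _ 0 (by omega) (by omega)
  have d2 : ¬ (n : ℤ) ∣ 2 * g := nd _ 0 (by omega) (by omega)
  have d3 : ¬ (n : ℤ) ∣ 3 * g := nd _ 1 (by omega) (by omega)
  have d4 : ¬ (n : ℤ) ∣ 4 * g := nd _ 1 (by omega) (by omega)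
  have d5 : ¬ (n : ℤ) ∣ 5 * g := by
    rcases lt_or_gt_of_ne hpq with h | h
    · exact nd _ 2 (by omega) (by omega)
    · exact nd _ 1 (by omega) (by omega)
  have d6 : ¬ (n : ℤ) ∣ 6 * g := nd _ 2 (by omega) (by omega)
  set τ : ℂ := rot n (2 * g) with hτ
  obtain ⟨x, hx⟩ : ∃ x : ℝ, τ.re = -x := ⟨-τ.re, by ring⟩
  have τsq : τ.im ^ 2 = 1 - x ^ 2 := by
    have := Complex.normSq_eq_norm_sq τ
    rw [norm_rot, Complex.normSq_apply, hx] at this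
    linarith
  have re2 : (τ ^ 2).re = 2 * x ^ 2 - 1 := by
    simp only [pow_two τ, Complex.mul_re, hx]
    linarith
  have im2 : (τ ^ 2).im = -2 * x * τ.im := by
    simp only [pow_two τ, Complex.mul_im, hx]
    ring
  have re3 : (τ ^ 3).re = 3 * x - 4 * x ^ 3 := by
    rw [pow_succ, Complex.mul_re, re2, im2, hx]
    linear_combination 2 * x * τsq
  have re4 : (τ ^ 4).re = 8 * x ^ 4 - 8 * x ^ 2 + 1 := by
    rw [show τ ^ 4 = τ ^ 2 * τ ^ 2 by ring, Complex.mul_re, re2, im2]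
    linear_combination -4 * x ^ 2 * τsq
  have ratio : (2 * g * Real.pi / n : ℝ) = 2 * Real.pi * ((p + q) / (3 * p + 2 * q)) := by
    rw [hg, hn]
    push_cast
    ring
  have hp' : (0 : ℝ) < p := by exact_mod_cast hp
  have hq' : (0 : ℝ) < q := by exact_mod_cast hq
  have hcos : τ.re = Real.cos (2 * Real.pi * ((p + q) / (3 * p + 2 * q))) := by
    rw [hτ, rot, ratio, Complex.exp_ofReal_mul_I_re]
  have lo : (1 : ℝ) / 3 < (p + q) / (3 * p + 2 * q) := by
    rw [div_lt_div_iff₀ (by norm_num) (by positivity)]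
    linarith
  have hi : ((p + q) / (3 * p + 2 * q) : ℝ) < 1 / 2 := by
    rw [div_lt_div_iff₀ (by positivity) (by norm_num)]
    linarith
  have hπ := Real.pi_pos
  have x1 : x < 1 := by
    have := Real.cos_lt_cos_of_nonneg_of_le_pi (x := 2 * Real.pi * ((p + q) / (3 * p + 2 * q)))
      (y := Real.pi) (by positivity) le_rfl (by nlinarith)
    rw [← hcos, Real.cos_pi, hx] at this
    linarith
  have x0 : 1 / 2 < x := by
    have := Real.cos_lt_cos_of_nonneg_of_le_pi (x := Real.pi - Real.pi / 3)
      (y := 2 * Real.pi * ((p + q) / (3 * p + 2 * q))) (by linarith) (by nlinarith) (by nlinarith)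
    rw [← hcos, Real.cos_pi_sub, Real.cos_pi_div_three, hx] at this
    linarith
  rcases lt_or_ge x (37 / 50) with h | h
  · refine separable_progression_of_power hn0 g (k := 2) (by norm_num) d1 d2 (by simpa using d2)
      (by norm_num; exact d1) (by norm_num; exact d3) (by norm_num; exact d4)
      (C := 49 / 100) (by norm_num) (by norm_num) ?_
    rw [← hτ, re2, hx, abs_lt]
    constructor <;> nlinarith
  rcases le_or_gt x (9 / 10) with h' | h'
  · refine separable_progression_of_power hn0 g (k := 4) (by norm_num) d1 d2 (by simpa using d4)
      (by norm_num; exact d3) (by norm_num; exact d5) ?_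
      (C := 49 / 100) (by norm_num) (by norm_num) ?_
    · intro d8
      have τpow : ∀ m : ℕ, τ ^ m = rot n (2 * (m * g : ℤ)) := by
        intro m
        have := rot_int_mul n m (2 * g)
        rw [zpow_natCast] at this
        rw [hτ, ← this]
        push_cast
        ring_nf
      have t8 : τ ^ 8 = 1 := by
        rw [τpow, rot_two_mul_eq_one hn0]; exact_mod_cast d8
      have t4 : τ ^ 4 ≠ 1 := by
        rw [τpow, Ne, rot_two_mul_eq_one hn0]; exact_mod_cast d4
      have : (τ ^ 4 - 1) * (τ ^ 4 + 1) = 0 := by linear_combination t8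
      have t4' : τ ^ 4 = -1 := by
        linear_combination (mul_eq_zero.1 this).resolve_left (sub_ne_zero.2 t4)
      rw [t4'] at re4
      have h0 : (2 * x ^ 2 - 1) ^ 2 = 0 := by
        simp at re4
        linarith
      have := pow_eq_zero_iff (by norm_num) |>.1 h0
      nlinarith
    · rw [← hτ, re4, hx, abs_lt]
      exact abs_lt.1 (abs_quartic_lt h h')
  · refine separable_progression_of_power hn0 g (k := 3) (by norm_num) d1 d2 (by simpa using d3)
      (by norm_num; exact d2) (by norm_num; exact d4) (by norm_num; exact d6)
      (C := 49 / 100) (by norm_num) (by norm_num) ?_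
    rw [← hτ, re3, hx, abs_lt]
    have : x * (1 - x) < 9 / 100 + 1 / 100 := by nlinarith
    constructor <;> nlinarith

lemma stdAddChar_eq_rot {n : ℕ} [NeZero n] (s : ℤ) :
    (ZMod.stdAddChar (s : ZMod n) : ℂ) = rot n (2 * s) := by
  rw [ZMod.stdAddChar_coe, rot]
  congr 1
  push_cast
  ring

lemma norm_stdAddChar {n : ℕ} [NeZero n] (s : ZMod n) : ‖(ZMod.stdAddChar s : ℂ)‖ = 1 :=
  AddChar.norm_apply _ _

lemma re_stdAddChar_le {n : ℕ} [NeZero n] {s : ZMod n} (hs : s ≠ 0) :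
    (ZMod.stdAddChar s : ℂ).re ≤ Real.cos (2 * (Real.pi / n)) := by
  have hn : (0 : ℝ) < n := by exact_mod_cast NeZero.pos n
  have hπ := Real.pi_pos
  have hv : 0 < s.val := Nat.pos_of_ne_zero fun h => hs ((ZMod.val_eq_zero s).1 h)
  have hlt := s.val_lt
  have key : (ZMod.stdAddChar s : ℂ).re = Real.cos (2 * s.val * Real.pi / n) := by
    conv_lhs => rw [← ZMod.natCast_zmod_val s]
    have := stdAddChar_eq_rot (n := n) (s.val : ℤ)
    rw [Int.cast_natCast] at this
    rw [this, rot, Complex.exp_ofReal_mul_I_re, Int.cast_natCast]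
  have main : ∀ v : ℕ, 1 ≤ v → 2 * v ≤ n →
      Real.cos (2 * v * Real.pi / n) ≤ Real.cos (2 * (Real.pi / n)) := by
    intro v h1 h2
    have h1' : (1 : ℝ) ≤ v := by exact_mod_cast h1
    have h2' : (2 : ℝ) * v ≤ n := by exact_mod_cast h2
    apply Real.cos_le_cos_of_nonneg_of_le_pi (by positivity)
    · rw [div_le_iff₀ hn]; nlinarith
    · rw [← mul_div_assoc]
      gcongr
      nlinarith
  rw [key]
  rcases le_total (2 * s.val) n with h | h
  · exact main _ hv h
  · have := main (n - s.val) (by omega) (by omega)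
    rw [Nat.cast_sub hlt.le] at this
    convert this using 1
    rw [show 2 * ((n : ℝ) - s.val) * Real.pi / n = 2 * Real.pi - 2 * s.val * Real.pi / n by
      field_simp, Real.cos_two_pi_sub]

/-- A bump supported on the sector of half-angle `π / n` around the positive real axis. -/
def sector (n : ℕ) (y : ℂ) : ℝ := max 0 (y.re - Real.cos (Real.pi / n) * ‖y‖)

lemma continuous_sector (n : ℕ) : Continuous (sector n) := by unfold sector; fun_prop

lemma sector_smul (n : ℕ) {r : ℝ} (hr : 0 ≤ r) (y : ℂ) : sector n (r * y) = r * sector n y := by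
  simp only [sector, Complex.re_ofReal_mul, norm_mul, Complex.norm_real, Real.norm_of_nonneg hr]
  rw [mul_max_of_nonneg _ _ hr]
  ring_nf

lemma sector_unique {n : ℕ} [NeZero n] (hn : 2 ≤ n) {y : ℂ} {s t : ZMod n}
    (hs : sector n (ZMod.stdAddChar s * y) ≠ 0) (ht : sector n (ZMod.stdAddChar t * y) ≠ 0) :
    s = t := by
  by_contra hst
  have hn' : (2 : ℝ) ≤ n := by exact_mod_cast hn
  have hπ := Real.pi_pos
  set c := Real.cos (Real.pi / n) with hc
  have c0 : 0 ≤ c := by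
    apply Real.cos_nonneg_of_neg_pi_div_two_le_of_le
    · have : 0 ≤ Real.pi / n := by positivity
      linarith
    · gcongr
  have hy : y ≠ 0 := by rintro rfl; simp [sector] at hs
  have hy' : 0 < ‖y‖ := norm_pos_iff.2 hy
  have lt : ∀ s : ZMod n, sector n (ZMod.stdAddChar s * y) ≠ 0 →
      c * ‖y‖ < (ZMod.stdAddChar s * y).re := by
    intro s hs
    by_contra! h
    apply hs
    rw [sector, norm_mul, norm_stdAddChar, one_mul]
    exact max_eq_left (by linarith)
  have hs' := lt s hs
  have ht' := lt t ht
  have hn1 : ∀ s : ZMod n, (ZMod.stdAddChar s * y).re ^ 2 + (ZMod.stdAddChar s * y).im ^ 2 =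
      ‖y‖ ^ 2 := by
    intro s
    have := Complex.normSq_eq_norm_sq (ZMod.stdAddChar s * y)
    rw [norm_mul, norm_stdAddChar, one_mul, Complex.normSq_apply] at this
    linarith
  have e1 := hn1 s
  have e2 := hn1 t
  have hre := re_stdAddChar_le (sub_ne_zero.2 hst)
  rw [Real.cos_two_mul, ← hc] at hre
  have prod : (ZMod.stdAddChar (s - t) : ℂ).re * ‖y‖ ^ 2 =
      (ZMod.stdAddChar s * y).re * (ZMod.stdAddChar t * y).re +
      (ZMod.stdAddChar s * y).im * (ZMod.stdAddChar t * y).im := by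
    have h1 : (ZMod.stdAddChar (s - t) : ℂ) * (‖y‖ ^ 2 : ℝ) =
        (ZMod.stdAddChar s * y) * (starRingEnd ℂ) (ZMod.stdAddChar t * y) := by
      have h2 : (ZMod.stdAddChar t : ℂ) * (starRingEnd ℂ) (ZMod.stdAddChar t : ℂ) = 1 := by
        rw [Complex.mul_conj, Complex.normSq_eq_norm_sq, norm_stdAddChar]; simp
      have h3 : (ZMod.stdAddChar s : ℂ) = ZMod.stdAddChar (s - t) * ZMod.stdAddChar t := by
        rw [← AddChar.map_add_eq_mul, sub_add_cancel]
      have h4 := Complex.mul_conj y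
      rw [Complex.normSq_eq_norm_sq] at h4
      rw [h3, map_mul, ← h4]
      linear_combination -(ZMod.stdAddChar (s - t) : ℂ) * y * (starRingEnd ℂ) y * h2
    have h2 := congrArg Complex.re h1
    rw [Complex.re_mul_ofReal, Complex.mul_re, Complex.conj_re, Complex.conj_im] at h2
    linarith
  set a := (ZMod.stdAddChar s * y).re
  set b := (ZMod.stdAddChar t * y).re
  set a' := (ZMod.stdAddChar s * y).im
  set b' := (ZMod.stdAddChar t * y).im
  have cy : 0 ≤ c * ‖y‖ := by positivity
  have h1 : (c * ‖y‖) ^ 2 < a * b := by nlinarith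
  have h2 : -(a' * b') ≤ (a' ^ 2 + b' ^ 2) / 2 := by nlinarith [sq_nonneg (a' + b')]
  have h3 : (c * ‖y‖) ^ 2 < a ^ 2 := by nlinarith
  have h4 : (c * ‖y‖) ^ 2 < b ^ 2 := by nlinarith
  have h5 : (ZMod.stdAddChar (s - t) : ℂ).re * ‖y‖ ^ 2 ≤ (2 * c ^ 2 - 1) * ‖y‖ ^ 2 := by gcongr
  nlinarith

lemma sector_cover {n : ℕ} [NeZero n] {y : ℂ} (hy : y ≠ 0) :
    ∃ s : ZMod n, sector n (ZMod.stdAddChar s * y) ≠ 0 ∨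
      sector n (ZMod.stdAddChar s * (y * rot n (-1))) ≠ 0 := by
  have hn : (0 : ℝ) < n := by exact_mod_cast NeZero.pos n
  have hn1 : (1 : ℝ) ≤ n := by exact_mod_cast NeZero.one_le (n := n)
  have hπ := Real.pi_pos
  have hy' : 0 < ‖y‖ := norm_pos_iff.2 hy
  set m := ⌊y.arg * n / (2 * Real.pi)⌋ with hm
  have hle := Int.floor_le (y.arg * n / (2 * Real.pi))
  have hlt := Int.lt_floor_add_one (y.arg * n / (2 * Real.pi))
  rw [← hm, le_div_iff₀ (by positivity)] at hle
  rw [← hm, div_lt_iff₀ (by positivity)] at hlt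
  set φ := y.arg - 2 * m * Real.pi / n with hφ
  have φ0 : 0 ≤ φ := by
    rw [hφ, sub_nonneg, div_le_iff₀ hn]; linarith
  have φ1 : φ < 2 * (Real.pi / n) := by
    have : φ * n < 2 * Real.pi := by
      rw [hφ, sub_mul, div_mul_cancel₀ _ hn.ne']; linarith
    rw [← mul_div_assoc, lt_div_iff₀ hn]
    exact this
  have polar : (ZMod.stdAddChar ((-m : ℤ) : ZMod n) : ℂ) * y =
      (‖y‖ : ℝ) * Complex.exp ((φ : ℝ) * Complex.I) := by
    conv_lhs => rw [← Complex.norm_mul_exp_arg_mul_I y]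
    rw [stdAddChar_eq_rot, rot, mul_left_comm, ← Complex.exp_add, hφ]
    congr 2
    push_cast
    ring
  have sec : ∀ θ : ℝ, 0 ≤ θ → θ < Real.pi / n →
      sector n ((‖y‖ : ℝ) * Complex.exp ((θ : ℝ) * Complex.I)) ≠ 0 := by
    intro θ h0 h1
    rw [sector_smul _ hy'.le]
    refine mul_ne_zero hy'.ne' ?_
    rw [sector, Complex.norm_exp_ofReal_mul_I, Complex.exp_ofReal_mul_I_re]
    have : Real.cos (Real.pi / n) < Real.cos θ :=
      Real.cos_lt_cos_of_nonneg_of_le_pi h0 (div_le_self hπ.le hn1) h1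
    exact (lt_max_of_lt_right (by linarith)).ne'
  refine ⟨((-m : ℤ) : ZMod n), ?_⟩
  rcases lt_or_ge φ (Real.pi / n) with h | h
  · left
    rw [polar]
    exact sec φ φ0 h
  · right
    have : (ZMod.stdAddChar ((-m : ℤ) : ZMod n) : ℂ) * (y * rot n (-1)) =
        (‖y‖ : ℝ) * Complex.exp ((φ - Real.pi / n : ℝ) * Complex.I) := by
      rw [← mul_assoc, polar, rot, mul_assoc, ← Complex.exp_add]
      congr 2
      push_cast
      ring
    rw [this]
    exact sec _ (by linarith) (by linarith)

/-- A star forest with four edges `(a i, b i)`, two of which share their centre. -/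
def IsForest {Z : Type*} (a b : Fin 4 → Z) : Prop :=
  Function.Injective b ∧ (∀ i j, a i ≠ b j) ∧ a 0 = a 1

lemma IsForest.sub {Z : Type*} [AddGroup Z] {a b : Fin 4 → Z} (h : IsForest a b) (t : Z) :
    IsForest (fun i => a i - t) (fun i => b i - t) :=
  ⟨fun i j hij => h.1 (sub_left_injective hij), fun i j hij => h.2.1 i j (sub_left_injective hij),
    by simp [h.2.2]⟩

/-- The differences of `f` along the edges `(a i, b i)`. -/
def edgeDiff {Z : Type*} (a b : Fin 4 → Z) : (Z → ℝ) →ₗ[ℝ] (Fin 4 → ℝ) where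
  toFun f i := f (a i) - f (b i)
  map_add' f g := by ext i; simp; ring
  map_smul' r f := by ext i; simp; ring

lemma edgeDiff_surjective {Z : Type*} [DecidableEq Z] {a b : Fin 4 → Z} (h : IsForest a b) :
    Function.Surjective (edgeDiff a b) := by
  intro r
  refine ⟨fun z => -∑ j, if b j = z then r j else 0, ?_⟩
  ext i
  have h1 : ∀ j, b j ≠ a i := fun j hj => h.2.1 i j hj.symm
  have h2 : ∀ j, (b j = b i) = (j = i) := fun j => by rw [h.1.eq_iff]
  simp [edgeDiff, h1, h2]

/-- The real wave with amplitude `p`. -/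
def wave {n : ℕ} [NeZero n] (p : ℂ) (s : ZMod n) : ℝ := (ZMod.stdAddChar s * p).re

lemma eq_zero_of_wave_eq {n : ℕ} [NeZero n] {p : ℂ} {a b c : ZMod n} (hab : a ≠ b) (hac : a ≠ c)
    (hbc : b ≠ c) (h1 : wave p a = wave p b) (h2 : wave p a = wave p c) : p = 0 := by
  by_contra hp
  have key : ∀ s t : ZMod n, s ≠ t → wave p s = wave p t →
      (ZMod.stdAddChar s * p).im = -(ZMod.stdAddChar t * p).im := by
    intro s t hst h
    have hn1 : ∀ s : ZMod n, (ZMod.stdAddChar s * p).re ^ 2 + (ZMod.stdAddChar s * p).im ^ 2 =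
        ‖p‖ ^ 2 := by
      intro s
      have := Complex.normSq_eq_norm_sq (ZMod.stdAddChar s * p)
      rw [norm_mul, norm_stdAddChar, one_mul, Complex.normSq_apply] at this
      linarith
    have e1 := hn1 s
    have e2 := hn1 t
    simp only [wave] at h
    rw [h] at e1
    have : (ZMod.stdAddChar s * p).im ^ 2 = (ZMod.stdAddChar t * p).im ^ 2 := by linarith
    rcases sq_eq_sq_iff_eq_or_eq_neg.1 this with h' | h'
    · exact absurd (ZMod.injective_stdAddChar (mul_right_cancel₀ hp (Complex.ext h h'))) hst
    · exact h'
  have e1 := key a b hab h1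
  have e2 := key a c hac h2
  have e3 := key b c hbc (h1.symm.trans h2)
  have z1 : (ZMod.stdAddChar a * p).im = (ZMod.stdAddChar b * p).im := by linarith
  exact hab (ZMod.injective_stdAddChar (mul_right_cancel₀ hp (Complex.ext h1 z1)))

/-- Linear parametrization of waves plus multiples of `w`. -/
def waveMap {n : ℕ} [NeZero n] (w : ZMod n → ℝ) : (ℂ × ℝ) →ₗ[ℝ] (ZMod n → ℝ) where
  toFun x s := wave x.1 s + x.2 * w s
  map_add' x y := by ext s; simp [wave, mul_add]; ring
  map_smul' r x := by
    ext s
    simp only [wave, Prod.smul_fst, Prod.smul_snd, RingHom.id_apply, Pi.smul_apply, smul_eq_mul,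
      mul_smul_comm, Complex.smul_re]
    ring

lemma exists_generic {n : ℕ} [NeZero n] (w : ZMod n → ZMod n → ℝ) :
    ∃ v : ZMod n → ℝ, ∀ a b : Fin 4 → ZMod n, IsForest a b → ∀ (x : ZMod n) (p : ℂ) (r : ℝ),
      edgeDiff a b v ≠ edgeDiff a b (fun s => wave p s + r * w x s) := by
  set ι := {e : (Fin 4 → ZMod n) × (Fin 4 → ZMod n) // IsForest e.1 e.2} × ZMod n
  set W : ι → Submodule ℝ (ZMod n → ℝ) := fun i =>
    (LinearMap.range (edgeDiff i.1.1.1 i.1.1.2 ∘ₗ waveMap (w i.2))).comap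
      (edgeDiff i.1.1.1 i.1.1.2) with hW
  have hne : ∀ i, W i ≠ ⊤ := by
    intro i htop
    have hr : LinearMap.range (edgeDiff i.1.1.1 i.1.1.2 ∘ₗ waveMap (w i.2)) = ⊤ := by
      rw [eq_top_iff]
      rintro r -
      obtain ⟨f, rfl⟩ := edgeDiff_surjective i.1.2 r
      have : f ∈ W i := by rw [htop]; trivial
      exact this
    have h1 := LinearMap.finrank_range_le (edgeDiff i.1.1.1 i.1.1.2 ∘ₗ waveMap (w i.2))
    rw [hr, finrank_top] at h1
    simp [Complex.finrank_real_complex] at h1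
  have : (⋃ i ∈ (Set.finite_range W).toFinset, (i : Set (ZMod n → ℝ))) ≠ Set.univ := by
    refine Subspace.biUnion_ne_univ_of_top_notMem ?_
    simpa using hne
  obtain ⟨v, hv⟩ := (Set.ne_univ_iff_exists_notMem _).1 this
  refine ⟨v, fun a b hab x p r h => hv ?_⟩
  simp only [Set.mem_iUnion]
  refine ⟨W (⟨(a, b), hab⟩, x), by simp, ?_⟩
  exact ⟨(p, r), h.symm⟩

lemma exists_shift_eq_sum {n : ℕ} [NeZero n] (hn : 2 ≤ n) (u : ZMod n → ℝ) (y : ℂ) :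
    ∃ t : ZMod n, (∀ s, (∑ x, u x * sector n (ZMod.stdAddChar (-x) * (ZMod.stdAddChar s * y))) =
      sector n (ZMod.stdAddChar t * y) * u (s - t)) ∧
      ∀ t' : ZMod n, sector n (ZMod.stdAddChar t' * y) ≠ 0 →
        sector n (ZMod.stdAddChar t * y) ≠ 0 := by
  have hmul : ∀ s x : ZMod n, (ZMod.stdAddChar (-x) : ℂ) * (ZMod.stdAddChar s * y) =
      ZMod.stdAddChar (s - x) * y := by
    intro s x
    rw [← mul_assoc, ← AddChar.map_add_eq_mul, neg_add_eq_sub]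
  obtain ⟨t, ht⟩ : ∃ t : ZMod n, ∀ t' : ZMod n,
      sector n (ZMod.stdAddChar t' * y) ≠ 0 → t' = t := by
    by_cases h : ∃ t : ZMod n, sector n (ZMod.stdAddChar t * y) ≠ 0
    · obtain ⟨t, ht⟩ := h
      exact ⟨t, fun t' ht' => sector_unique hn ht' ht⟩
    · push Not at h
      exact ⟨0, fun t' ht' => absurd (h t') ht'⟩
  refine ⟨t, fun s => ?_, fun t' ht' => ht t' ht' ▸ ht'⟩
  rw [Finset.sum_eq_single (s - t)]
  · rw [hmul, sub_sub_cancel, mul_comm]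
  · intro x _ hx
    rw [hmul]
    by_contra h
    have := ht _ (right_ne_zero_of_mul h)
    exact hx (by rw [← this, sub_sub_cancel])
  · simp

/-- There is a continuous, positively homogeneous function on the plane whose samples along
the orbits of the `n`-th roots of unity are in general position with respect to the waves. -/
lemma exists_general_position {n : ℕ} [NeZero n] (hn : 2 ≤ n) :
    ∃ K : ℂ → ℝ, Continuous K ∧ (∀ r : ℝ, 0 ≤ r → ∀ y, K (r * y) = r * K y) ∧
      ∀ a b : Fin 4 → ZMod n, IsForest a b → ∀ p y, (p, y) ≠ (0 : ℂ × ℂ) →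
        ∃ i, wave p (a i) + K (ZMod.stdAddChar (a i) * y) ≠
          wave p (b i) + K (ZMod.stdAddChar (b i) * y) := by
  obtain ⟨u, hu⟩ := exists_generic (n := n) fun _ _ => 0
  obtain ⟨v, hv⟩ := exists_generic (n := n) fun x s => u (s - x)
  set K : ℂ → ℝ := fun y => ∑ x : ZMod n, u x * sector n (ZMod.stdAddChar (-x) * y) +
    ∑ x : ZMod n, v x * sector n (ZMod.stdAddChar (-x) * (y * rot n (-1))) with hK
  have K0 : ∀ r : ℝ, 0 ≤ r → ∀ y, K (r * y) = r * K y := by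
    intro r hr y
    simp only [hK, mul_add, Finset.mul_sum]
    congr 1 <;> refine Finset.sum_congr rfl fun x _ => ?_
    · rw [mul_left_comm, sector_smul n hr, mul_left_comm]
    · rw [mul_assoc (r : ℂ), mul_left_comm, sector_smul n hr, mul_left_comm]
  refine ⟨K, ?_, K0, ?_⟩
  · have := continuous_sector n
    fun_prop
  · intro a b hab p y hpy
    by_contra! hcon
    have hcon' : edgeDiff a b (fun s => wave p s + K (ZMod.stdAddChar s * y)) = 0 := by
      ext i
      simp [edgeDiff, hcon i]
    by_cases hy : y = 0
    · subst hy
      have h0 : K 0 = 0 := by simpa using K0 0 le_rfl 0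
      simp only [mul_zero, h0, add_zero] at hcon
      have hp := eq_zero_of_wave_eq (hab.2.1 0 0) (hab.2.1 0 1) (hab.1.ne (by decide))
        (hcon 0) (hab.2.2 ▸ hcon 1)
      exact hpy (by simp [hp])
    obtain ⟨t₁, h₁, h₁'⟩ := exists_shift_eq_sum hn u y
    obtain ⟨t₂, h₂, h₂'⟩ := exists_shift_eq_sum hn v (y * rot n (-1))
    set α := sector n (ZMod.stdAddChar t₁ * y) with hα
    set β := sector n (ZMod.stdAddChar t₂ * (y * rot n (-1))) with hβ
    have hKs : ∀ s : ZMod n, K (ZMod.stdAddChar s * y) = α * u (s - t₁) + β * v (s - t₂) := by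
      intro s
      simp only [hK, mul_assoc, h₁, h₂]
    have wave_shift : ∀ (t s : ZMod n), wave p (s + t) = wave (ZMod.stdAddChar t * p) s := by
      intro t s
      rw [wave, wave, AddChar.map_add_eq_mul, mul_assoc]
    have wave_smul : ∀ (r : ℝ) (p : ℂ) (s : ZMod n), wave (r * p) s = r * wave p s := by
      intro r p s
      rw [wave, wave, mul_left_comm, Complex.re_ofReal_mul]
    simp only [hKs] at hcon
    by_cases hb : β = 0
    · have ha : α ≠ 0 := by
        obtain ⟨s, hs | hs⟩ := sector_cover (n := n) hy
        · exact h₁' s hs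
        · exact absurd hb (h₂' s hs)
      refine hu _ _ (hab.sub t₁) 0 ((-α⁻¹ : ℝ) * (ZMod.stdAddChar t₁ * p)) 0 ?_
      ext i
      have h := hcon i
      have w1 := wave_shift t₁ (a i - t₁)
      have w2 := wave_shift t₁ (b i - t₁)
      rw [sub_add_cancel] at w1 w2
      rw [w1, w2, hb] at h
      simp only [edgeDiff, LinearMap.coe_mk, AddHom.coe_mk, wave_smul]
      field_simp
      linarith
    · refine hv _ _ (hab.sub t₂) (t₁ - t₂) ((-β⁻¹ : ℝ) * (ZMod.stdAddChar t₂ * p)) (-β⁻¹ * α) ?_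
      ext i
      have h := hcon i
      have w1 := wave_shift t₂ (a i - t₂)
      have w2 := wave_shift t₂ (b i - t₂)
      rw [sub_add_cancel] at w1 w2
      rw [w1, w2] at h
      simp only [edgeDiff, LinearMap.coe_mk, AddHom.coe_mk, wave_smul, sub_sub_sub_cancel_right]
      field_simp
      linarith

lemma exists_lower_bound {E : Type*} [NormedAddCommGroup E] [NormedSpace ℝ E] [ProperSpace E]
    {f : E → ℝ} (hc : Continuous f) (hr : ∀ r : ℝ, 0 ≤ r → ∀ x, f (r • x) = r * f x)
    (hpos : ∀ x ≠ 0, 0 < f x) : ∃ c : ℝ, 0 < c ∧ ∀ x, c * ‖x‖ ≤ f x := by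
  have scale : ∀ x : E, x ≠ 0 → f x = ‖x‖ * f (‖x‖⁻¹ • x) := by
    intro x hx
    rw [← hr _ (norm_nonneg x), smul_smul, mul_inv_cancel₀ (norm_ne_zero_iff.2 hx), one_smul]
  have f0 : f 0 = 0 := by simpa using hr 0 le_rfl 0
  rcases (Metric.sphere (0 : E) 1).eq_empty_or_nonempty with h | h
  · refine ⟨1, one_pos, fun x => ?_⟩
    by_cases hx : x = 0
    · simp [hx, f0]
    · have : ‖x‖⁻¹ • x ∈ Metric.sphere (0 : E) 1 := by simp [norm_smul, hx]
      rw [h] at this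
      exact absurd this (Set.notMem_empty _)
  · obtain ⟨x₀, hx₀, hmin⟩ := (isCompact_sphere (0 : E) 1).exists_isMinOn h hc.continuousOn
    refine ⟨f x₀, hpos _ (ne_zero_of_mem_unit_sphere ⟨x₀, hx₀⟩), fun x => ?_⟩
    by_cases hx : x = 0
    · simp [hx, f0]
    · have : ‖x‖⁻¹ • x ∈ Metric.sphere (0 : E) 1 := by simp [norm_smul, hx]
      rw [scale x hx, mul_comm]
      exact mul_le_mul_of_nonneg_left (hmin this) (norm_nonneg x)

lemma exists_uniform_pos {ι : Type*} [Finite ι] {P : ι → ℝ → Prop}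
    (hmono : ∀ i c c', c' ≤ c → P i c → P i c') (h : ∀ i, ∃ c, 0 < c ∧ P i c) :
    ∃ c, 0 < c ∧ ∀ i, P i c := by
  choose c hc hP using h
  cases isEmpty_or_nonempty ι
  · exact ⟨1, one_pos, fun i => isEmptyElim i⟩
  · obtain ⟨i₀, h₀⟩ := Finite.exists_min c
    exact ⟨c i₀, hc i₀, fun i => hmono i _ _ (h₀ i) (hP i)⟩

/-- The function on `ℤ/n` sampling the wave with amplitude `p` perturbed by `K` along the
orbit of `y`. -/
def profile {n : ℕ} [NeZero n] (K : ℂ → ℝ) (p y : ℂ) (s : ZMod n) : ℝ :=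
  wave p s + K (ZMod.stdAddChar s * y)

lemma profile_add {n : ℕ} [NeZero n] (K : ℂ → ℝ) (p y : ℂ) (s t : ZMod n) :
    profile K p y (s + t) = profile K (ZMod.stdAddChar s * p) (ZMod.stdAddChar s * y) t := by
  simp only [profile, wave, AddChar.map_add_eq_mul, ← mul_assoc]
  rw [mul_comm (ZMod.stdAddChar s : ℂ)]

lemma continuous_profile {n : ℕ} [NeZero n] {K : ℂ → ℝ} (hK : Continuous K) (s : ZMod n) :
    Continuous fun x : ℂ × ℂ => profile K x.1 x.2 s := by
  unfold profile wave
  fun_prop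

lemma abs_wave_le {n : ℕ} [NeZero n] (p : ℂ) (s : ZMod n) : |wave p s| ≤ ‖p‖ := by
  refine (Complex.abs_re_le_norm _).trans ?_
  rw [norm_mul, norm_stdAddChar, one_mul]

/-- A quantitative version of `exists_general_position`. -/
lemma exists_profile_bounds {n : ℕ} [NeZero n] (hn : 2 ≤ n) :
    ∃ (K : ℂ → ℝ) (c C : ℝ), Continuous K ∧ K 0 = 0 ∧ 0 < c ∧ 0 ≤ C ∧
      (∀ a b : Fin 4 → ZMod n, IsForest a b → ∀ p y, c * ‖((p, y) : ℂ × ℂ)‖ ≤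
        ∑ i, |profile K p y (a i) - profile K p y (b i)|) ∧
      (∀ p y (s : ZMod n), |profile K p y s| ≤ C * ‖((p, y) : ℂ × ℂ)‖) ∧
      ∀ a b d : ZMod n, a ≠ b → a ≠ d → b ≠ d → ∀ p,
        c * ‖p‖ ≤ |wave p a - wave p b| + |wave p a - wave p d| := by
  obtain ⟨K, hK, hr, hgen⟩ := exists_general_position hn
  have K0 : K 0 = 0 := by simpa using hr 0 le_rfl 0
  have wave_smul : ∀ (r : ℝ) (p : ℂ) (s : ZMod n), wave (r * p) s = r * wave p s := by
    intro r p s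
    rw [wave, wave, mul_left_comm, Complex.re_ofReal_mul]
  have profile_smul : ∀ r : ℝ, 0 ≤ r → ∀ p y (s : ZMod n),
      profile K (r * p) (r * y) s = r * profile K p y s := by
    intro r h p y s
    rw [profile, profile, wave_smul, mul_left_comm, hr r h, mul_add]
  obtain ⟨c₁, hc₁, h₁⟩ := exists_uniform_pos
    (ι := {e : (Fin 4 → ZMod n) × (Fin 4 → ZMod n) // IsForest e.1 e.2})
    (P := fun e c => ∀ x : ℂ × ℂ, c * ‖x‖ ≤
      ∑ i, |profile K x.1 x.2 (e.1.1 i) - profile K x.1 x.2 (e.1.2 i)|)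
    (fun e c c' hcc h x => (mul_le_mul_of_nonneg_right hcc (norm_nonneg _)).trans (h x))
    (fun e => by
      refine exists_lower_bound ?_ ?_ ?_
      · have := continuous_profile (n := n) hK
        fun_prop
      · intro r h x
        simp only [Prod.smul_fst, Prod.smul_snd, Complex.real_smul, profile_smul r h, ← mul_sub,
          abs_mul, abs_of_nonneg h, Finset.mul_sum]
      · intro x hx
        obtain ⟨i, hi⟩ := hgen _ _ e.2 x.1 x.2 hx
        exact Finset.sum_pos' (fun _ _ => abs_nonneg _)
          ⟨i, Finset.mem_univ i, abs_pos.2 (sub_ne_zero.2 hi)⟩)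
  obtain ⟨c₂, hc₂, h₂⟩ := exists_uniform_pos
    (ι := {e : ZMod n × ZMod n × ZMod n // e.1 ≠ e.2.1 ∧ e.1 ≠ e.2.2 ∧ e.2.1 ≠ e.2.2})
    (P := fun e c => ∀ p : ℂ, c * ‖p‖ ≤
      |wave p e.1.1 - wave p e.1.2.1| + |wave p e.1.1 - wave p e.1.2.2|)
    (fun e c c' hcc h x => (mul_le_mul_of_nonneg_right hcc (norm_nonneg _)).trans (h x))
    (fun e => by
      refine exists_lower_bound ?_ ?_ ?_
      · unfold wave
        fun_prop
      · intro r h x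
        simp only [Complex.real_smul, wave_smul, ← mul_sub, abs_mul, abs_of_nonneg h, mul_add]
      · intro x hx
        by_contra! h
        refine hx (eq_zero_of_wave_eq e.2.1 e.2.2.1 e.2.2.2 ?_ ?_)
        · exact sub_eq_zero.1 (abs_nonpos_iff.1
            (by linarith [abs_nonneg (wave x e.1.1 - wave x e.1.2.2)]))
        · exact sub_eq_zero.1 (abs_nonpos_iff.1
            (by linarith [abs_nonneg (wave x e.1.1 - wave x e.1.2.1)])))
  obtain ⟨C, hC⟩ := (isCompact_closedBall (0 : ℂ) 1).exists_bound_of_continuousOn hK.continuousOn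
  have C0 : 0 ≤ C := (norm_nonneg _).trans (hC 0 (by simp))
  have hC' : ∀ y, |K y| ≤ C * ‖y‖ := by
    intro y
    by_cases hy : y = 0
    · simp [hy, K0]
    have h := hC ((‖y‖⁻¹ : ℝ) * y) (by simp [hy])
    rw [hr _ (by positivity), norm_mul, Real.norm_of_nonneg (by positivity), Real.norm_eq_abs] at h
    have : 0 < ‖y‖ := norm_pos_iff.2 hy
    rw [inv_mul_le_iff₀ this] at h
    linarith
  refine ⟨K, min c₁ c₂, 1 + C, hK, K0, lt_min hc₁ hc₂, by positivity, ?_, ?_, ?_⟩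
  · intro a b hab p y
    exact (mul_le_mul_of_nonneg_right (min_le_left _ _) (norm_nonneg _)).trans
      (h₁ ⟨(a, b), hab⟩ (p, y))
  · intro p y s
    have e1 := abs_wave_le p s
    have e2 := hC' (ZMod.stdAddChar s * y)
    rw [norm_mul, norm_stdAddChar, one_mul] at e2
    have e3 : ‖p‖ ≤ ‖((p, y) : ℂ × ℂ)‖ := norm_fst_le (p, y)
    have e4 : ‖y‖ ≤ ‖((p, y) : ℂ × ℂ)‖ := norm_snd_le (p, y)
    have := mul_le_mul_of_nonneg_left e4 C0
    refine (abs_add_le _ _).trans ?_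
    linarith
  · intro a b d h1 h2 h3 p
    exact (mul_le_mul_of_nonneg_right (min_le_right _ _) (norm_nonneg _)).trans
      (h₂ ⟨(a, b, d), h1, h2, h3⟩ p)

lemma isForest_mk {Z : Type*} {c c' b₀ b₁ b₂ b₃ : Z} (h₀₁ : b₀ ≠ b₁) (h₀₂ : b₀ ≠ b₂)
    (h₀₃ : b₀ ≠ b₃) (h₁₂ : b₁ ≠ b₂) (h₁₃ : b₁ ≠ b₃) (h₂₃ : b₂ ≠ b₃)
    (hc : c ≠ b₀ ∧ c ≠ b₁ ∧ c ≠ b₂ ∧ c ≠ b₃) {c₂ : Z}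
    (hc₂ : c₂ ≠ b₀ ∧ c₂ ≠ b₁ ∧ c₂ ≠ b₂ ∧ c₂ ≠ b₃)
    (hc' : c' ≠ b₀ ∧ c' ≠ b₁ ∧ c' ≠ b₂ ∧ c' ≠ b₃) :
    IsForest ![c, c, c₂, c'] ![b₀, b₁, b₂, b₃] := by
  refine ⟨fun i j h => ?_, fun i j => ?_, rfl⟩
  · fin_cases i <;> fin_cases j <;> simp_all
  · fin_cases i <;> fin_cases j <;> simp_all

/-- `g` varies by less than `η` on `B`. -/
def Close {Z : Type*} (g : Z → ℝ) (η : ℝ) (B : Finset Z) : Prop :=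
  ∀ a ∈ B, ∀ b ∈ B, |g a - g b| < η

/-- The differences of `g` along the edges of a star forest are not all small. -/
def Spread {Z : Type*} (g : Z → ℝ) (η : ℝ) : Prop :=
  ∀ a b : Fin 4 → Z, IsForest a b → ∃ i, 2 * η ≤ |g (a i) - g (b i)|

lemma Spread.two_le_card_inter {Z : Type*} [DecidableEq Z] {g : Z → ℝ} {η : ℝ} (hη : 0 < η)
    (hg : Spread g η) {B B' : Finset Z} (hB : B.card = 3) (hB' : B'.card = 3)
    (hc : Close g η B) (hc' : Close g η B') : ¬ (B ∩ B').card ≤ 1 := by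
  intro hcard
  obtain ⟨c, c', hcB, hcB', hinter⟩ : ∃ c c', c ∈ B ∧ c' ∈ B' ∧
      ∀ e ∈ B, e ∈ B' → e = c ∧ e = c' := by
    rw [Finset.card_le_one] at hcard
    rcases (B ∩ B').eq_empty_or_nonempty with h | ⟨e, he⟩
    · obtain ⟨c, hc⟩ := Finset.card_pos.1 (hB ▸ three_pos : 0 < B.card)
      obtain ⟨c', hc'⟩ := Finset.card_pos.1 (hB' ▸ three_pos : 0 < B'.card)
      refine ⟨c, c', hc, hc', fun e h1 h2 => ?_⟩
      have : e ∈ B ∩ B' := Finset.mem_inter.2 ⟨h1, h2⟩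
      simp [h] at this
    · rw [Finset.mem_inter] at he
      refine ⟨e, e, he.1, he.2, fun e' h1 h2 => ?_⟩
      have := hcard e' (Finset.mem_inter.2 ⟨h1, h2⟩) e (Finset.mem_inter.2 he)
      exact ⟨this, this⟩
  obtain ⟨b₀, b₁, hb, h⟩ := Finset.card_eq_two.1
    (by rw [Finset.card_erase_of_mem hcB, hB] : (B.erase c).card = 2)
  obtain ⟨b₂, b₃, hb', h'⟩ := Finset.card_eq_two.1
    (by rw [Finset.card_erase_of_mem hcB', hB'] : (B'.erase c').card = 2)
  have m₀ : b₀ ∈ B.erase c := by simp [h]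
  have m₁ : b₁ ∈ B.erase c := by simp [h]
  have m₂ : b₂ ∈ B'.erase c' := by simp [h']
  have m₃ : b₃ ∈ B'.erase c' := by simp [h']
  rw [Finset.mem_erase] at m₀ m₁ m₂ m₃
  have hforest : IsForest ![c, c, c', c'] ![b₀, b₁, b₂, b₃] := by
    apply isForest_mk <;> grind
  obtain ⟨i, hi⟩ := hg _ _ hforest
  have e₀ := hc c hcB b₀ m₀.2
  have e₁ := hc c hcB b₁ m₁.2
  have e₂ := hc' c' hcB' b₂ m₂.2
  have e₃ := hc' c' hcB' b₃ m₃.2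
  fin_cases i <;> simp at hi <;> linarith

lemma Spread.ne_of_card_inter_eq_two {Z : Type*} [DecidableEq Z] {g : Z → ℝ} {η : ℝ} (hη : 0 < η)
    (hg : Spread g η) {B B' : Finset Z} (hB : B.card = 3) (hB' : B'.card = 3)
    (hc : Close g η B) (hc' : Close g η B') (hcard : (B ∩ B').card = 2) {w w' : Z}
    (hw : w ≠ w') (hww : ¬ (w ∈ B ∪ B' ∧ w' ∈ B ∪ B')) : g w ≠ g w' := by
  intro heq
  wlog hw' : w' ∉ B ∪ B' generalizing w w'
  · exact this hw.symm (fun h => hww h.symm) heq.symm fun h => hww ⟨h, not_not.1 hw'⟩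
  clear hww
  obtain ⟨a, d, had, hint⟩ := Finset.card_eq_two.1 hcard
  have ma : a ∈ B ∩ B' := by simp [hint]
  have md : d ∈ B ∩ B' := by simp [hint]
  rw [Finset.mem_inter] at ma md
  obtain ⟨b₀, hb₀⟩ := Finset.card_eq_one.1 (by
    have := Finset.card_sdiff_add_card_inter B B'
    omega : (B \ B').card = 1)
  obtain ⟨b₁, hb₁⟩ := Finset.card_eq_one.1 (by
    have := Finset.card_sdiff_add_card_inter B' B
    rw [Finset.inter_comm] at this
    omega : (B' \ B).card = 1)
  have m₀ : b₀ ∈ B \ B' := by simp [hb₀]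
  have m₁ : b₁ ∈ B' \ B := by simp [hb₁]
  rw [Finset.mem_sdiff] at m₀ m₁
  have e₀ := hc a ma.1 b₀ m₀.1
  have e₁ := hc' a ma.2 b₁ m₁.1
  have e₂ := hc a ma.1 d md.1
  rw [Finset.mem_union, not_or] at hw'
  obtain ⟨v, hv, hv', hvw⟩ : ∃ v, |g v - g w'| < η ∧ v ≠ w' ∧ (v = a ∨ v ∉ B ∪ B') := by
    by_cases h : w ∈ B ∪ B'
    · refine ⟨a, ?_, fun h => hw'.1 (h ▸ ma.1), Or.inl rfl⟩
      rw [← heq]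
      rcases Finset.mem_union.1 h with h | h
      · exact hc a ma.1 w h
      · exact hc' a ma.2 w h
    · exact ⟨w, by simpa [heq] using hη, hw, Or.inr h⟩
  rw [Finset.mem_union, not_or] at hvw
  have hforest : IsForest ![a, a, a, v] ![d, b₀, b₁, w'] := by
    apply isForest_mk <;> grind
  obtain ⟨i, hi⟩ := hg _ _ hforest
  fin_cases i <;> simp at hi <;> linarith

/-- The translate of `k.1` by `k.2`. -/
def block {Z : Type*} [AddGroup Z] [DecidableEq Z] (k : Finset Z × Z) : Finset Z :=
  k.1.image (k.2 + ·)

lemma card_block {Z : Type*} [AddGroup Z] [DecidableEq Z] (k : Finset Z × Z) :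
    (block k).card = k.1.card :=
  Finset.card_image_of_injective _ (add_right_injective _)

lemma block_zero {Z : Type*} [AddGroup Z] [DecidableEq Z] (D : Finset Z) : block (D, 0) = D := by
  simp [block]

/-- The translates of members of `P` by elements of `insert 0 D`, other than `D` itself. -/
def others {Z : Type*} [AddGroup Z] [DecidableEq Z] (P : Finset (Finset Z)) (D : Finset Z) :
    Finset (Finset Z × Z) :=
  (P ×ˢ insert 0 D).erase (D, 0)

/-- The combinatorial conditions under which the penalized profile separates `insert 0 D`. -/
structure Admissible {Z : Type*} [AddGroup Z] [DecidableEq Z] (P : Finset (Finset Z))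
    (D : Finset Z) : Prop where
  mem : D ∈ P
  card_eq : ∀ E ∈ P, E.card = 3
  zero_notMem : (0 : Z) ∉ D
  inter : ∀ k ∈ others P D, (block k ∩ insert 0 D).card ≤ 1
  pair : ∀ k ∈ others P D, ∀ k' ∈ others P D, k ≠ k' → (block k ∩ block k').card ≤ 1 ∨
    (block k ∩ block k').card = 2 ∧ ∃ w ∈ insert 0 D, ∃ w' ∈ insert 0 D, w ≠ w' ∧
      (w ≠ k.2 ∧ w ≠ k'.2) ∧ (w' ≠ k.2 ∧ w' ≠ k'.2) ∧
      ¬ (w ∈ block k ∪ block k' ∧ w' ∈ block k ∪ block k')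
  triple : ∀ k ∈ others P D, ∀ k' ∈ others P D, ∀ k'' ∈ others P D, k ≠ k' → k ≠ k'' → k' ≠ k'' →
    (block k ∩ block k').card ≤ 1 ∨ (block k ∩ block k'').card ≤ 1 ∨
      (block k' ∩ block k'').card ≤ 1

/-- The total variation of `g` over `B`. -/
def variation {Z : Type*} (g : Z → ℝ) (B : Finset Z) : ℝ := ∑ a ∈ B, ∑ b ∈ B, |g a - g b|

lemma close_of_variation_lt {Z : Type*} {g : Z → ℝ} {η : ℝ} {B : Finset Z}
    (h : variation g B < η) : Close g η B := by
  intro a ha b hb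
  refine lt_of_le_of_lt ?_ h
  refine le_trans ?_ (Finset.single_le_sum (f := fun a => ∑ b ∈ B, |g a - g b|)
    (fun _ _ => Finset.sum_nonneg fun _ _ => abs_nonneg _) ha)
  exact Finset.single_le_sum (f := fun b => |g a - g b|) (fun _ _ => abs_nonneg _) hb

lemma variation_eq_zero {Z : Type*} {g : Z → ℝ} {B : Finset Z}
    (h : ∀ a ∈ B, ∀ b ∈ B, g a = g b) : variation g B = 0 :=
  Finset.sum_eq_zero fun a ha => Finset.sum_eq_zero fun b hb => by
    rw [h a ha b hb, sub_self, abs_zero]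

/-- `g` together with a penalty at `x` for each translate by `x` on which it varies little. -/
def penalized {Z : Type*} [AddGroup Z] [DecidableEq Z] (P : Finset (Finset Z)) (M η : ℝ)
    (g : Z → ℝ) (x : Z) : ℝ :=
  g x + ∑ D ∈ P, M * max 0 (η - variation g (block (D, x)))

lemma penalized_eq {Z : Type*} [AddGroup Z] [DecidableEq Z] {P : Finset (Finset Z)} {M η : ℝ}
    {g : Z → ℝ} {x : Z} (h : ∀ D ∈ P, η ≤ variation g (block (D, x))) :
    penalized P M η g x = g x := by
  rw [penalized, Finset.sum_eq_zero, add_zero]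
  intro D hD
  rw [max_eq_left (by linarith [h D hD]), mul_zero]

lemma Admissible.not_const {Z : Type*} [AddGroup Z] [DecidableEq Z] {P : Finset (Finset Z)}
    {D : Finset Z} (h : Admissible P D) {g : Z → ℝ} {η M b : ℝ} (hη : 0 < η) (hg : Spread g η)
    (hb : ∀ s, |g s| ≤ b) (hM : 2 * b < M * η) :
    ¬ ∀ s ∈ insert 0 D, ∀ t ∈ insert 0 D, penalized P M η g s = penalized P M η g t := by
  intro hconst
  have hclose : ∀ k ∈ others P D, variation g (block k) < η → Close g η (block k) :=
    fun k _ hk => close_of_variation_lt hk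
  have hcard : ∀ k ∈ others P D, (block k).card = 3 := by
    intro k hk
    rw [card_block]
    exact h.card_eq _ (Finset.mem_product.1 (Finset.mem_of_mem_erase hk)).1
  have hDcard := h.card_eq D h.mem
  have key : ∀ k ∈ others P D, ∀ k' ∈ others P D, variation g (block k) < η →
      variation g (block k') < η → ¬ (block k ∩ block k').card ≤ 1 := fun k hk k' hk' ha ha' =>
    hg.two_le_card_inter hη (hcard k hk) (hcard k' hk') (hclose k hk ha) (hclose k' hk' ha')
  have key' : ∀ k ∈ others P D, variation g (block k) < η → ∀ B ⊆ insert 0 D, B.card = 3 →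
      ¬ Close g η B := by
    intro k hk ha B hB hBc hcl
    refine hg.two_le_card_inter hη (hcard k hk) hBc (hclose k hk ha) hcl ?_
    exact (Finset.card_le_card (Finset.inter_subset_inter_left hB)).trans (h.inter k hk)
  have hmem : ∀ x ∈ insert 0 D, ∀ E ∈ P, (E, x) ≠ (D, (0 : Z)) → (E, x) ∈ others P D :=
    fun x hx E hE hne => Finset.mem_erase.2 ⟨hne, Finset.mem_product.2 ⟨hE, hx⟩⟩
  have constD : (∀ a ∈ D, ∀ b ∈ D, g a = g b) → variation g D < η := by
    intro hD
    rw [variation_eq_zero hD]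
    exact hη
  have hsub : D ⊆ insert 0 D := Finset.subset_insert _ _
  by_cases hown : variation g D < η
  · have hnone : ∀ k ∈ others P D, η ≤ variation g (block k) := by
      intro k hk
      by_contra! ha
      exact key' k hk ha D hsub hDcard (close_of_variation_lt hown)
    have hval : ∀ x ∈ D, penalized P M η g x = g x := by
      intro x hx
      refine penalized_eq fun E hE => hnone _ (hmem x (hsub hx) E hE ?_)
      rintro ⟨⟩
      exact h.zero_notMem hx
    have hD0 : variation g D = 0 := by
      refine variation_eq_zero fun s hs t ht => ?_
      rw [← hval s hs, ← hval t ht]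
      exact hconst s (hsub hs) t (hsub ht)
    have h0 : penalized P M η g 0 = g 0 + M * η := by
      rw [penalized, Finset.sum_eq_single D]
      · rw [block_zero, hD0, sub_zero, max_eq_right hη.le]
      · intro E hE hne
        rw [max_eq_left, mul_zero]
        linarith [hnone _ (hmem 0 (Finset.mem_insert_self _ _) E hE (by simpa using hne))]
      · exact fun hD => absurd h.mem hD
    obtain ⟨x, hx⟩ := Finset.card_pos.1 (hDcard ▸ three_pos : 0 < D.card)
    have e := hconst 0 (Finset.mem_insert_self _ _) x (hsub hx)
    rw [h0, hval x hx] at e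
    have e1 := (abs_le.1 (hb 0)).1
    have e2 := (abs_le.1 (hb x)).2
    linarith
  have hval : ∀ x ∈ insert 0 D, (∀ E ∈ P, (E, x) ∈ others P D → η ≤ variation g (block (E, x))) →
      penalized P M η g x = g x := by
    intro x hx hina
    refine penalized_eq fun E hE => ?_
    by_cases he : (E, x) = (D, 0)
    · rw [he, block_zero]
      exact not_lt.1 hown
    · exact hina E hE (hmem x hx E hE he)
  by_cases hex : ∃ k ∈ others P D, variation g (block k) < η
  swap
  · push Not at hex
    refine hown (constD fun s hs t ht => ?_)
    rw [← hval s (hsub hs) fun E _ hE => hex _ hE, ← hval t (hsub ht) fun E _ hE => hex _ hE]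
    exact hconst s (hsub hs) t (hsub ht)
  obtain ⟨k, hk, ha⟩ := hex
  have hk2 : k.2 ∈ insert 0 D := (Finset.mem_product.1 (Finset.mem_of_mem_erase hk)).2
  by_cases hex' : ∃ k' ∈ others P D, k ≠ k' ∧ variation g (block k') < η
  · obtain ⟨k', hk', hne, ha'⟩ := hex'
    rcases h.pair k hk k' hk' hne with h1 | ⟨h2, w, hw, w', hw', hww, hwk, hwk', hmm⟩
    · exact key k hk k' hk' ha ha' h1
    · have hthird : ∀ v, v ≠ k.2 ∧ v ≠ k'.2 → ∀ E ∈ P, (E, v) ∈ others P D →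
          η ≤ variation g (block (E, v)) := by
        intro v hv E _ hE
        by_contra! ha''
        rcases h.triple k hk k' hk' (E, v) hE hne (fun e => hv.1 (by rw [e]))
          (fun e => hv.2 (by rw [e])) with h1 | h1 | h1
        · exact key k hk k' hk' ha ha' h1
        · exact key k hk _ hE ha ha'' h1
        · exact key k' hk' _ hE ha' ha'' h1
      refine hg.ne_of_card_inter_eq_two hη (hcard k hk) (hcard k' hk') (hclose k hk ha)
        (hclose k' hk' ha') h2 hww hmm ?_
      rw [← hval w hw (hthird w hwk), ← hval w' hw' (hthird w' hwk')]
      exact hconst w hw w' hw'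
  · push Not at hex'
    have hval' : ∀ x ∈ (insert 0 D).erase k.2, penalized P M η g x = g x := by
      intro x hx
      rw [Finset.mem_erase] at hx
      exact hval x hx.2 fun E _ hE => hex' _ hE fun e => hx.1 (by rw [e])
    refine key' k hk ha ((insert 0 D).erase k.2) (Finset.erase_subset _ _) ?_ ?_
    · rw [Finset.card_erase_of_mem hk2, Finset.card_insert_of_notMem h.zero_notMem, hDcard]
    · intro s hs t ht
      rw [← hval' s hs, ← hval' t ht, hconst s (Finset.mem_of_mem_erase hs) t
        (Finset.mem_of_mem_erase ht), sub_self, abs_zero]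
      exact hη

lemma variation_block_add {Z : Type*} [AddCommGroup Z] [DecidableEq Z] (g : Z → ℝ) (D : Finset Z)
    (x t : Z) : variation g (block (D, x + t)) = variation (fun s => g (x + s)) (block (D, t)) := by
  have h : ∀ z : Z, Set.InjOn (z + ·) D := fun z => (add_right_injective z).injOn
  simp only [variation, block, Finset.sum_image (h _)]
  simp only [add_assoc]

lemma penalized_add {Z : Type*} [AddCommGroup Z] [DecidableEq Z] (P : Finset (Finset Z)) (M η : ℝ)
    (g : Z → ℝ) (x t : Z) :
    penalized P M η g (x + t) = penalized P M η (fun s => g (x + s)) t := by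
  simp only [penalized, variation_block_add]

lemma le_variation {Z : Type*} [DecidableEq Z] (g : Z → ℝ) {a b d : Z} (hab : a ≠ b) (had : a ≠ d)
    (hbd : b ≠ d) : |g a - g b| + |g a - g d| ≤ variation g {a, b, d} := by
  rw [variation, Finset.sum_insert (by simp [hab, had]), Finset.sum_insert (by simp [hab, had]),
    Finset.sum_pair hbd, sub_self, abs_zero, zero_add]
  exact le_add_of_nonneg_right (Finset.sum_nonneg fun _ _ =>
    Finset.sum_nonneg fun _ _ => abs_nonneg _)

lemma stdAddChar_mul_eq {n : ℕ} [NeZero n] (t : ℤ) (x : ZMod n) (h : (t : ZMod n) = x) :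
    rot n (2 * (t : ℝ)) = ZMod.stdAddChar x := by
  rw [← h, stdAddChar_eq_rot]

/-- A set of indices is separable if, up to translation, it and its negative are admissible. -/
lemma separable_of_admissible {n : ℕ} [NeZero n] (hn : 2 ≤ n) {S : Set ℤ}
    (P : Finset (Finset (ZMod n)))
    (h : ∀ e : ℤ, e = 1 ∨ e = -1 → ∃ (D : Finset (ZMod n)) (x : ZMod n), Admissible P D ∧
      ∀ t ∈ insert 0 D, ∃ s ∈ S, ((e * s : ℤ) : ZMod n) = x + t) : Separable4 n S := by
  obtain ⟨K, c, C, hK, K0, hc, hC, hforest, hbound, hthree⟩ := exists_profile_bounds hn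
  set δ := c / 8 with hδ
  have δ0 : 0 < δ := by positivity
  set M := (2 * C + 1) / δ with hM
  set Ψ : ℂ → ℂ → ℝ := fun p y =>
    penalized P M (δ * ‖((p, y) : ℂ × ℂ)‖) (profile K p y) (0 : ZMod n) with hΨ
  have Ψ_mul : ∀ (t : ℤ) (z : ZMod n), (t : ZMod n) = z → ∀ p y,
      Ψ (rot n (2 * (t : ℝ)) * p) (rot n (2 * (t : ℝ)) * y) =
      penalized P M (δ * ‖((p, y) : ℂ × ℂ)‖) (profile K p y) z := by
    intro t z hz p y
    have hnorm : ‖((ZMod.stdAddChar z * p, ZMod.stdAddChar z * y) : ℂ × ℂ)‖ =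
        ‖((p, y) : ℂ × ℂ)‖ := by
      simp only [Prod.norm_def, norm_mul, norm_stdAddChar, one_mul]
    rw [stdAddChar_mul_eq t z hz, ← add_zero z, penalized_add, hΨ]
    simp only [add_zero, hnorm, profile_add]
  refine separable_of_half Ψ ?_ ?_ ?_
  · simp only [hΨ, penalized, variation]
    have := continuous_profile (n := n) hK
    fun_prop
  · have hre : ∀ p, Ψ p 0 = p.re := by
      intro p
      have hw : profile K p 0 = (wave p : ZMod n → ℝ) := by
        ext s
        simp [profile, K0]
      simp only [hΨ, hw]
      rw [penalized_eq, wave]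
      · simp
      · intro D hD
        obtain ⟨D₀, x, hD₀, -⟩ := h 1 (Or.inl rfl)
        obtain ⟨a, b, d, hab, had, hbd, hB⟩ := Finset.card_eq_three.1
          ((card_block (D, 0)).trans (hD₀.card_eq D hD))
        rw [hB]
        refine le_trans ?_ (le_variation _ hab had hbd)
        refine le_trans ?_ (hthree a b d hab had hbd p)
        have : ‖((p, 0) : ℂ × ℂ)‖ = ‖p‖ := by simp [Prod.norm_def]
        rw [this]
        exact mul_le_mul_of_nonneg_right (by linarith) (norm_nonneg _)
    intro p
    simp [hre]
  · intro e he p y hpy hconst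
    obtain ⟨D, x, hD, hDS⟩ := h e he
    have hρ : 0 < ‖((p, y) : ℂ × ℂ)‖ := norm_pos_iff.2 hpy
    set ρ := ‖((p, y) : ℂ × ℂ)‖ with hρdef
    have hspread : Spread (fun s => profile K p y (x + s)) (δ * ρ) := by
      intro a b hab
      have hab' : IsForest (fun i => x + a i) (fun i => x + b i) :=
        ⟨fun i j hij => hab.1 (add_right_injective x hij),
          fun i j hij => hab.2.1 i j (add_right_injective x hij), by simp [hab.2.2]⟩
      have hsum := hforest _ _ hab' p y
      by_contra! hcon
      have h0 := hcon 0
      have h1 := hcon 1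
      have h2 := hcon 2
      have h3 := hcon 3
      rw [Fin.sum_univ_four, ← hρdef] at hsum
      have : c = 8 * δ := by rw [hδ]; ring
      rw [this] at hsum
      linarith
    refine hD.not_const (M := M) (b := C * ρ) (by positivity) hspread
      (fun s => hbound p y (x + s)) ?_ ?_
    · have : M * (δ * ρ) = (2 * C + 1) * ρ := by
        rw [hM, ← mul_assoc, div_mul_cancel₀ _ δ0.ne']
      linarith
    · intro s hs t ht
      obtain ⟨s', hs', es⟩ := hDS s hs
      obtain ⟨t', ht', et⟩ := hDS t ht
      have := hconst s' hs' t' ht'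
      rw [Ψ_mul _ _ es, Ψ_mul _ _ et, penalized_add, penalized_add] at this
      exact this

/-- The sums of two elements of `insert 0 D` are distinct, except that some `2 a` may vanish. -/
structure Sidon {Z : Type*} [AddCommGroup Z] [DecidableEq Z] (D : Finset Z) : Prop where
  card_eq : D.card = 3
  zero_notMem : (0 : Z) ∉ D
  eq : ∀ a ∈ insert 0 D, ∀ b ∈ insert 0 D, ∀ c ∈ insert 0 D, ∀ d ∈ insert 0 D, a + b = c + d →
    (a = c ∧ b = d) ∨ (a = d ∧ b = c) ∨ (a = b ∧ c = d ∧ (a = 0 ∨ c = 0))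

section

variable {Z : Type*} [AddCommGroup Z] [DecidableEq Z] {D : Finset Z}

lemma Sidon.neg (h : Sidon D) : Sidon (D.image Neg.neg) := by
  have hT : ∀ a, a ∈ insert 0 (D.image Neg.neg) → -a ∈ insert 0 D := by
    intro a ha
    rcases Finset.mem_insert.1 ha with rfl | ha
    · simp
    · obtain ⟨b, hb, rfl⟩ := Finset.mem_image.1 ha
      simp [hb]
  refine ⟨by rw [Finset.card_image_of_injective _ neg_injective, h.card_eq], ?_, ?_⟩
  · simpa using h.zero_notMem
  · intro a ha b hb c hc d hd e
    have := h.eq _ (hT a ha) _ (hT b hb) _ (hT c hc) _ (hT d hd)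
      (by rw [← neg_add, ← neg_add, e])
    simpa using this

lemma Sidon.card_inter_translate_le (h : Sidon D) {x x' : Z} (hx : x ∈ insert 0 D)
    (hx' : x' ∈ insert 0 D) (hne : x ≠ x') :
    (block (D, x) ∩ block (D, x')).card ≤ 1 := by
  have h0 := h.zero_notMem
  have key : ∀ y ∈ block (D, x) ∩ block (D, x'), y = x + x' := by
    intro y hy
    simp only [block, Finset.mem_inter, Finset.mem_image] at hy
    obtain ⟨⟨u, hu, rfl⟩, u', hu', e⟩ := hy
    have := h.eq x' hx' u' (Finset.mem_insert_of_mem hu') x hx u (Finset.mem_insert_of_mem hu) e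
    grind
  rw [Finset.card_le_one]
  intro a ha b hb
  rw [key a ha, key b hb]

lemma Sidon.card_inter_reflected_le (h : Sidon D) {x x' : Z} (hx : x ∈ insert 0 D)
    (hx' : x' ∈ insert 0 D) (hne : x ≠ x') :
    (block (D.image Neg.neg, x) ∩ block (D.image Neg.neg, x')).card ≤ 1 := by
  have h0 := h.zero_notMem
  have key : ∀ y ∈ block (D.image Neg.neg, x) ∩ block (D.image Neg.neg, x'), y = 0 := by
    intro y hy
    simp only [block, Finset.mem_inter, Finset.mem_image, exists_exists_and_eq_and] at hy
    obtain ⟨⟨u, hu, rfl⟩, u', hu', e⟩ := hy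
    have := h.eq x' hx' u (Finset.mem_insert_of_mem hu) x hx u' (Finset.mem_insert_of_mem hu')
      (by rwa [← sub_eq_add_neg, ← sub_eq_add_neg, sub_eq_sub_iff_add_eq_add] at e)
    grind
  rw [Finset.card_le_one]
  intro a ha b hb
  rw [key a ha, key b hb]

lemma Sidon.card_inter_base_le (h : Sidon D) {x : Z} (hx : x ∈ D) :
    (block (D, x) ∩ insert 0 D).card ≤ 1 := by
  have h0 := h.zero_notMem
  have key : ∀ y ∈ block (D, x) ∩ insert 0 D, y = 0 := by
    intro y hy
    simp only [block, Finset.mem_inter, Finset.mem_image] at hy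
    obtain ⟨⟨u, hu, rfl⟩, ht⟩ := hy
    have := h.eq x (Finset.mem_insert_of_mem hx) u (Finset.mem_insert_of_mem hu) _ ht 0
      (Finset.mem_insert_self _ _) (by simp)
    grind
  rw [Finset.card_le_one]
  intro a ha b hb
  rw [key a ha, key b hb]

lemma Sidon.card_inter_reflected_base_le (h : Sidon D) {x : Z} (hx : x ∈ insert 0 D) :
    (block (D.image Neg.neg, x) ∩ insert 0 D).card ≤ 1 := by
  have h0 := h.zero_notMem
  have key : ∀ y ∈ block (D.image Neg.neg, x) ∩ insert 0 D, y = 0 ∨ (x = 0 ∧ y + y = 0) := by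
    intro y hy
    simp only [block, Finset.mem_inter, Finset.mem_image, exists_exists_and_eq_and] at hy
    obtain ⟨⟨u, hu, rfl⟩, ht⟩ := hy
    have := h.eq _ ht u (Finset.mem_insert_of_mem hu) x hx 0
      (Finset.mem_insert_self _ _) (by simp)
    grind
  rw [Finset.card_le_one]
  intro a ha b hb
  have ha' := (Finset.mem_inter.1 ha).2
  have hb' := (Finset.mem_inter.1 hb).2
  have hx0 : x = 0 → a ≠ 0 := by
    rintro rfl rfl
    simp [block, h0] at ha
  have hx0' : x = 0 → b ≠ 0 := by
    rintro rfl rfl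
    simp [block, h0] at hb
  rcases key a ha with rfl | ⟨hx0a, ea⟩
  · rcases key b hb with rfl | ⟨hx0b, eb⟩
    · rfl
    · exact absurd rfl (hx0 hx0b)
  · rcases key b hb with rfl | ⟨hx0b, eb⟩
    · exact absurd rfl (hx0' hx0a)
    · have := h.eq a ha' a ha' b hb' b hb' (ea.trans eb.symm)
      grind

lemma Sidon.pair (h : Sidon D) {x x' : Z} (hx : x ∈ insert 0 D) (hx' : x' ∈ insert 0 D) :
    (block (D, x) ∩ block (D.image Neg.neg, x')).card ≤ 1 ∨
    (block (D, x) ∩ block (D.image Neg.neg, x')).card = 2 ∧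
      ∃ w ∈ insert 0 D, ∃ w' ∈ insert 0 D, w ≠ w' ∧ (w ≠ x ∧ w ≠ x') ∧ (w' ≠ x ∧ w' ≠ x') ∧
      ¬ (w ∈ block (D, x) ∪ block (D.image Neg.neg, x') ∧
        w' ∈ block (D, x) ∪ block (D.image Neg.neg, x')) := by
  have h0 := h.zero_notMem
  rw [or_iff_not_imp_left, not_le, Finset.one_lt_card]
  rintro ⟨y₁, h₁, y₂, h₂, hy⟩
  have mem_iff : ∀ y, y ∈ block (D, x) ∩ block (D.image Neg.neg, x') ↔
      ∃ u ∈ D, ∃ v ∈ D, y = x + u ∧ x' = x + u + v := by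
    intro y
    simp only [block, Finset.mem_inter, Finset.mem_image, exists_exists_and_eq_and]
    constructor
    · rintro ⟨⟨u, hu, rfl⟩, v, hv, e⟩
      exact ⟨u, hu, v, hv, rfl, by rw [← e]; simp⟩
    · rintro ⟨u, hu, v, hv, rfl, rfl⟩
      exact ⟨⟨u, hu, rfl⟩, v, hv, by simp⟩
  obtain ⟨u, hu, v, hv, rfl, e₁⟩ := (mem_iff y₁).1 h₁
  obtain ⟨u₂, hu₂, v₂, hv₂, rfl, e₂⟩ := (mem_iff y₂).1 h₂
  have huT := Finset.mem_insert_of_mem (b := (0 : Z)) hu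
  have hvT := Finset.mem_insert_of_mem (b := (0 : Z)) hv
  have h0T := Finset.mem_insert_self (0 : Z) D
  have hsum : ∀ c ∈ D, ∀ d ∈ D, x' = x + c + d → (u = c ∧ v = d) ∨ (u = d ∧ v = c) := by
    intro c hc d hd e
    have := h.eq u huT v hvT c (Finset.mem_insert_of_mem hc) d (Finset.mem_insert_of_mem hd)
      (by rw [e₁, add_assoc, add_assoc] at e; exact add_left_cancel e)
    grind
  have huv : u ≠ v := by
    rintro rfl
    rcases hsum _ hu₂ _ hv₂ e₂ with ⟨rfl, -⟩ | ⟨-, rfl⟩ <;> exact hy rfl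
  have hxx' : x ≠ x' := by
    intro e
    have := h.eq u huT v hvT 0 h0T 0 h0T (by
      rw [e₁, add_assoc, left_eq_add] at e
      rw [e, add_zero])
    grind
  have hx0 : x ≠ 0 := by
    rintro rfl
    have := h.eq u huT v hvT x' hx' 0 h0T (by simp [e₁])
    grind
  have hinter : block (D, x) ∩ block (D.image Neg.neg, x') = {x + u, x + v} := by
    ext y
    rw [mem_iff, Finset.mem_insert, Finset.mem_singleton]
    constructor
    · rintro ⟨c, hc, d, hd, rfl, e⟩
      rcases hsum c hc d hd e with ⟨rfl, -⟩ | ⟨-, rfl⟩ <;> simp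
    · rintro (rfl | rfl)
      · exact ⟨u, hu, v, hv, rfl, e₁⟩
      · exact ⟨v, hv, u, hu, rfl, by rw [e₁, add_right_comm]⟩
  have hunion : ∀ w ∈ insert 0 D, w ≠ x → w ≠ x' → w ≠ 0 →
      w ∈ block (D, x) ∪ block (D.image Neg.neg, x') → x' = 0 ∧ w + w = 0 := by
    intro w hw hwx hwx' hw0 hmem
    simp only [block, Finset.mem_union, Finset.mem_image, exists_exists_and_eq_and] at hmem
    rcases hmem with ⟨d, hd, e⟩ | ⟨d, hd, e⟩
    · have := h.eq x hx d (Finset.mem_insert_of_mem hd) w hw 0 h0T (by rw [e, add_zero])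
      grind
    · have := h.eq w hw d (Finset.mem_insert_of_mem hd) x' hx' 0 h0T (by rw [← e]; simp)
      grind
  refine ⟨by rw [hinter, Finset.card_pair (by simpa using huv)], ?_⟩
  obtain ⟨w, hw, w', hw', hne⟩ := Finset.one_lt_card.1 (by
    have h4 : (insert 0 D).card = 4 := by rw [Finset.card_insert_of_notMem h0, h.card_eq]
    rw [Finset.card_erase_of_mem (Finset.mem_erase.2 ⟨hxx'.symm, hx'⟩),
      Finset.card_erase_of_mem hx, h4]
    norm_num : 1 < (((insert 0 D).erase x).erase x').card)
  simp only [Finset.mem_erase, ne_eq] at hw hw'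
  refine ⟨w, hw.2.2, w', hw'.2.2, hne, ⟨hw.2.1, hw.1⟩, ⟨hw'.2.1, hw'.1⟩, ?_⟩
  rintro ⟨m, m'⟩
  by_cases w0 : w = 0
  · obtain ⟨e, -⟩ := hunion w' hw'.2.2 hw'.2.1 hw'.1 (fun h => hne (w0.trans h.symm)) m'
    exact hw.1 (w0.trans e.symm)
  · obtain ⟨e, ew⟩ := hunion w hw.2.2 hw.2.1 hw.1 w0 m
    obtain ⟨-, ew'⟩ := hunion w' hw'.2.2 hw'.2.1 hw'.1 (fun h => hw'.1 (h.trans e.symm)) m'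
    have := h.eq w hw.2.2 w hw.2.2 w' hw'.2.2 w' hw'.2.2 (ew.trans ew'.symm)
    grind

lemma Sidon.admissible (h : Sidon D) : Admissible {D, D.image Neg.neg} D := by
  have hmem : ∀ k ∈ others {D, D.image Neg.neg} D, k.2 ∈ insert 0 D ∧
      ((k = (D, k.2) ∧ k.2 ≠ 0) ∨ k = (D.image Neg.neg, k.2)) := by
    rintro ⟨E, x⟩ hk
    simp only [others, Finset.mem_erase, Finset.mem_product] at hk
    obtain ⟨hne, hE, hx⟩ := hk
    refine ⟨hx, ?_⟩
    rcases Finset.mem_insert.1 hE with rfl | hE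
    · exact Or.inl ⟨rfl, fun e => hne (Prod.ext rfl e)⟩
    · rw [Finset.mem_singleton] at hE
      exact Or.inr (Prod.ext hE rfl)
  have hpair : ∀ k ∈ others {D, D.image Neg.neg} D, ∀ k' ∈ others {D, D.image Neg.neg} D, k ≠ k' →
      k.1 = k'.1 → (block k ∩ block k').card ≤ 1 := by
    intro k hk k' hk' hne he
    obtain ⟨hx, h1⟩ := hmem k hk
    obtain ⟨hx', -⟩ := hmem k' hk'
    have hxx : k.2 ≠ k'.2 := fun e => hne (Prod.ext he e)
    have hk'e : k' = (k.1, k'.2) := Prod.ext he.symm rfl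
    rcases h1 with ⟨e, -⟩ | e
    · rw [hk'e, e]
      exact h.card_inter_translate_le hx hx' hxx
    · rw [hk'e, e]
      exact h.card_inter_reflected_le hx hx' hxx
  refine ⟨by simp, ?_, h.zero_notMem, ?_, ?_, ?_⟩
  · intro E hE
    rcases Finset.mem_insert.1 hE with rfl | hE
    · exact h.card_eq
    · rw [Finset.mem_singleton.1 hE]
      exact h.neg.card_eq
  · intro k hk
    obtain ⟨hx, ⟨e, h0⟩ | e⟩ := hmem k hk
    · rw [e]
      exact h.card_inter_base_le ((Finset.mem_insert.1 hx).resolve_left h0)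
    · rw [e]
      exact h.card_inter_reflected_base_le hx
  · intro k hk k' hk' hne
    by_cases he : k.1 = k'.1
    · exact Or.inl (hpair k hk k' hk' hne he)
    obtain ⟨hx, ⟨e, -⟩ | e⟩ := hmem k hk <;> obtain ⟨hx', ⟨e', -⟩ | e'⟩ := hmem k' hk'
    · exact absurd (by rw [e, e']) he
    · rw [e, e']
      exact h.pair hx hx'
    · rw [e, e', Finset.inter_comm, Finset.union_comm]
      rcases h.pair hx' hx with h1 | ⟨h2, w, hw, w', hw', hww, hwk, hwk', hmm⟩
      · exact Or.inl h1
      · exact Or.inr ⟨h2, w, hw, w', hw', hww, hwk.symm, hwk'.symm, hmm⟩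
    · exact absurd (by rw [e, e']) he
  · intro k hk k' hk' k'' hk'' h1 h2 h3
    have hfst : ∀ k ∈ others {D, D.image Neg.neg} D, k.1 = D ∨ k.1 = D.image Neg.neg := by
      intro k hk
      exact (hmem k hk).2.imp (fun e => congrArg Prod.fst e.1) (congrArg Prod.fst)
    by_cases e1 : k.1 = k'.1
    · exact Or.inl (hpair k hk k' hk' h1 e1)
    by_cases e2 : k.1 = k''.1
    · exact Or.inr (Or.inl (hpair k hk k'' hk'' h2 e2))
    refine Or.inr (Or.inr (hpair k' hk' k'' hk'' h3 ?_))
    rcases hfst k hk with e | e <;> rcases hfst k' hk' with e' | e' <;>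
      rcases hfst k'' hk'' with e'' | e'' <;> simp_all

end

lemma card_inter_le_one {Z : Type*} [DecidableEq Z] {s t : Finset Z} (z : Z)
    (h : ∀ y ∈ s, y ∈ t → y = z) : (s ∩ t).card ≤ 1 := by
  rw [Finset.card_le_one]
  intro a ha b hb
  rw [Finset.mem_inter] at ha hb
  rw [h a ha.1 ha.2, h b hb.1 hb.2]

section

variable {Z : Type*} [CommRing Z] [DecidableEq Z]

lemma mem_block_triple {a b c x y : Z} :
    y ∈ block (({a, b, c} : Finset Z), x) ↔ y = x + a ∨ y = x + b ∨ y = x + c := by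
  simp [block]

lemma mem_others_triple {a b c : Z} {k : Finset Z × Z}
    (hk : k ∈ others {({a, b, c} : Finset Z)} {a, b, c}) :
    k = ({a, b, c}, a) ∨ k = ({a, b, c}, b) ∨ k = ({a, b, c}, c) := by
  obtain ⟨E, x⟩ := k
  simp only [others, Finset.mem_erase, Finset.mem_product, Finset.mem_singleton,
    Finset.mem_insert] at hk
  obtain ⟨hne, rfl, rfl | rfl | rfl | rfl⟩ := hk <;> simp_all

lemma admissible_trapezoid {A B : Z} (hA : A ≠ 0) (hB : B ≠ 0) (hAB : A + B ≠ 0)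
    (h2A : 2 * A ≠ 0) (h2B : 2 * B ≠ 0) (hne : A ≠ B) (h1 : 2 * A ≠ B) (h2 : 2 * B ≠ A)
    (h3 : 2 * A + B ≠ 0) (h4 : A + 2 * B ≠ 0) (h5 : 2 * A ≠ 2 * B) :
    Admissible {({A, B, A + B} : Finset Z)} {A, B, A + B} := by
  have e1 : (block (({A, B, A + B} : Finset Z), A) ∩
      block (({A, B, A + B} : Finset Z), B)).card ≤ 1 :=
    card_inter_le_one (A + B) (by simp only [mem_block_triple]; grind)
  have e2 : (block (({A, B, A + B} : Finset Z), A) ∩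
      block (({A, B, A + B} : Finset Z), A + B)).card ≤ 1 :=
    card_inter_le_one (2 * A + B) (by simp only [mem_block_triple]; grind)
  have e3 : (block (({A, B, A + B} : Finset Z), B) ∩
      block (({A, B, A + B} : Finset Z), A + B)).card ≤ 1 :=
    card_inter_le_one (A + 2 * B) (by simp only [mem_block_triple]; grind)
  have key : ∀ k ∈ others {({A, B, A + B} : Finset Z)} {A, B, A + B},
      ∀ k' ∈ others {({A, B, A + B} : Finset Z)} {A, B, A + B}, k ≠ k' →
      (block k ∩ block k').card ≤ 1 := by
    intro k hk k' hk' hne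
    rcases mem_others_triple hk with rfl | rfl | rfl <;>
      rcases mem_others_triple hk' with rfl | rfl | rfl <;>
      first
        | exact absurd rfl hne
        | assumption
        | (rw [Finset.inter_comm]; assumption)
  refine ⟨by simp, ?_, ?_, ?_, fun k hk k' hk' h => Or.inl (key k hk k' hk' h),
    fun k hk k' hk' _ _ h _ _ => Or.inl (key k hk k' hk' h)⟩
  · intro E hE
    rw [Finset.mem_singleton.1 hE, Finset.card_eq_three]
    exact ⟨_, _, _, hne, by simpa using hB, by simpa using hA, rfl⟩
  · simp only [Finset.mem_insert, Finset.mem_singleton]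
    grind
  · intro k hk
    rcases mem_others_triple hk with rfl | rfl | rfl
    · refine card_inter_le_one (A + B) ?_
      simp only [mem_block_triple, Finset.mem_insert, Finset.mem_singleton]
      grind
    · refine card_inter_le_one (A + B) ?_
      simp only [mem_block_triple, Finset.mem_insert, Finset.mem_singleton]
      grind
    · refine card_inter_le_one (2 * A + 2 * B) ?_
      simp only [mem_block_triple, Finset.mem_insert, Finset.mem_singleton]
      grind

lemma admissible_kite {α t : Z} (hα : α + α = 0) (h0 : α ≠ 0) (h1 : α ≠ t)
    (h2 : α ≠ 2 * t) (h3 : α ≠ 3 * t) (ht : t ≠ 0) (ht2 : 2 * t ≠ 0) (ht3 : 3 * t ≠ 0)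
    (ht4 : 4 * t ≠ 0) :
    Admissible {({α - t, α, α + t} : Finset Z)} {α - t, α, α + t} := by
  set D : Finset Z := {α - t, α, α + t} with hD
  have hmem : ∀ x y : Z, y ∈ block (D, x) ↔ y = x + (α - t) ∨ y = x + α ∨ y = x + (α + t) :=
    fun x y => mem_block_triple
  have m0 : ∀ y, y ∈ block (D, α) ↔ y = -t ∨ y = 0 ∨ y = t := by
    intro y; rw [hmem]; grind
  have m1 : ∀ y, y ∈ block (D, α + t) ↔ y = 0 ∨ y = t ∨ y = 2 * t := by
    intro y; rw [hmem]; grind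
  have m2 : ∀ y, y ∈ block (D, α - t) ↔ y = -(2 * t) ∨ y = -t ∨ y = 0 := by
    intro y; rw [hmem]; grind
  have hoth : ∀ k ∈ others {D} D, k = (D, α - t) ∨ k = (D, α) ∨ k = (D, α + t) :=
    fun k hk => mem_others_triple hk
  have e12 : (block (D, α + t) ∩ block (D, α - t)).card ≤ 1 := by
    refine card_inter_le_one 0 fun y => ?_
    rw [m1, m2]
    grind
  have e01 : (block (D, α) ∩ block (D, α + t)).card = 2 := by
    rw [Finset.card_eq_two]
    refine ⟨0, t, ht.symm, ?_⟩
    ext y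
    rw [Finset.mem_inter, m0, m1, Finset.mem_insert, Finset.mem_singleton]
    grind
  have e02 : (block (D, α) ∩ block (D, α - t)).card = 2 := by
    rw [Finset.card_eq_two]
    refine ⟨0, -t, by simpa using ht, ?_⟩
    ext y
    rw [Finset.mem_inter, m0, m2, Finset.mem_insert, Finset.mem_singleton]
    grind
  have n1 : α - t ∉ block (D, α) ∪ block (D, α + t) := by
    rw [Finset.mem_union, m0, m1]
    grind
  have n2 : α + t ∉ block (D, α) ∪ block (D, α - t) := by
    rw [Finset.mem_union, m0, m2]
    grind
  have hT : (0 : Z) ∈ insert 0 D ∧ α - t ∈ insert 0 D ∧ α + t ∈ insert 0 D := by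
    simp [hD]
  refine ⟨by simp, ?_, ?_, ?_, ?_, ?_⟩
  · intro E hE
    rw [Finset.mem_singleton.1 hE, Finset.card_eq_three]
    exact ⟨_, _, _, by grind, by grind, by grind, rfl⟩
  · simp only [hD, Finset.mem_insert, Finset.mem_singleton]
    grind
  · intro k hk
    refine card_inter_le_one 0 fun y => ?_
    simp only [hD, Finset.mem_insert, Finset.mem_singleton]
    rcases hoth k hk with rfl | rfl | rfl
    · rw [m2]
      grind
    · rw [m0]
      grind
    · rw [m1]
      grind
  · have p01 : ∃ w ∈ insert 0 D, ∃ w' ∈ insert 0 D, w ≠ w' ∧ (w ≠ α ∧ w ≠ α + t) ∧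
        (w' ≠ α ∧ w' ≠ α + t) ∧ ¬ (w ∈ block (D, α) ∪ block (D, α + t) ∧
          w' ∈ block (D, α) ∪ block (D, α + t)) :=
      ⟨0, hT.1, α - t, hT.2.1, by grind, by grind, by grind, fun h => n1 h.2⟩
    have p02 : ∃ w ∈ insert 0 D, ∃ w' ∈ insert 0 D, w ≠ w' ∧ (w ≠ α ∧ w ≠ α - t) ∧
        (w' ≠ α ∧ w' ≠ α - t) ∧ ¬ (w ∈ block (D, α) ∪ block (D, α - t) ∧
          w' ∈ block (D, α) ∪ block (D, α - t)) :=
      ⟨0, hT.1, α + t, hT.2.2, by grind, by grind, by grind, fun h => n2 h.2⟩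
    intro k hk k' hk' hne
    rcases hoth k hk with rfl | rfl | rfl <;> rcases hoth k' hk' with rfl | rfl | rfl
    · exact absurd rfl hne
    · obtain ⟨w, hw, w', hw', h, ha, hb, hc⟩ := p02
      exact Or.inr ⟨by rw [Finset.inter_comm, e02], w, hw, w', hw', h, ha.symm, hb.symm,
        by rwa [Finset.union_comm]⟩
    · exact Or.inl (by rwa [Finset.inter_comm])
    · exact Or.inr ⟨e02, p02⟩
    · exact absurd rfl hne
    · exact Or.inr ⟨e01, p01⟩
    · exact Or.inl e12
    · obtain ⟨w, hw, w', hw', h, ha, hb, hc⟩ := p01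
      exact Or.inr ⟨by rw [Finset.inter_comm, e01], w, hw, w', hw', h, ha.symm, hb.symm,
        by rwa [Finset.union_comm]⟩
    · exact absurd rfl hne
  · have e21 : (block (D, α - t) ∩ block (D, α + t)).card ≤ 1 := by rwa [Finset.inter_comm]
    intro k hk k' hk' k'' hk'' h h' h''
    rcases hoth k hk with rfl | rfl | rfl <;> rcases hoth k' hk' with rfl | rfl | rfl <;>
      rcases hoth k'' hk'' with rfl | rfl | rfl <;>
      first
        | exact absurd rfl h
        | exact absurd rfl h'
        | exact absurd rfl h''
        | exact Or.inl e12
        | exact Or.inl e21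
        | exact Or.inr (Or.inl e12)
        | exact Or.inr (Or.inl e21)
        | exact Or.inr (Or.inr e12)
        | exact Or.inr (Or.inr e21)

lemma sidon_mk {A B C : Z} (hA : A ≠ 0) (hB : B ≠ 0) (hC : C ≠ 0) (hAB : A ≠ B) (hAC : A ≠ C)
    (hBC : B ≠ C) (h1 : 2 * A ≠ B) (h2 : 2 * A ≠ C) (h3 : 2 * B ≠ A) (h4 : 2 * B ≠ C)
    (h5 : 2 * C ≠ A) (h6 : 2 * C ≠ B) (h7 : A ≠ B + C) (h8 : B ≠ A + C) (h9 : C ≠ A + B)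
    (h10 : A + B ≠ 0) (h11 : A + C ≠ 0) (h12 : B + C ≠ 0) (h13 : 2 * A ≠ 2 * B)
    (h14 : 2 * A ≠ 2 * C) (h15 : 2 * B ≠ 2 * C) (h16 : 2 * A ≠ B + C) (h17 : 2 * B ≠ A + C)
    (h18 : 2 * C ≠ A + B) : Sidon ({A, B, C} : Finset Z) := by
  refine ⟨Finset.card_eq_three.2 ⟨A, B, C, hAB, hAC, hBC, rfl⟩, by simp; grind, ?_⟩
  intro a ha b hb c hc d hd e
  simp only [Finset.mem_insert, Finset.mem_singleton] at ha hb hc hd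
  rcases ha with rfl | rfl | rfl | rfl <;> rcases hb with rfl | rfl | rfl | rfl <;>
    rcases hc with rfl | rfl | rfl | rfl <;> rcases hd with rfl | rfl | rfl | rfl <;> grind

end

lemma intCast_ne {n : ℕ} {x y : ℤ} (h : x - y < 2 * n ∧ y - x < 2 * n := by omega)
    (h0 : x ≠ y := by omega) (h1 : x ≠ y + n := by omega) (h2 : y ≠ x + n := by omega) :
    (x : ZMod n) ≠ y := by
  rw [ne_eq, ← sub_eq_zero, ← Int.cast_sub, ZMod.intCast_zmod_eq_zero_iff_dvd]
  rintro ⟨k, hk⟩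
  have hn : (0 : ℤ) ≤ n := Int.natCast_nonneg n
  have k1 : k < 2 := by
    by_contra! hk'
    nlinarith
  have k2 : -2 < k := by
    by_contra! hk'
    nlinarith
  have : k = -1 ∨ k = 0 ∨ k = 1 := by omega
  rcases this with rfl | rfl | rfl <;> omega

lemma separable_trapezoid {n : ℕ} {p q s : ℤ} (hn : (n : ℤ) = 2 * p + q + s) (hp : 0 < p)
    (hq : 0 < q) (hqs : q < s) (hpq : p ≠ q) (hps : p ≠ s) (hs : s ≠ p + q) :
    Separable4 n {0, p, p + q, 2 * p + q} := by
  have : NeZero n := ⟨by rintro rfl; omega⟩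
  set D : Finset (ZMod n) :=
    {(p : ZMod n), ((p + q : ℤ) : ZMod n), p + ((p + q : ℤ) : ZMod n)} with hD
  have hadm : Admissible {D} D := by
    apply admissible_trapezoid
    · exact_mod_cast intCast_ne (n := n) (x := p) (y := 0)
    · exact_mod_cast intCast_ne (n := n) (x := p + q) (y := 0)
    · exact_mod_cast intCast_ne (n := n) (x := p + (p + q)) (y := 0)
    · exact_mod_cast intCast_ne (n := n) (x := 2 * p) (y := 0)
    · exact_mod_cast intCast_ne (n := n) (x := 2 * (p + q)) (y := 0)
    · exact_mod_cast intCast_ne (n := n) (x := p) (y := p + q)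
    · exact_mod_cast intCast_ne (n := n) (x := 2 * p) (y := p + q)
    · exact_mod_cast intCast_ne (n := n) (x := 2 * (p + q)) (y := p)
    · exact_mod_cast intCast_ne (n := n) (x := 2 * p + (p + q)) (y := 0)
    · exact_mod_cast intCast_ne (n := n) (x := p + 2 * (p + q)) (y := 0)
    · exact_mod_cast intCast_ne (n := n) (x := 2 * p) (y := 2 * (p + q))
  refine separable_of_admissible (by omega) {D} fun e he => ?_
  rcases he with rfl | rfl
  · refine ⟨_, 0, hadm, ?_⟩
    simp only [hD, Finset.mem_insert, Finset.mem_singleton, forall_eq_or_imp, forall_eq]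
    refine ⟨⟨0, by simp, by simp⟩, ⟨p, by simp, by simp⟩, ⟨p + q, by simp, by simp⟩,
      ⟨2 * p + q, by simp, by push_cast; ring⟩⟩
  · refine ⟨_, -((2 * p + q : ℤ) : ZMod n), hadm, ?_⟩
    simp only [hD, Finset.mem_insert, Finset.mem_singleton, forall_eq_or_imp, forall_eq]
    refine ⟨⟨2 * p + q, by simp, by push_cast; ring⟩, ⟨p + q, by simp, by push_cast; ring⟩,
      ⟨p, by simp, by push_cast; ring⟩, ⟨0, by simp, by push_cast; ring⟩⟩

lemma separable_kite {n : ℕ} {p q : ℤ} (hn : (n : ℤ) = 2 * p + 2 * q) (hp : 0 < p) (hq : 0 < q)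
    (hpq : p ≠ q) (h1 : q ≠ 2 * p) (h2 : p ≠ 2 * q) :
    Separable4 n {0, q, p + q, 2 * p + q} := by
  have : NeZero n := ⟨by rintro rfl; omega⟩
  set α : ZMod n := ((p + q : ℤ) : ZMod n) with hα
  have h2α : α + α = 0 := by
    have : ((n : ℤ) : ZMod n) = 0 := by simp
    rw [hn] at this
    rw [hα]
    push_cast at this ⊢
    linear_combination this
  set D : Finset (ZMod n) := {α - (p : ZMod n), α, α + (p : ZMod n)} with hD
  have hadm : Admissible {D} D := by
    apply admissible_kite h2α
    · exact_mod_cast intCast_ne (n := n) (x := p + q) (y := 0)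
    · exact_mod_cast intCast_ne (n := n) (x := p + q) (y := p)
    · exact_mod_cast intCast_ne (n := n) (x := p + q) (y := 2 * p)
    · exact_mod_cast intCast_ne (n := n) (x := p + q) (y := 3 * p)
    · exact_mod_cast intCast_ne (n := n) (x := p) (y := 0)
    · exact_mod_cast intCast_ne (n := n) (x := 2 * p) (y := 0)
    · exact_mod_cast intCast_ne (n := n) (x := 3 * p) (y := 0)
    · exact_mod_cast intCast_ne (n := n) (x := 4 * p) (y := 0)
  refine separable_of_admissible (by omega) {D} fun e he => ?_
  refine ⟨_, 0, hadm, ?_⟩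
  rw [hD, hα]
  rw [hα] at h2α
  push_cast at h2α ⊢
  simp only [Finset.mem_insert, Finset.mem_singleton, forall_eq_or_imp, forall_eq]
  rcases he with rfl | rfl
  · refine ⟨⟨0, by simp, by simp⟩, ⟨q, by simp, by simp⟩, ⟨p + q, by simp, by simp⟩,
      ⟨2 * p + q, by simp, by push_cast; ring⟩⟩
  · refine ⟨⟨0, by simp, by simp⟩, ⟨2 * p + q, by simp, ?_⟩, ⟨p + q, by simp, ?_⟩,
      ⟨q, by simp, ?_⟩⟩ <;> push_cast <;> linear_combination -h2α

lemma separable_generic {n : ℕ} {a b c d : ℤ} (hn : (n : ℤ) = a + b + c + d) (ha : 0 < a)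
    (hb : 0 < b) (hc : 0 < c) (hd : 0 < d) (hab : a ≠ b) (hbc : b ≠ c) (hcd : c ≠ d) (hda : d ≠ a)
    (hac : a ≠ c) (hbd : b ≠ d) (ha1 : a ≠ b + c) (ha2 : a ≠ c + d) (hb1 : b ≠ c + d)
    (hb2 : b ≠ d + a) (hc1 : c ≠ d + a) (hc2 : c ≠ a + b) (hd1 : d ≠ a + b) (hd2 : d ≠ b + c)
    (hb3 : b ≠ a + c + d) (hc3 : c ≠ a + b + d) (hbc3 : b + c ≠ a + d) :
    Separable4 n {0, a, a + b, a + b + c} := by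
  have : NeZero n := ⟨by rintro rfl; omega⟩
  set D : Finset (ZMod n) :=
    {(a : ZMod n), ((a + b : ℤ) : ZMod n), ((a + b + c : ℤ) : ZMod n)} with hD
  have hS : Sidon D := by
    apply sidon_mk
    · exact_mod_cast intCast_ne (n := n) (x := a) (y := 0)
    · exact_mod_cast intCast_ne (n := n) (x := a + b) (y := 0)
    · exact_mod_cast intCast_ne (n := n) (x := a + b + c) (y := 0)
    · exact_mod_cast intCast_ne (n := n) (x := a) (y := a + b)
    · exact_mod_cast intCast_ne (n := n) (x := a) (y := a + b + c)
    · exact_mod_cast intCast_ne (n := n) (x := a + b) (y := a + b + c)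
    · exact_mod_cast intCast_ne (n := n) (x := 2 * a) (y := a + b)
    · exact_mod_cast intCast_ne (n := n) (x := 2 * a) (y := a + b + c)
    · exact_mod_cast intCast_ne (n := n) (x := 2 * (a + b)) (y := a)
    · exact_mod_cast intCast_ne (n := n) (x := 2 * (a + b)) (y := a + b + c)
    · exact_mod_cast intCast_ne (n := n) (x := 2 * (a + b + c)) (y := a)
    · exact_mod_cast intCast_ne (n := n) (x := 2 * (a + b + c)) (y := a + b)
    · exact_mod_cast intCast_ne (n := n) (x := a) (y := (a + b) + (a + b + c))
    · exact_mod_cast intCast_ne (n := n) (x := a + b) (y := a + (a + b + c))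
    · exact_mod_cast intCast_ne (n := n) (x := a + b + c) (y := a + (a + b))
    · exact_mod_cast intCast_ne (n := n) (x := a + (a + b)) (y := 0)
    · exact_mod_cast intCast_ne (n := n) (x := a + (a + b + c)) (y := 0)
    · exact_mod_cast intCast_ne (n := n) (x := (a + b) + (a + b + c)) (y := 0)
    · exact_mod_cast intCast_ne (n := n) (x := 2 * a) (y := 2 * (a + b))
    · exact_mod_cast intCast_ne (n := n) (x := 2 * a) (y := 2 * (a + b + c))
    · exact_mod_cast intCast_ne (n := n) (x := 2 * (a + b)) (y := 2 * (a + b + c))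
    · exact_mod_cast intCast_ne (n := n) (x := 2 * a) (y := (a + b) + (a + b + c))
    · exact_mod_cast intCast_ne (n := n) (x := 2 * (a + b)) (y := a + (a + b + c))
    · exact_mod_cast intCast_ne (n := n) (x := 2 * (a + b + c)) (y := a + (a + b))
  have hS' := hS.neg.admissible
  rw [Finset.image_image, neg_comp_neg, Finset.image_id, Finset.pair_comm] at hS'
  refine separable_of_admissible (by omega) {D, D.image Neg.neg} fun e he => ?_
  rcases he with rfl | rfl
  · refine ⟨_, 0, hS.admissible, ?_⟩
    simp only [hD, Finset.mem_insert, Finset.mem_singleton, forall_eq_or_imp, forall_eq]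
    refine ⟨⟨0, by simp, by simp⟩, ⟨a, by simp, by simp⟩, ⟨a + b, by simp, by simp⟩,
      ⟨a + b + c, by simp, by simp⟩⟩
  · refine ⟨_, 0, hS', ?_⟩
    simp only [hD, Finset.image_insert, Finset.image_singleton, Finset.mem_insert,
      Finset.mem_singleton, forall_eq_or_imp, forall_eq]
    refine ⟨⟨0, by simp, by simp⟩, ⟨a, by simp, by simp⟩, ⟨a + b, by simp, by simp⟩,
      ⟨a + b + c, by simp, by simp⟩⟩

/-- The marks cutting a circle of circumference `n` into arcs with lengths `a, b, c` and the rest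
are separable. -/
def SeparableArcs (n : ℕ) (a b c : ℤ) : Prop := Separable4 n {0, a, a + b, a + b + c}

section

variable {n : ℕ} {a b c d p q : ℤ}

lemma SeparableArcs.rotate (hn : 0 < n) (h : SeparableArcs n a b c) (hs : (n : ℤ) = a + b + c + d) :
    SeparableArcs n b c d := by
  refine h.congr hn (-a) 1 (Or.inl rfl) ?_
  simp only [Set.mem_insert_iff, Set.mem_singleton_iff, forall_eq_or_imp, forall_eq]
  exact ⟨⟨b + c + d, by simp, -1, by linarith⟩, ⟨0, by simp, 0, by ring⟩,
    ⟨b, by simp, 0, by ring⟩, ⟨b + c, by simp, 0, by ring⟩⟩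

lemma SeparableArcs.reflect (hn : 0 < n) (h : SeparableArcs n a b c) : SeparableArcs n c b a := by
  refine h.congr hn (a + b + c) (-1) (Or.inr rfl) ?_
  simp only [Set.mem_insert_iff, Set.mem_singleton_iff, forall_eq_or_imp, forall_eq]
  exact ⟨⟨c + b + a, by simp, 0, by ring⟩, ⟨c + b, by simp, 0, by ring⟩,
    ⟨c, by simp, 0, by ring⟩, ⟨0, by simp, 0, by ring⟩⟩

lemma separableArcs_kite (hp : 0 < p) (hq : 0 < q) (hpq : p ≠ q) (hn : (n : ℤ) = 2 * p + 2 * q) :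
    SeparableArcs n p p q := by
  have h0 : 0 < n := by omega
  have special : ∀ {p q : ℤ}, 0 < p → (n : ℤ) = 2 * p + 2 * q → q = 2 * p →
      SeparableArcs n p p q := by
    intro p q hp hn hq
    lift p to ℕ using hp.le
    obtain rfl : n = 6 * p := by omega
    subst hq
    refine (separable_kite_one_two (by omega)).congr h0 0 1 (Or.inl rfl) ?_
    simp only [Set.mem_insert_iff, Set.mem_singleton_iff, forall_eq_or_imp, forall_eq]
    exact ⟨⟨0, by simp, 0, by ring⟩, ⟨p, by simp, 0, by ring⟩, ⟨p + p, by simp, 0, by ring⟩,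
      ⟨p + p + 2 * p, by simp, 0, by ring⟩⟩
  by_cases h1 : q = 2 * p
  · exact special hp hn h1
  by_cases h2 : p = 2 * q
  · have h := special hq (by omega) h2
    exact (h.rotate (d := p) h0 (by omega)).rotate (d := q) h0 (by omega)
  · have h : SeparableArcs n q p p := by
      have := separable_kite hn hp hq hpq h1 h2
      rw [SeparableArcs]
      convert this using 4 <;> ring_nf
    exact h.rotate (d := q) h0 (by omega)

lemma separableArcs_progression (hp : 0 < p) (hq : 0 < q) (hpq : p ≠ q)
    (hn : (n : ℤ) = 3 * p + 2 * q) : SeparableArcs n p q p := by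
  have h0 : 0 < n := by omega
  lift p to ℕ using hp.le
  lift q to ℕ using hq.le
  obtain rfl : n = 3 * p + 2 * q := by omega
  refine (separable_progression (by omega) (by omega) (by omega)).congr h0 (-(2 * (p + q))) 1
    (Or.inl rfl) ?_
  simp only [Set.mem_insert_iff, Set.mem_singleton_iff, forall_eq_or_imp, forall_eq]
  exact ⟨⟨p, by simp, -1, by push_cast; ring⟩, ⟨p + q + p, by simp, -1, by push_cast; ring⟩,
    ⟨0, by simp, 0, by ring⟩, ⟨p + q, by simp, 0, by ring⟩⟩

lemma separableArcs_rectangle (hp : 0 < p) (hq : 0 < q) (hpq : p ≠ q)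
    (hn : (n : ℤ) = 2 * p + 2 * q) : SeparableArcs n p q p := by
  have h0 : 0 < n := by omega
  have special : ∀ {p q : ℤ}, 0 < p → (n : ℤ) = 2 * p + 2 * q → q = 2 * p →
      SeparableArcs n p q p := by
    intro p q hp hn hq
    lift p to ℕ using hp.le
    obtain rfl : n = 6 * p := by omega
    subst hq
    refine (separable_rectangle_one_two (by omega)).congr h0 0 1 (Or.inl rfl) ?_
    simp only [Set.mem_insert_iff, Set.mem_singleton_iff, forall_eq_or_imp, forall_eq]
    exact ⟨⟨0, by simp, 0, by ring⟩, ⟨p, by simp, 0, by ring⟩, ⟨p + 2 * p, by simp, 0, by ring⟩,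
      ⟨p + 2 * p + p, by simp, 0, by ring⟩⟩
  by_cases h1 : q = 2 * p
  · exact special hp hn h1
  by_cases h2 : p = 2 * q
  · exact (special hq (by omega) h2).rotate (d := p) h0 (by omega)
  · obtain ⟨h, rfl⟩ : ∃ h : ℕ, n = 2 * h := ⟨n / 2, by omega⟩
    have hh : (h : ℤ) = p + q := by push_cast at hn; linarith
    have hdvd : ∀ x : ℤ, 0 < x → x < 6 * h → x ≠ 2 * h → x ≠ 4 * h → ¬ (2 * h : ℤ) ∣ x := by
      rintro x hx hx' hx2 hx4 ⟨k, rfl⟩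
      have k0 : 0 < k := by
        by_contra! hk
        nlinarith
      have k3 : k < 3 := by
        by_contra! hk
        nlinarith
      have : k = 1 ∨ k = 2 := by omega
      rcases this with rfl | rfl <;> omega
    refine (separable_rectangle (by omega) p (hdvd _ ?_ ?_ ?_ ?_) (hdvd _ ?_ ?_ ?_ ?_)
      (hdvd _ ?_ ?_ ?_ ?_)).congr h0 0 1 (Or.inl rfl) ?_
    all_goals try omega
    simp only [Set.mem_insert_iff, Set.mem_singleton_iff, forall_eq_or_imp, forall_eq]
    exact ⟨⟨0, by simp, 0, by ring⟩, ⟨p, by simp, 0, by ring⟩,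
      ⟨p + q, by simp, 0, by rw [hh]; ring⟩,
      ⟨p + q + p, by simp, 0, by rw [hh]; ring⟩⟩

lemma separableArcs_trapezoid (ha : 0 < a) (hb : 0 < b) (hd : 0 < d) (hab : a ≠ b) (had : a ≠ d)
    (hd' : d ≠ a + b) (hb' : b ≠ a + d) (hn : (n : ℤ) = 2 * a + b + d) : SeparableArcs n a b a := by
  have key : ∀ {b d : ℤ}, (n : ℤ) = 2 * a + b + d → 0 < b → b < d → a ≠ b → a ≠ d → d ≠ a + b →
      SeparableArcs n a b a := by
    intro b d hn hb hbd hab had hd'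
    have := separable_trapezoid hn ha hb hbd hab had hd'
    rw [SeparableArcs]
    convert this using 4
    ring_nf
  have h0 : 0 < n := by omega
  rcases lt_trichotomy b d with h | rfl | h
  · exact key hn hb h hab had hd'
  · exact separableArcs_rectangle ha hb hab (by omega)
  · have := key (by omega) hd h had hab (by omega)
    exact (this.rotate (d := b) h0 (by omega)).rotate (d := a) h0 (by omega)

lemma separableArcs_scalene (hn : (n : ℤ) = a + b + c + d) (ha : 0 < a) (hb : 0 < b) (hc : 0 < c)
    (hd : 0 < d) (hab : a ≠ b) (hbc : b ≠ c) (hcd : c ≠ d) (hda : d ≠ a)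
    (ha1 : a ≠ b + c) (ha2 : a ≠ c + d) (hb1 : b ≠ c + d) (hb2 : b ≠ d + a) (hc1 : c ≠ d + a)
    (hc2 : c ≠ a + b) (hd1 : d ≠ a + b) (hd2 : d ≠ b + c) : SeparableArcs n a b c := by
  have h0 : 0 < n := by omega
  by_cases hac : a = c
  · subst hac
    exact separableArcs_trapezoid ha hb hd hab (by omega) (by omega) (by omega) (by omega)
  by_cases hbd : b = d
  · subst hbd
    have : SeparableArcs n b a b :=
      separableArcs_trapezoid hb ha hc (by omega) (by omega) (by omega) (by omega) (by omega)
    exact this.rotate h0 (by omega)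
  by_cases h1 : b ≠ a + c + d ∧ c ≠ a + b + d ∧ b + c ≠ a + d
  · exact separable_generic hn ha hb hc hd hab hbc hcd hda hac hbd ha1 ha2 hb1 hb2 hc1 hc2 hd1 hd2
      h1.1 h1.2.1 h1.2.2
  by_cases h2 : c ≠ b + d + a ∧ d ≠ b + c + a ∧ c + d ≠ b + a
  · have : SeparableArcs n b c d := separable_generic (by omega) hb hc hd ha hbc hcd hda hab
      hbd (Ne.symm hac) hb1 hb2 hc1 hc2 hd1 hd2 ha1 ha2 h2.1 h2.2.1 h2.2.2
    exact ((this.rotate h0 (d := a) (by omega)).rotate h0 (d := b) (by omega)).rotate h0 (by omega)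
  have : SeparableArcs n d a b := separable_generic (by omega) hd ha hb hc hda hab hbc hcd
    (Ne.symm hbd) hac hd1 hd2 ha1 ha2 hb1 hb2 hc1 hc2 (by omega) (by omega) (by omega)
  exact this.rotate h0 (by omega)

end

/-- No rearrangement of `(a, b, c, d)` has an excluded shape. -/
def DihedrallyAdmissible (a b c d : ℕ) : Prop :=
  ∀ v ∈ dihedralVersions a b c d, ¬ ExcludedShape v

namespace DihedrallyAdmissible

variable {n a b c d : ℕ}

lemma rotate (h : DihedrallyAdmissible a b c d) : DihedrallyAdmissible b c d a := by
  intro v hv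
  refine h v ?_
  simp only [dihedralVersions, List.mem_cons, List.not_mem_nil, or_false] at hv ⊢
  tauto

lemma reflect (h : DihedrallyAdmissible a b c d) : DihedrallyAdmissible c b a d := by
  intro v hv
  refine h v ?_
  simp only [dihedralVersions, List.mem_cons, List.not_mem_nil, or_false] at hv ⊢
  tauto

lemma not_excludedShape (h : DihedrallyAdmissible a b c d) : ¬ ExcludedShape (a, b, c, d) :=
  h _ (by simp [dihedralVersions])

lemma le_of_eq (h : DihedrallyAdmissible a b c d) (ha : 0 < a) (hc : 0 < c) (hab : a = b) :
    d ≤ c := by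
  subst hab
  by_contra! hcd
  exact h.not_excludedShape (Or.inr <| Or.inr <| Or.inr
    ⟨a, c, d - c, ha, hc, by omega, by simp [Nat.add_sub_cancel' hcd.le]⟩)

lemma separableArcs_of_eq (h : DihedrallyAdmissible a b c d) (ha : 0 < a) (hc : 0 < c)
    (hd : 0 < d) (hn : n = a + b + c + d) (hab : a = b) : SeparableArcs n a b c := by
  obtain rfl : c = d := le_antisymm
    (h.reflect.rotate.le_of_eq (by omega) hd hab.symm)
    (h.le_of_eq ha hc hab)
  subst hab
  have hac : a ≠ c := by
    rintro rfl
    exact h.not_excludedShape (Or.inl ⟨a, ha, rfl⟩)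
  exact separableArcs_kite (by omega) (by omega) (by omega) (by omega)

lemma separableArcs_of_eq_add (h : DihedrallyAdmissible a b c d) (ha : 0 < a) (hb : 0 < b)
    (hc : 0 < c) (hn : n = a + b + c + d) (hd : d = a + b) : SeparableArcs n a b c := by
  by_cases hab : a = b
  · exact h.separableArcs_of_eq ha hc (by omega) hn hab
  subst hd
  have hc' : c ≠ a + b := by
    rintro rfl
    exact h.not_excludedShape (Or.inr <| Or.inl ⟨a, b, ha, hb, hab, rfl⟩)
  obtain rfl : c = a := by
    by_contra hca
    exact h.not_excludedShape (Or.inr <| Or.inr <| Or.inl ⟨a, b, c, ha, hb, hc, hca, hc', rfl⟩)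
  exact separableArcs_progression (by omega) (by omega) (by omega) (by omega)

/-- The two coincidences handled directly, for the first two arcs of the quadruple. -/
lemma separableArcs_of_coincidence (h : DihedrallyAdmissible a b c d) (ha : 0 < a) (hb : 0 < b)
    (hc : 0 < c) (hd : 0 < d) (hn : n = a + b + c + d) (hab : a = b ∨ d = a + b ∨ c = a + b) :
    SeparableArcs n a b c := by
  obtain hab | hab | hab := hab
  · exact h.separableArcs_of_eq ha hc hd hn hab
  · exact h.separableArcs_of_eq_add ha hb hc hn hab
  · have hr : SeparableArcs n b a d :=
      h.reflect.rotate.separableArcs_of_eq_add hb ha hd (by omega) (by omega)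
    exact (hr.reflect (by omega)).rotate (by omega) (by omega)

lemma separableArcs (h : DihedrallyAdmissible a b c d) (ha : 0 < a) (hb : 0 < b)
    (hc : 0 < c) (hd : 0 < d) (hn : n = a + b + c + d) : SeparableArcs n a b c := by
  by_cases h1 : a = b ∨ d = a + b ∨ c = a + b
  · exact h.separableArcs_of_coincidence ha hb hc hd hn h1
  by_cases h2 : b = c ∨ a = b + c ∨ d = b + c
  · exact (((h.rotate.separableArcs_of_coincidence hb hc hd ha (by omega) h2).rotate (d := a)
      (by omega) (by omega)).rotate (d := b) (by omega) (by omega)).rotate (d := c)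
      (by omega) (by omega)
  by_cases h3 : c = d ∨ b = c + d ∨ a = c + d
  · exact ((h.rotate.rotate.separableArcs_of_coincidence hc hd ha hb (by omega) h3).rotate
      (d := b) (by omega) (by omega)).rotate (d := c) (by omega) (by omega)
  by_cases h4 : d = a ∨ c = d + a ∨ b = d + a
  · exact (h.rotate.rotate.rotate.separableArcs_of_coincidence hd ha hb hc (by omega) h4).rotate
      (d := c) (by omega) (by omega)
  exact separableArcs_scalene (d := d) (by omega) (by omega) (by omega) (by omega) (by omega)
    (by omega) (by omega) (by omega) (by omega) (by omega) (by omega) (by omega) (by omega)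
    (by omega) (by omega) (by omega) (by omega)

end DihedrallyAdmissible

/-- If `(a₁,a₂,a₃,a₄)` is not equal, up to cyclic rotation and/or reversal,
to a quadruple of any of the excluded shapes, then there exists a continuous
`Q₄ₙ`-equivariant map `F : S³ → M_D(α)`. -/
theorem exists_quaternion_equivariant_map (n a₁ a₂ a₃ a₄ : ℕ) (hn : 1 ≤ n)
    (h1 : 0 < a₁) (h2 : 0 < a₂) (h3 : 0 < a₃) (h4 : 0 < a₄)
    (hsum : a₁ + a₂ + a₃ + a₄ = n)
    (hα : ∀ b ∈ dihedralVersions a₁ a₂ a₃ a₄, ¬ ExcludedShape b) :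
    ExistsQuatEquivariantMap n a₁ a₂ a₃ a₄ := by
  refine exists_map_of_separable hn hsum ?_
  exact DihedrallyAdmissible.separableArcs hα h1 h2 h3 h4 hsum.symm
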